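/- Let i ≥ 1 be such that #f_i = 2, let d ∈ f_i, and let J be an invariant-factor count function for d. Then lim_{n→∞} ((1/n)·Σ_{m=1}^n J(m))/(log log n)^{1/2} = σ_i/√(2π). -/

import Mathlib

open MeasureTheory ProbabilityTheory Filter

noncomputable section

/-- A key encoding the lexicographic order on pairs `(φ(q), q)`; this is a valid
encoding on prime powers since every prime power satisfies `q ≤ 2 * φ(q)`. -/
def ppKey (q : ℕ) : ℕ := 2 * Nat.totient q ^ 2 + q

/-- The `n`-th smallest key of a prime power (0-indexed). -/
def ppNthKey (n : ℕ) : ℕ := Nat.nth (fun k => ∃ q : ℕ, IsPrimePow q ∧ ppKey q = k) n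

/-- The total φ-sequence `q̃_i` (1-indexed): the enumeration of all prime powers
ordered by nondecreasing totient, with ties broken by increasing size. -/
def qt (i : ℕ) : ℕ := sInf {q : ℕ | IsPrimePow q ∧ ppKey q = ppNthKey (i - 1)}

/-- `lcm(q̃_1, …, q̃_i)`. -/
def Lseq (i : ℕ) : ℕ := (Finset.Icc 1 i).lcm qt

/-- The universal factor order set `f_i`. -/
def UFO (i : ℕ) : Set ℕ :=
  if Nat.totient (qt i) < Nat.totient (qt (i + 1)) then {Lseq i}
  else {Lseq i, Nat.lcm (Lseq (i - 1)) (qt (i + 1))}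

/-- `φ(q̃_i)` as a real number. -/
def phiQ (i : ℕ) : ℝ := (Nat.totient (qt i) : ℝ)

/-- `μ_i = 1/φ(q̃_i) − 1/φ(q̃_{i+1})`. -/
def muSeq (i : ℕ) : ℝ := 1 / phiQ i - 1 / phiQ (i + 1)

/-- `σ_i = (1/φ(q̃_i) + 1/φ(q̃_{i+1}) − 2/(φ(q̃_i)·φ(q̃_{i+1})))^{1/2}`. -/
def sigSeq (i : ℕ) : ℝ :=
  Real.sqrt (1 / phiQ i + 1 / phiQ (i + 1) - 2 / (phiQ i * phiQ (i + 1)))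

/-- `σ_{i;a,b} = (φ(q̃_i)^{−a} + φ(q̃_{i+1})^{−b} − 2/(φ(q̃_i)·φ(q̃_{i+1})))^{1/2}`. -/
def sigAB (i a b : ℕ) : ℝ :=
  Real.sqrt (1 / phiQ i ^ a + 1 / phiQ (i + 1) ^ b - 2 / (phiQ i * phiQ (i + 1)))

/-- `ν_j = (φ(q̃_j)^{−1}·(1 − φ(q̃_j)^{−1}))^{1/2}`. -/
def nuSeq (j : ℕ) : ℝ := Real.sqrt (1 / phiQ j * (1 - 1 / phiQ j))

/-- `J` is an invariant-factor count function for `d`: whenever `(ℤ/mℤ)ˣ` is isomorphic to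
a direct product of cyclic groups `ℤ/λ_1 × ⋯ × ℤ/λ_K` with `1 < λ_1 ∣ λ_2 ∣ ⋯ ∣ λ_K`,
`J m` is the number of indices `j` with `λ_j = d`. -/
def IsInvCount (d : ℕ) (J : ℕ → ℕ) : Prop :=
  ∀ m : ℕ, 1 ≤ m → ∀ K : ℕ, ∀ lam : Fin K → ℕ,
    (∀ j, 1 < lam j) →
    (∀ j k : Fin K, j ≤ k → lam j ∣ lam k) →
    Nonempty ((ZMod m)ˣ ≃* Multiplicative (∀ j : Fin K, ZMod (lam j))) →
    J m = (Finset.univ.filter fun j : Fin K => lam j = d).card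

/-- The number of `m ∈ {1, …, n}` satisfying `P`. -/
def cnt (P : ℕ → Prop) (n : ℕ) : ℕ := {m : ℕ | 1 ≤ m ∧ m ≤ n ∧ P m}.ncard

/-- The average `(1/n)·∑_{m=1}^n J(m)`. -/
def avg (J : ℕ → ℕ) (n : ℕ) : ℝ := (∑ m ∈ Finset.Icc 1 n, (J m : ℝ)) / n

/-- `log log n`. -/
def LL (n : ℕ) : ℝ := Real.log (Real.log n)

/-- The standard normal cumulative distribution function. -/
def Phi (x : ℝ) : ℝ := (Real.sqrt (2 * Real.pi))⁻¹ * ∫ t in Set.Iic x, Real.exp (-t ^ 2 / 2)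

/-- Owen's T-function. -/
def OwenT (h a : ℝ) : ℝ :=
  (2 * Real.pi)⁻¹ * ∫ t in (0:ℝ)..a, Real.exp (-(1 + t ^ 2) * h ^ 2 / 2) / (1 + t ^ 2)

/-- The skew-normal cumulative distribution function with parameter `α`. -/
def PhiSkew (x α : ℝ) : ℝ := Phi x - 2 * OwenT x α

/-- The standard Gaussian probability measure `γ^k` on `ℝ^k`. -/
def stdGaussian (k : ℕ) : Measure (Fin k → ℝ) :=
  Measure.pi fun _ => gaussianReal 0 1

/-- `ω(m;q,1)`: the number of distinct primes `p ∣ m` with `p ≡ 1 (mod q)`. -/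
def omegaQ (m q : ℕ) : ℕ := (m.primeFactors.filter fun p => p % q = 1 % q).card

/-- The correction term `Ē(m;p^α)`. -/
def Ebar (m p α : ℕ) : ℕ :=
  if p ^ α = 2 ∧ 8 ∣ m then 2
  else if p ^ α = 2 ∧ 4 ∣ m ∧ ¬(8 ∣ m) then 1
  else if p = 2 ∧ 2 ≤ α ∧ 2 ^ (α + 2) ∣ m then 1
  else if p ≠ 2 ∧ p ^ (α + 1) ∣ m then 1
  else 0

/-- `prm(m;q)` for a prime power `q = p^α`: the unique `k` such that `p^k` is the cardinality
of the subgroup `{x ∈ (ℤ/mℤ)ˣ : x^p = 1 and x = y^{p^{α−1}} for some y}` (obtained here as the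
`p`-adic valuation of that cardinality; note `p = q.minFac` and `p^{α−1} = q / p`). -/
def prm (m q : ℕ) : ℕ :=
  (Nat.card {x : (ZMod m)ˣ // x ^ q.minFac = 1 ∧ ∃ y : (ZMod m)ˣ, y ^ (q / q.minFac) = x}).factorization
    q.minFac

/-- `m` is `y`-typical: for all prime powers `q₁, q₂` with `φ(q₁) ≤ y` and `φ(q₁) < φ(q₂)`
one has `prm(m;q₁) > prm(m;q₂)`. -/
def yTypical (y : ℝ) (m : ℕ) : Prop :=
  ∀ q₁ q₂ : ℕ, IsPrimePow q₁ → IsPrimePow q₂ →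
    (Nat.totient q₁ : ℝ) ≤ y → Nat.totient q₁ < Nat.totient q₂ →
    prm m q₂ < prm m q₁


theorem summable_re_char_mul_prime_rpow {N : ℕ} (χ : DirichletCharacter ℂ N) {s : ℝ}
    (hs : 1 < s) : Summable fun p : Nat.Primes => (χ p).re * (p : ℝ) ^ (-s) := by
  refine Summable.of_norm_bounded (g := fun p : Nat.Primes => (p : ℝ) ^ (-s))
    (Nat.Primes.summable_rpow.mpr (by linarith)) fun p => ?_
  rw [norm_mul, Real.norm_of_nonneg (by positivity : (0 : ℝ) ≤ (p : ℝ) ^ (-s))]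
  refine mul_le_of_le_one_left (by positivity) ?_
  exact (Complex.abs_re_le_norm _).trans (χ.norm_le_one _)

theorem abs_sum_re_char_sub_log_norm_le {N : ℕ} [NeZero N] (χ : DirichletCharacter ℂ N) {s : ℝ}
    (hs : 1 < s) :
    |∑' p : Nat.Primes, (χ p).re * (p : ℝ) ^ (-s) - Real.log ‖χ.LFunction s‖| ≤
      ∑' p : Nat.Primes, (p : ℝ) ^ (-2 : ℝ) := by
  have hs' : 1 < (s : ℂ).re := by simpa using hs
  have H := DirichletCharacter.summable_neg_log_one_sub_mul_prime_cpow χ hs'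
  have Hre := (Complex.hasSum_re H.hasSum).summable
  have hS2 : Summable fun p : Nat.Primes => (p : ℝ) ^ (-2 : ℝ) :=
    Nat.Primes.summable_rpow.mpr (by norm_num)
  rw [DirichletCharacter.LFunction_eq_LSeries χ hs',
    ← DirichletCharacter.LSeries_eulerProduct_exp_log χ hs', Complex.norm_exp, Real.log_exp,
    Complex.re_tsum H, ← (summable_re_char_mul_prime_rpow χ hs).tsum_sub Hre]
  have key : ∀ p : Nat.Primes, ‖(χ p).re * (p : ℝ) ^ (-s) -
      (-Complex.log (1 - χ p * (p : ℂ) ^ (-(s : ℂ)))).re‖ ≤ (p : ℝ) ^ (-2 : ℝ) := by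
    intro p
    have hp0 : (0 : ℝ) < p := by exact_mod_cast p.prop.pos
    have hp2 : (2 : ℝ) ≤ p := by exact_mod_cast p.prop.two_le
    set z : ℂ := χ p * (p : ℂ) ^ (-(s : ℂ)) with hz
    have hcp : (p : ℂ) ^ (-(s : ℂ)) = (((p : ℝ) ^ (-s) : ℝ) : ℂ) := by
      rw [Complex.ofReal_cpow hp0.le]; simp
    have hzre : z.re = (χ p).re * (p : ℝ) ^ (-s) := by
      rw [hz, hcp, Complex.re_mul_ofReal]
    have hps : (p : ℝ) ^ (-s) ≤ (p : ℝ) ^ (-1 : ℝ) :=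
      Real.rpow_le_rpow_of_exponent_le (by linarith) (by linarith)
    have hzn : ‖z‖ ≤ (p : ℝ) ^ (-1 : ℝ) := by
      rw [hz, norm_mul, hcp, Complex.norm_real, Real.norm_of_nonneg (by positivity)]
      exact (mul_le_of_le_one_left (by positivity) (χ.norm_le_one _)).trans hps
    have hhalf : (p : ℝ) ^ (-1 : ℝ) ≤ 1 / 2 := by
      rw [Real.rpow_neg_one, one_div]; gcongr
    have hz1 : ‖-z‖ < 1 := by rw [norm_neg]; linarith
    have h1 := Complex.norm_log_one_add_sub_self_le hz1
    rw [norm_neg] at h1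
    have h2 : (1 - ‖z‖)⁻¹ ≤ 2 := by
      rw [inv_le_comm₀ (by linarith) (by norm_num)]; linarith
    have h3 : ‖Complex.log (1 + -z) - -z‖ ≤ ‖z‖ ^ 2 := by
      refine h1.trans ?_
      have : ‖z‖ ^ 2 * (1 - ‖z‖)⁻¹ ≤ ‖z‖ ^ 2 * 2 := by gcongr
      linarith
    have h4 : ‖z‖ ^ 2 ≤ (p : ℝ) ^ (-2 : ℝ) := by
      have : ((p : ℝ) ^ (-1 : ℝ)) ^ 2 = (p : ℝ) ^ (-2 : ℝ) := by
        rw [← Real.rpow_natCast, ← Real.rpow_mul hp0.le]; norm_num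
      rw [← this]; gcongr
    rw [← hzre, ← Complex.sub_re]
    refine (Complex.abs_re_le_norm _).trans ?_
    have : z - -Complex.log (1 - z) = Complex.log (1 + -z) - -z := by ring_nf
    rw [this]
    exact h3.trans h4
  exact tsum_of_norm_bounded hS2.hasSum key

/-- The sum of `p ^ (-s)` over primes `p ≡ 1 (mod q)`. -/
def primeSeries (q : ℕ) (s : ℝ) : ℝ :=
  ∑' p : Nat.Primes, if (p : ℕ) % q = 1 % q then (p : ℝ) ^ (-s) else 0

theorem summable_primeSeries (q : ℕ) {s : ℝ} (hs : 1 < s) :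
    Summable fun p : Nat.Primes => if (p : ℕ) % q = 1 % q then (p : ℝ) ^ (-s) else 0 := by
  refine Summable.of_nonneg_of_le (fun p => ?_) (fun p => ?_)
    (Nat.Primes.summable_rpow.mpr (by linarith : -s < -1))
  · split_ifs <;> positivity
  · split_ifs
    · rfl
    · positivity

theorem totient_mul_primeSeries (q : ℕ) [NeZero q] {s : ℝ} (hs : 1 < s) :
    (q.totient : ℝ) * primeSeries q s =
      ∑ χ : DirichletCharacter ℂ q, ∑' p : Nat.Primes, (χ p).re * (p : ℝ) ^ (-s) := by
  rw [primeSeries, ← tsum_mul_left, ← Summable.tsum_finsetSum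
    (fun χ _ => summable_re_char_mul_prime_rpow χ hs)]
  refine tsum_congr fun p => ?_
  rw [← Finset.sum_mul, ← Complex.re_sum, DirichletCharacter.sum_characters_eq]
  have : ((p : ℕ) : ZMod q) = 1 ↔ (p : ℕ) % q = 1 % q := by
    have := ZMod.natCast_eq_natCast_iff' (p : ℕ) 1 q
    simpa using this
  by_cases h : (p : ℕ) % q = 1 % q
  · rw [if_pos h, if_pos (this.mpr h)]; simp
  · rw [if_neg h, if_neg (fun h' => h (this.mp h'))]; simp

theorem abs_totient_mul_primeSeries_sub_le (q : ℕ) [NeZero q] {s : ℝ} (hs : 1 < s) :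
    |(q.totient : ℝ) * primeSeries q s -
      ∑ χ : DirichletCharacter ℂ q, Real.log ‖χ.LFunction s‖| ≤
      q.totient * ∑' p : Nat.Primes, (p : ℝ) ^ (-2 : ℝ) := by
  rw [totient_mul_primeSeries q hs, ← Finset.sum_sub_distrib]
  refine (Finset.abs_sum_le_sum_abs _ _).trans ?_
  refine (Finset.sum_le_sum fun χ _ => abs_sum_re_char_sub_log_norm_le χ hs).trans ?_
  rw [Finset.sum_const, Finset.card_univ, nsmul_eq_mul, ← Nat.card_eq_fintype_card,
    DirichletCharacter.card_eq_totient_of_hasEnoughRootsOfUnity]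

/-- For fixed `q`, the series over primes `p ≡ 1 (mod q)` is `log (1 / (s - 1)) / φ(q) + O(1)`. -/
theorem exists_abs_primeSeries_sub_le (q : ℕ) [NeZero q] :
    ∃ C : ℝ, ∀ᶠ s : ℝ in nhdsWithin 1 (Set.Ioi 1),
      |primeSeries q s - Real.log (1 / (s - 1)) / q.totient| ≤ C := by
  classical
  have hφ : (0 : ℝ) < q.totient := by exact_mod_cast Nat.totient_pos.mpr (NeZero.pos q)
  set B : ℝ := ∑' p : Nat.Primes, (p : ℝ) ^ (-2 : ℝ)
  have hto : Tendsto (fun s : ℝ => (s : ℂ)) (nhdsWithin 1 (Set.Ioi 1)) (nhdsWithin 1 {1}ᶜ) := by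
    refine tendsto_nhdsWithin_iff.mpr ⟨?_, ?_⟩
    · have := (Complex.continuous_ofReal.tendsto 1).mono_left
        (nhdsWithin_le_nhds (s := Set.Ioi (1 : ℝ)))
      simpa using this
    · filter_upwards [self_mem_nhdsWithin] with s hs
      simp only [Set.mem_compl_iff, Set.mem_singleton_iff]
      norm_cast
      exact (ne_of_gt hs)
  have htriv : ∃ l : ℝ, Tendsto (fun s : ℝ => Real.log ‖((s : ℂ) - 1) *
      (1 : DirichletCharacter ℂ q).LFunction s‖) (nhdsWithin 1 (Set.Ioi 1)) (nhds l) := by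
    refine ⟨_, ((DirichletCharacter.LFunctionTrivChar_residue_one (N := q)).comp hto).norm.log ?_⟩
    rw [norm_ne_zero_iff, Finset.prod_ne_zero_iff]
    intro p hp h
    have hp' := (Nat.prime_of_mem_primeFactors hp)
    have h1 : (p : ℂ)⁻¹ = 1 := by linear_combination -h
    have : (p : ℂ) = 1 := by rw [← inv_inv (p : ℂ), h1, inv_one]
    exact hp'.one_lt.ne' (by exact_mod_cast this)
  have hnon : ∀ χ : DirichletCharacter ℂ q, χ ≠ 1 → ∃ l : ℝ, Tendsto (fun s : ℝ =>
      Real.log ‖χ.LFunction s‖) (nhdsWithin 1 (Set.Ioi 1)) (nhds l) := by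
    intro χ hχ
    have hc := (DirichletCharacter.differentiable_LFunction hχ).continuous.tendsto 1
    refine ⟨_, ((hc.mono_left nhdsWithin_le_nhds).comp hto).norm.log ?_⟩
    exact norm_ne_zero_iff.mpr (DirichletCharacter.LFunction_apply_one_ne_zero hχ)
  have hsum : ∃ l : ℝ, Tendsto (fun s : ℝ => (∑ χ : DirichletCharacter ℂ q,
      Real.log ‖χ.LFunction s‖) - Real.log (1 / (s - 1))) (nhdsWithin 1 (Set.Ioi 1)) (nhds l) := by
    obtain ⟨l0, hl0⟩ := htriv
    choose! l hl using hnon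
    refine ⟨l0 + ∑ χ ∈ Finset.univ.erase (1 : DirichletCharacter ℂ q), l χ, ?_⟩
    refine (hl0.add (tendsto_finsetSum _ fun χ hχ => hl χ (Finset.ne_of_mem_erase hχ))).congr' ?_
    filter_upwards [self_mem_nhdsWithin] with s hs
    have hs1 : (1 : ℝ) < s := hs
    rw [← Finset.add_sum_erase _ _ (Finset.mem_univ (1 : DirichletCharacter ℂ q)), norm_mul,
      Real.log_mul]
    · rw [one_div, Real.log_inv]
      have : ‖(s : ℂ) - 1‖ = s - 1 := by
        rw [← Complex.ofReal_one, ← Complex.ofReal_sub, Complex.norm_real,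
          Real.norm_of_nonneg (by linarith)]
      rw [this]; ring
    · rw [norm_ne_zero_iff, sub_ne_zero]; exact_mod_cast hs1.ne'
    · rw [norm_ne_zero_iff]
      refine DirichletCharacter.LFunction_ne_zero_of_one_le_re _ (Or.inr ?_) ?_
      · exact_mod_cast hs1.ne'
      · simpa using hs1.le
  obtain ⟨l, hl⟩ := hsum
  refine ⟨(|l| + 1) / q.totient + B, ?_⟩
  filter_upwards [self_mem_nhdsWithin, hl.abs.eventually_lt_const (lt_add_one _)] with s hs h1
  have h2 := abs_totient_mul_primeSeries_sub_le q hs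
  have h3 : |(q.totient : ℝ) * primeSeries q s - Real.log (1 / (s - 1))| ≤
      (|l| + 1) + q.totient * B := by
    have := abs_sub_le ((q.totient : ℝ) * primeSeries q s)
      (∑ χ : DirichletCharacter ℂ q, Real.log ‖χ.LFunction s‖) (Real.log (1 / (s - 1)))
    linarith
  have h4 : primeSeries q s - Real.log (1 / (s - 1)) / q.totient =
      ((q.totient : ℝ) * primeSeries q s - Real.log (1 / (s - 1))) / q.totient := by
    field_simp
  rw [h4, abs_div, abs_of_pos hφ, div_le_iff₀ hφ, add_mul, div_mul_cancel₀ _ hφ.ne']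
  linarith [mul_comm B (q.totient : ℝ)]

theorem norm_sum_range_char_le {q : ℕ} [NeZero q] {χ : DirichletCharacter ℂ q} (hχ : χ ≠ 1)
    (n : ℕ) : ‖∑ k ∈ Finset.range n, χ (k : ZMod q)‖ ≤ q := by
  have hper : ∑ k ∈ Finset.range q, χ (k : ZMod q) = 0 := by
    rw [← MulChar.sum_eq_zero_of_ne_one hχ, Finset.sum_range]
    refine Fintype.sum_equiv (ZMod.finEquiv q).toEquiv _ _ fun x => ?_
    obtain ⟨m, rfl⟩ := Nat.exists_eq_succ_of_ne_zero (NeZero.ne q)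
    congr 1
    exact Fin.cast_val_eq_self x
  induction n using Nat.strong_induction_on with
  | _ n ih =>
    by_cases h : n < q
    · calc ‖∑ k ∈ Finset.range n, χ (k : ZMod q)‖ ≤ ∑ k ∈ Finset.range n, ‖χ (k : ZMod q)‖ :=
            norm_sum_le _ _
        _ ≤ ∑ k ∈ Finset.range n, (1 : ℝ) := Finset.sum_le_sum fun k _ => χ.norm_le_one _
        _ ≤ q := by simpa using h.le
    · obtain ⟨m, rfl⟩ := Nat.exists_eq_add_of_le (not_lt.mp h)
      rw [Finset.sum_range_add, hper, zero_add]
      simpa using ih m (by have := NeZero.pos q; omega)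

theorem norm_sum_Icc_char_le_floor {q : ℕ} (χ : DirichletCharacter ℂ q) (n : ℕ) :
    ‖∑ k ∈ Finset.Icc 1 n, χ (k : ZMod q)‖ ≤ n :=
  calc ‖∑ k ∈ Finset.Icc 1 n, χ (k : ZMod q)‖ ≤ ∑ k ∈ Finset.Icc 1 n, ‖χ (k : ZMod q)‖ :=
        norm_sum_le _ _
    _ ≤ ∑ k ∈ Finset.Icc 1 n, (1 : ℝ) := Finset.sum_le_sum fun k _ => χ.norm_le_one _
    _ = n := by simp

theorem norm_sum_Icc_char_le {q : ℕ} [NeZero q] {χ : DirichletCharacter ℂ q} (hχ : χ ≠ 1)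
    (n : ℕ) : ‖∑ k ∈ Finset.Icc 1 n, χ (k : ZMod q)‖ ≤ q := by
  have h1 : χ ((0 : ℕ) : ZMod q) = 0 := by
    have : Nontrivial (ZMod q) := by
      refine ZMod.nontrivial_iff.mpr fun h => hχ ?_
      subst h
      exact Subsingleton.elim _ _
    rw [Nat.cast_zero]
    exact MulChar.map_zero χ
  have h2 := norm_sum_range_char_le hχ (n + 1)
  rw [Finset.sum_range_succ', h1, add_zero] at h2
  have h3 : ∑ k ∈ Finset.Icc 1 n, χ (k : ZMod q) =
      ∑ k ∈ Finset.range n, χ ((k + 1 : ℕ) : ZMod q) := by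
    rw [Finset.range_eq_Ico, Finset.sum_Ico_add' (fun k : ℕ => χ (k : ZMod q)) 0 n 1]
    rfl
  rwa [h3]

theorem LFunction_eq_mul_integral {q : ℕ} [NeZero q] (χ : DirichletCharacter ℂ q) {s : ℝ}
    (hs : 1 < s) :
    χ.LFunction s = s * ∫ t in Set.Ioi (1 : ℝ),
      (∑ k ∈ Finset.Icc 1 ⌊t⌋₊, χ (k : ZMod q)) * (t : ℂ) ^ (-((s : ℂ) + 1)) := by
  have hs' : 1 < (s : ℂ).re := by simpa using hs
  rw [DirichletCharacter.LFunction_eq_LSeries χ hs']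
  refine LSeries_eq_mul_integral (fun n => χ (n : ZMod q)) zero_le_one hs'
    (DirichletCharacter.LSeriesSummable_of_one_lt_re χ hs') ?_
  refine Asymptotics.isBigO_of_le _ fun n => ?_
  simpa using norm_sum_Icc_char_le_floor χ n

theorem norm_LFunction_le_integral {q : ℕ} [NeZero q] (χ : DirichletCharacter ℂ q) {s : ℝ}
    (hs : 1 < s) {h : ℝ → ℝ}
    (hinteg : IntegrableOn (fun t => h t * t ^ (-(s + 1))) (Set.Ioi 1))
    (hh : ∀ t : ℝ, 1 < t → ‖∑ k ∈ Finset.Icc 1 ⌊t⌋₊, χ (k : ZMod q)‖ ≤ h t) :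
    ‖χ.LFunction s‖ ≤ s * ∫ t in Set.Ioi (1 : ℝ), h t * t ^ (-(s + 1)) := by
  rw [LFunction_eq_mul_integral χ hs, norm_mul, Complex.norm_real,
    Real.norm_of_nonneg (by linarith)]
  refine mul_le_mul_of_nonneg_left ?_ (by linarith)
  refine norm_integral_le_of_norm_le hinteg ?_
  filter_upwards [ae_restrict_mem measurableSet_Ioi] with t ht
  have ht1 : (1 : ℝ) < t := ht
  rw [norm_mul, Complex.norm_cpow_eq_rpow_re_of_pos (by linarith)]
  have : (-((s : ℂ) + 1)).re = -(s + 1) := by simp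
  rw [this]
  exact mul_le_mul_of_nonneg_right (hh t ht) (by positivity)

theorem norm_LFunction_le {q : ℕ} [NeZero q] (χ : DirichletCharacter ℂ q) {s : ℝ} (hs : 1 < s) :
    ‖χ.LFunction s‖ ≤ s / (s - 1) := by
  have heq : Set.EqOn (fun t : ℝ => t ^ (-s)) (fun t : ℝ => t * t ^ (-(s + 1))) (Set.Ioi 1) := by
    intro t ht
    have ht0 : (0 : ℝ) < t := lt_trans one_pos ht
    simp only
    rw [← Real.rpow_one_add' ht0.le (by linarith)]
    ring_nf
  have h := norm_LFunction_le_integral χ hs (h := fun t => t)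
    ((integrableOn_Ioi_rpow_of_lt (by linarith : -s < -1) one_pos).congr_fun heq
      measurableSet_Ioi) fun t ht =>
      (norm_sum_Icc_char_le_floor χ _).trans (Nat.floor_le (by linarith))
  rw [← setIntegral_congr_fun measurableSet_Ioi heq,
    integral_Ioi_rpow_of_lt (by linarith) one_pos, Real.one_rpow] at h
  convert h using 1
  have : s - 1 ≠ 0 := by linarith
  have : -s + 1 ≠ 0 := by linarith
  field_simp
  ring

theorem norm_LFunction_le_log {q : ℕ} [NeZero q] {χ : DirichletCharacter ℂ q} (hχ : χ ≠ 1)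
    {s : ℝ} (hs : 1 < s) (hs2 : s ≤ 2) : ‖χ.LFunction s‖ ≤ 1 + 2 * Real.log q := by
  have hq1 : (1 : ℝ) ≤ q := by exact_mod_cast NeZero.pos q
  set h : ℝ → ℝ := fun t => if t ≤ q then t else q with hdef
  have hc1 : Set.EqOn (fun t : ℝ => t ^ (-s)) (fun t => h t * t ^ (-(s + 1)))
      (Set.Ioc 1 (q : ℝ)) := by
    intro t ht
    have ht0 : (0 : ℝ) < t := lt_trans one_pos ht.1
    simp only [hdef, if_pos ht.2]
    rw [← Real.rpow_one_add' ht0.le (by linarith)]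
    ring_nf
  have hc2 : Set.EqOn (fun t : ℝ => q * t ^ (-(s + 1))) (fun t => h t * t ^ (-(s + 1)))
      (Set.Ioi (q : ℝ)) := by
    intro t ht
    have ht' : ¬ t ≤ q := not_le.mpr ht
    simp only [hdef, if_neg ht']
  have hi1' : IntegrableOn (fun t : ℝ => t ^ (-s)) (Set.Ioc 1 (q : ℝ)) :=
    (integrableOn_Ioi_rpow_of_lt (by linarith : -s < -1) one_pos).mono_set Set.Ioc_subset_Ioi_self
  have hi1 := hi1'.congr_fun hc1 measurableSet_Ioc
  have hi2' : IntegrableOn (fun t : ℝ => (q : ℝ) * t ^ (-(s + 1))) (Set.Ioi (q : ℝ)) :=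
    (integrableOn_Ioi_rpow_of_lt (by linarith : -(s + 1) < -1)
      (by linarith : (0 : ℝ) < q)).const_mul (q : ℝ)
  have hi2 := hi2'.congr_fun hc2 measurableSet_Ioi
  have hunion : Set.Ioi (1 : ℝ) = Set.Ioc 1 (q : ℝ) ∪ Set.Ioi (q : ℝ) :=
    (Set.Ioc_union_Ioi_eq_Ioi hq1).symm
  have hb := norm_LFunction_le_integral χ hs (h := h) (by rw [hunion]; exact hi1.union hi2)
    fun t ht => by
      simp only [hdef]
      split_ifs
      · exact (norm_sum_Icc_char_le_floor χ _).trans (Nat.floor_le (by linarith))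
      · exact norm_sum_Icc_char_le hχ _
  rw [hunion, setIntegral_union (Set.Ioc_disjoint_Ioi le_rfl) measurableSet_Ioi hi1 hi2,
    ← setIntegral_congr_fun measurableSet_Ioc hc1, ← setIntegral_congr_fun measurableSet_Ioi hc2,
    integral_const_mul, integral_Ioi_rpow_of_lt (by linarith) (by linarith)] at hb
  have hlog : ∫ t in Set.Ioc 1 (q : ℝ), t ^ (-s) ≤ Real.log q := by
    have h1 : IntegrableOn (fun t : ℝ => t⁻¹) (Set.Ioc 1 (q : ℝ)) := by
      have := intervalIntegral.intervalIntegrable_inv (μ := volume) (a := 1) (b := (q : ℝ))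
        (f := fun x => x) (fun x hx => by
          rw [Set.uIcc_of_le hq1] at hx; have := hx.1; linarith) continuousOn_id
      exact (intervalIntegrable_iff_integrableOn_Ioc_of_le hq1).mp this
    have h2 : ∫ t in Set.Ioc 1 (q : ℝ), t⁻¹ = Real.log q := by
      rw [← intervalIntegral.integral_of_le hq1, integral_inv_of_pos one_pos (by linarith), div_one]
    rw [← h2]
    refine setIntegral_mono_on hi1' h1 measurableSet_Ioc fun t ht => ?_
    rw [← Real.rpow_neg_one]
    exact Real.rpow_le_rpow_of_exponent_le ht.1.le (by linarith)
  have hlog0 : 0 ≤ Real.log q := Real.log_nonneg hq1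
  have htail : (q : ℝ) * (-(q : ℝ) ^ (-(s + 1) + 1) / (-(s + 1) + 1)) = (q : ℝ) ^ (1 - s) / s := by
    rw [Real.rpow_sub (by linarith), Real.rpow_one]
    have : -(s + 1) + 1 = -s := by ring
    rw [this, Real.rpow_neg (by linarith)]
    have : s ≠ 0 := by linarith
    field_simp
  have h3 : (q : ℝ) ^ (1 - s) ≤ 1 := Real.rpow_le_one_of_one_le_of_nonpos hq1 (by linarith)
  rw [htail, mul_add, mul_div_cancel₀ _ (by linarith : s ≠ 0)] at hb
  nlinarith

/-- An upper bound, uniform in `q`, for the series over primes `p ≡ 1 (mod q)`. -/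
theorem primeSeries_le {q : ℕ} (hq : 2 ≤ q) {s : ℝ} (hs : 1 < s) (hs2 : s ≤ 2) :
    primeSeries q s ≤ Real.log (s / (s - 1)) / q.totient + Real.log (1 + 2 * Real.log q) +
      ∑' p : Nat.Primes, (p : ℝ) ^ (-2 : ℝ) := by
  classical
  have : NeZero q := ⟨by omega⟩
  have hφ : (0 : ℝ) < q.totient := by exact_mod_cast Nat.totient_pos.mpr (NeZero.pos q)
  have hlogq : 0 ≤ Real.log q := Real.log_nonneg (by exact_mod_cast (by omega : 1 ≤ q))
  have h1 := (abs_le.mp (abs_totient_mul_primeSeries_sub_le q hs)).2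
  have hll : 0 ≤ Real.log (1 + 2 * Real.log q) := Real.log_nonneg (by linarith)
  have hlog_le : ∀ {x y : ℝ}, 0 ≤ x → x ≤ y → 1 ≤ y → Real.log x ≤ Real.log y := by
    intro x y hx hxy hy
    rcases hx.eq_or_lt with rfl | hx
    · rw [Real.log_zero]; exact Real.log_nonneg hy
    · exact Real.log_le_log hx hxy
  have hcard : ((Finset.univ.erase (1 : DirichletCharacter ℂ q)).card : ℝ) ≤ q.totient := by
    have h2 := DirichletCharacter.card_eq_totient_of_hasEnoughRootsOfUnity ℂ q
    rw [Nat.card_eq_fintype_card] at h2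
    rw [← h2]
    exact_mod_cast Finset.card_le_univ _
  have h2 : ∑ χ : DirichletCharacter ℂ q, Real.log ‖χ.LFunction s‖ ≤
      Real.log (s / (s - 1)) + q.totient * Real.log (1 + 2 * Real.log q) := by
    rw [← Finset.add_sum_erase _ _ (Finset.mem_univ (1 : DirichletCharacter ℂ q))]
    refine add_le_add (hlog_le (norm_nonneg _) (norm_LFunction_le _ hs) ?_) ?_
    · rw [le_div_iff₀ (by linarith)]; linarith
    · refine (Finset.sum_le_card_nsmul _ _ (Real.log (1 + 2 * Real.log q)) fun χ hχ => ?_).trans ?_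
      · exact hlog_le (norm_nonneg _)
          (norm_LFunction_le_log (Finset.ne_of_mem_erase hχ) hs hs2) (by linarith)
      · rw [nsmul_eq_mul]
        exact mul_le_mul_of_nonneg_right hcard hll
  have h3 : primeSeries q s = (q.totient * primeSeries q s) / q.totient := by field_simp
  rw [h3, div_le_iff₀ hφ, add_mul, add_mul, div_mul_cancel₀ _ hφ.ne']
  linarith [mul_comm (Real.log (1 + 2 * Real.log q)) (q.totient : ℝ),
    mul_comm (∑' p : Nat.Primes, (p : ℝ) ^ (-2 : ℝ)) (q.totient : ℝ)]

/-- The primes `p ≤ N` with `p ≡ 1 (mod q)`. -/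
def primesAP (q N : ℕ) : Finset ℕ :=
  (Finset.Icc 1 N).filter fun p => p.Prime ∧ p % q = 1 % q

/-- The sum of `1 / p` over the primes `p ≤ N` with `p ≡ 1 (mod q)`. -/
def recipAP (q N : ℕ) : ℝ := ∑ p ∈ primesAP q N, (p : ℝ)⁻¹

theorem mem_primesAP {q N p : ℕ} :
    p ∈ primesAP q N ↔ p ≤ N ∧ p.Prime ∧ p % q = 1 % q := by
  simp only [primesAP, Finset.mem_filter, Finset.mem_Icc]
  constructor
  · rintro ⟨⟨_, h⟩, h1, h2⟩; exact ⟨h, h1, h2⟩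
  · rintro ⟨h, h1, h2⟩; exact ⟨⟨h1.one_lt.le, h⟩, h1, h2⟩

theorem recipAP_nonneg (q N : ℕ) : 0 ≤ recipAP q N :=
  Finset.sum_nonneg fun _ _ => by positivity

/-- The primes of `primesAP q N` as a finset of `Nat.Primes`. -/
theorem exists_primes_finset (q N : ℕ) : ∃ S : Finset Nat.Primes,
    (∀ p : Nat.Primes, p ∈ S ↔ (p : ℕ) ≤ N ∧ (p : ℕ) % q = 1 % q) ∧
    ∀ f : ℕ → ℝ, ∑ p ∈ primesAP q N, f p = ∑ p ∈ S, f (p : ℕ) := by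
  classical
  refine ⟨(primesAP q N).subtype Nat.Prime, fun p => ?_, fun f => ?_⟩
  · refine Finset.mem_subtype.trans (mem_primesAP.trans ?_)
    exact ⟨fun h => ⟨h.1, h.2.2⟩, fun h => ⟨h.1, p.prop, h.2⟩⟩
  · exact (Finset.sum_subtype_of_mem f fun p hp => (mem_primesAP.mp hp).2.1).symm

theorem sum_primesAP_rpow_le (q N : ℕ) {s : ℝ} (hs : 1 < s) :
    ∑ p ∈ primesAP q N, (p : ℝ) ^ (-s) ≤ primeSeries q s := by
  obtain ⟨S, hS, hf⟩ := exists_primes_finset q N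
  rw [hf fun p => (p : ℝ) ^ (-s)]
  calc ∑ p ∈ S, ((p : ℕ) : ℝ) ^ (-s)
      = ∑ p ∈ S, if (p : ℕ) % q = 1 % q then (p : ℝ) ^ (-s) else 0 :=
        Finset.sum_congr rfl fun p hp => by rw [if_pos ((hS p).mp hp).2]
    _ ≤ _ := (summable_primeSeries q hs).sum_le_tsum _ fun p _ => by
        split_ifs <;> positivity

theorem primeSeries_le_sum_add (q : ℕ) {x δ : ℝ} (hx : 1 ≤ x) (hδ : 0 < δ) :
    primeSeries q (1 + δ) ≤ recipAP q ⌊x⌋₊ + x ^ (-(δ / 2)) * primeSeries q (1 + δ / 2) := by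
  obtain ⟨S, hS, hf⟩ := exists_primes_finset q ⌊x⌋₊
  have h2 := summable_primeSeries q (by linarith : 1 < 1 + δ / 2)
  rw [recipAP, hf fun p => (p : ℝ)⁻¹, primeSeries, primeSeries, ← tsum_mul_left]
  rw [← (summable_primeSeries q (by linarith : 1 < 1 + δ)).sum_add_tsum_subtype_compl S]
  refine add_le_add (Finset.sum_le_sum fun p hp => ?_) ?_
  · rw [if_pos ((hS p).mp hp).2, ← Real.rpow_neg_one]
    exact Real.rpow_le_rpow_of_exponent_le (by exact_mod_cast p.prop.one_lt.le) (by linarith)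
  · refine le_trans ?_ ((h2.mul_left (x ^ (-(δ / 2)))).tsum_subtype_le _ (S : Set Nat.Primes)ᶜ
      fun p => ?_)
    · refine Summable.tsum_le_tsum (fun p => ?_)
        ((summable_primeSeries q (by linarith : 1 < 1 + δ)).subtype _)
        ((h2.mul_left (x ^ (-(δ / 2)))).subtype _)
      obtain ⟨p, hp⟩ := p
      simp only
      by_cases hpq : (p : ℕ) % q = 1 % q
      · simp only [if_pos hpq]
        have hpx : x < (p : ℕ) := by
          by_contra h
          exact hp ((hS p).mpr ⟨Nat.le_floor (not_lt.mp h), hpq⟩)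
        have hp0 : (0 : ℝ) < (p : ℕ) := by linarith
        have : -(1 + δ) = -(δ / 2) + -(1 + δ / 2) := by ring
        rw [this, Real.rpow_add hp0]
        refine mul_le_mul_of_nonneg_right ?_ (by positivity)
        exact Real.rpow_le_rpow_of_nonpos (by linarith) hpx.le (by linarith)
      · simp only [if_neg hpq, mul_zero, le_refl]
    · split_ifs <;> positivity

theorem recipAP_le_primeSeries_add (q : ℕ) {x δ : ℝ} (hx : 1 ≤ x) (hδ : 0 < δ) :
    recipAP q ⌊x⌋₊ ≤ primeSeries q (1 + δ) + δ * Real.log x * recipAP q ⌊x⌋₊ := by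
  have h := sum_primesAP_rpow_le q ⌊x⌋₊ (by linarith : 1 < 1 + δ)
  have h2 : recipAP q ⌊x⌋₊ - δ * Real.log x * recipAP q ⌊x⌋₊ ≤
      ∑ p ∈ primesAP q ⌊x⌋₊, (p : ℝ) ^ (-(1 + δ)) := by
    rw [recipAP, Finset.mul_sum, ← Finset.sum_sub_distrib]
    refine Finset.sum_le_sum fun p hp => ?_
    obtain ⟨hpx, hp, -⟩ := mem_primesAP.mp hp
    have hp0 : (0 : ℝ) < p := by exact_mod_cast hp.pos
    have hpx' : (p : ℝ) ≤ x := (Nat.le_floor_iff (by linarith)).mp hpx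
    have hlog : Real.log p ≤ Real.log x := Real.log_le_log hp0 hpx'
    have : -(1 + δ) = -1 + -δ := by ring
    rw [this, Real.rpow_add hp0, Real.rpow_neg_one]
    have h3 : 1 - δ * Real.log x ≤ (p : ℝ) ^ (-δ) := by
      rw [Real.rpow_def_of_pos hp0]
      have := Real.add_one_le_exp (Real.log p * -δ)
      nlinarith
    have : (0 : ℝ) ≤ (p : ℝ)⁻¹ := by positivity
    nlinarith
  linarith

theorem recipAP_le_uniform {q : ℕ} (hq : 2 ≤ q) {x : ℝ} (hx : Real.exp 1 ≤ x) :
    recipAP q ⌊x⌋₊ ≤ 3 * ((Real.log (Real.log x) + 1) / q.totient +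
      Real.log (1 + 2 * Real.log q) + ∑' p : Nat.Primes, (p : ℝ) ^ (-2 : ℝ)) := by
  have hx0 : 0 < x := (Real.exp_pos 1).trans_le hx
  have hlx : 1 ≤ Real.log x := by rwa [Real.le_log_iff_exp_le hx0]
  have hδ : 0 < (Real.log x)⁻¹ := by positivity
  have hδ1 : (Real.log x)⁻¹ ≤ 1 := inv_le_one_of_one_le₀ hlx
  have hφ : (0 : ℝ) < q.totient := by exact_mod_cast Nat.totient_pos.mpr (by omega)
  set s := 1 + (Real.log x)⁻¹ with hs
  have h1 := sum_primesAP_rpow_le q ⌊x⌋₊ (by linarith : 1 < s)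
  have h2 := primeSeries_le hq (by linarith : 1 < s) (by linarith)
  have h3 : s / (s - 1) ≤ Real.exp 1 * Real.log x := by
    have he : 2 ≤ Real.exp 1 := by linarith [Real.add_one_le_exp (1 : ℝ)]
    rw [hs, add_sub_cancel_left, div_inv_eq_mul, add_mul, inv_mul_cancel₀ (by linarith)]
    nlinarith
  have h4 : Real.log (s / (s - 1)) ≤ Real.log (Real.log x) + 1 := by
    have h5 : 0 < s / (s - 1) := div_pos (by linarith) (by linarith)
    refine (Real.log_le_log h5 h3).trans ?_
    rw [Real.log_mul (by positivity) (by linarith), Real.log_exp]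
    linarith
  have h5 : recipAP q ⌊x⌋₊ ≤ 3 * ∑ p ∈ primesAP q ⌊x⌋₊, (p : ℝ) ^ (-s) := by
    rw [recipAP, Finset.mul_sum]
    refine Finset.sum_le_sum fun p hp => ?_
    obtain ⟨hpx, hp, -⟩ := mem_primesAP.mp hp
    have hp0 : (0 : ℝ) < p := by exact_mod_cast hp.pos
    have hpx' : (p : ℝ) ≤ x := (Nat.le_floor_iff hx0.le).mp hpx
    have hlog : Real.log p ≤ Real.log x := Real.log_le_log hp0 hpx'
    have : -s = -1 + -(Real.log x)⁻¹ := by rw [hs]; ring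
    rw [this, Real.rpow_add hp0, Real.rpow_neg_one]
    have h6 : Real.exp (-1) ≤ (p : ℝ) ^ (-(Real.log x)⁻¹) := by
      rw [Real.rpow_def_of_pos hp0]
      refine Real.exp_le_exp.mpr ?_
      rw [mul_neg, neg_le_neg_iff, ← div_eq_mul_inv, div_le_one (by linarith)]
      exact hlog
    have h7 : 1 ≤ 3 * Real.exp (-1) := by
      rw [Real.exp_neg, ← div_eq_mul_inv, le_div_iff₀ (Real.exp_pos _)]
      linarith [Real.exp_one_lt_d9]
    have : (0 : ℝ) ≤ (p : ℝ)⁻¹ := by positivity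
    nlinarith
  have h6 : Real.log (s / (s - 1)) / q.totient ≤ (Real.log (Real.log x) + 1) / q.totient := by
    gcongr
  linarith

theorem recipAP_le_one_add_log_div {q : ℕ} (hq : 2 ≤ q) (N : ℕ) :
    recipAP q N ≤ (1 + Real.log N) / q := by
  have hq0 : (0 : ℝ) < q := by positivity
  have h1 : recipAP q N ≤ ∑ p ∈ primesAP q N, (q : ℝ)⁻¹ * ((p / q : ℕ) : ℝ)⁻¹ := by
    refine Finset.sum_le_sum fun p hp => ?_
    obtain ⟨hpN, hp, hpq⟩ := mem_primesAP.mp hp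
    rw [Nat.mod_eq_of_lt hq] at hpq
    have h3 : 0 < p / q := by
      refine Nat.div_pos ?_ (by omega)
      by_contra h
      rw [Nat.mod_eq_of_lt (not_le.mp h)] at hpq
      exact hp.ne_one hpq
    rw [← mul_inv]
    have h4 : (q : ℝ) * ((p / q : ℕ) : ℝ) ≤ p := by
      exact_mod_cast Nat.mul_div_le p q
    have h5 : (0 : ℝ) < ((p / q : ℕ) : ℝ) := by exact_mod_cast h3
    gcongr
  have h2 : ∑ p ∈ primesAP q N, ((p / q : ℕ) : ℝ)⁻¹ ≤ ∑ k ∈ Finset.Icc 1 N, (k : ℝ)⁻¹ := by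
    have hinj : Set.InjOn (fun p => p / q) (primesAP q N : Set ℕ) := by
      intro p hp p' hp' h
      have h1 := (mem_primesAP.mp hp).2.2
      have h2 := (mem_primesAP.mp hp').2.2
      simp only at h
      rw [← Nat.div_add_mod p q, ← Nat.div_add_mod p' q, h, h1, h2]
    rw [← Finset.sum_image (f := fun k : ℕ => (k : ℝ)⁻¹) hinj]
    refine Finset.sum_le_sum_of_subset_of_nonneg (fun k hk => ?_) fun _ _ _ => by positivity
    obtain ⟨p, hp, rfl⟩ := Finset.mem_image.mp hk
    obtain ⟨hpN, hp, hpq⟩ := mem_primesAP.mp hp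
    rw [Nat.mod_eq_of_lt hq] at hpq
    refine Finset.mem_Icc.mpr ⟨Nat.div_pos ?_ (by omega), (Nat.div_le_self _ _).trans hpN⟩
    by_contra h
    rw [Nat.mod_eq_of_lt (not_le.mp h)] at hpq
    exact hp.ne_one hpq
  have h3 : ∑ k ∈ Finset.Icc 1 N, (k : ℝ)⁻¹ ≤ 1 + Real.log N := by
    have := harmonic_le_one_add_log N
    rw [harmonic_eq_sum_Icc] at this
    push_cast at this
    exact this
  rw [← Finset.mul_sum] at h1
  rw [div_eq_inv_mul]
  exact h1.trans (mul_le_mul_of_nonneg_left (h2.trans h3) (by positivity))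

theorem tendsto_log_log_atTop : Tendsto (fun x : ℝ => Real.log (Real.log x)) atTop atTop :=
  Real.tendsto_log_atTop.comp Real.tendsto_log_atTop

theorem exists_abs_recipAP_sub_le (q : ℕ) [NeZero q] : ∃ C : ℝ, ∀ᶠ x : ℝ in atTop,
    |recipAP q ⌊x⌋₊ - Real.log (Real.log x) / q.totient| ≤
      Real.log (Real.log (Real.log x)) + C := by
  obtain ⟨C0, hC0⟩ := exists_abs_primeSeries_sub_le q
  set C := |C0| with hC
  have hφ : (1 : ℝ) ≤ q.totient := by
    exact_mod_cast Nat.one_le_iff_ne_zero.mpr (Nat.totient_pos.mpr (NeZero.pos q)).ne'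
  have hC' : ∀ᶠ δ : ℝ in nhdsWithin 0 (Set.Ioi 0),
      |primeSeries q (1 + δ) - Real.log (1 / δ) / q.totient| ≤ C := by
    have hto : Tendsto (fun δ : ℝ => 1 + δ) (nhdsWithin 0 (Set.Ioi 0))
        (nhdsWithin 1 (Set.Ioi 1)) := by
      refine tendsto_nhdsWithin_iff.mpr ⟨?_, ?_⟩
      · have : Tendsto (fun δ : ℝ => 1 + δ) (nhds 0) (nhds (1 + 0)) :=
          (continuous_const.add continuous_id).tendsto 0
        rw [add_zero] at this
        exact this.mono_left nhdsWithin_le_nhds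
      · filter_upwards [self_mem_nhdsWithin] with δ hδ
        have hδ' : (0 : ℝ) < δ := hδ
        exact Set.mem_Ioi.mpr (by linarith)
    filter_upwards [hto.eventually hC0] with δ hδ
    rw [add_sub_cancel_left] at hδ
    exact hδ.trans (le_abs_self _)
  have hlog := Real.tendsto_log_atTop
  have hll := tendsto_log_log_atTop
  have hratio : Tendsto (fun x : ℝ => Real.log (Real.log x) / Real.log x) atTop (nhds 0) := by
    have := (Real.isLittleO_log_id_atTop.tendsto_div_nhds_zero).comp hlog
    exact this
  have hδ1 : Tendsto (fun x : ℝ => 1 / (Real.log x * Real.log (Real.log x))) atTop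
      (nhdsWithin 0 (Set.Ioi 0)) := by
    have := tendsto_inv_atTop_nhdsGT_zero.comp (hlog.atTop_mul_atTop₀ hll)
    simpa [Function.comp_def, one_div] using this
  have hpos : ∀ᶠ x : ℝ in atTop, 2 ≤ Real.log (Real.log x) ∧ 2 ≤ Real.log x ∧ 1 ≤ x := by
    filter_upwards [hll.eventually_ge_atTop 2, hlog.eventually_ge_atTop 2,
      eventually_ge_atTop 1] with x h1 h2 h3 using ⟨h1, h2, h3⟩
  have hδ2 : Tendsto (fun x : ℝ => Real.log (Real.log x) / Real.log x) atTop
      (nhdsWithin 0 (Set.Ioi 0)) := by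
    refine tendsto_nhdsWithin_iff.mpr ⟨hratio, ?_⟩
    filter_upwards [hpos] with x hx
    exact Set.mem_Ioi.mpr (div_pos (by linarith [hx.1]) (by linarith [hx.2.1]))
  have hδ3 : Tendsto (fun x : ℝ => 2 * (Real.log (Real.log x) / Real.log x)) atTop
      (nhdsWithin 0 (Set.Ioi 0)) := by
    refine tendsto_nhdsWithin_iff.mpr ⟨by simpa using hratio.const_mul 2, ?_⟩
    filter_upwards [hpos] with x hx
    exact Set.mem_Ioi.mpr
      (mul_pos two_pos (div_pos (by linarith [hx.1]) (by linarith [hx.2.1])))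
  refine ⟨3 * C + 8, ?_⟩
  filter_upwards [hpos, hδ1.eventually hC', hδ2.eventually hC', hδ3.eventually hC'] with
    x ⟨hL2, hlx2, hx1⟩ h1 h2 h3
  set l := Real.log x
  set L := Real.log l with hLdef
  set φ : ℝ := (q.totient : ℝ)
  have hCnn : 0 ≤ C := abs_nonneg _
  have hlogL : 0 ≤ Real.log L := Real.log_nonneg (by linarith)
  have hLl : L ≤ l := (Real.log_le_sub_one_of_pos (by linarith)).trans (by linarith)
  have hlogLL : Real.log L ≤ L := (Real.log_le_sub_one_of_pos (by linarith)).trans (by linarith)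
  have hdiv : ∀ {a : ℝ}, 0 ≤ a → a / φ ≤ a := fun ha => div_le_self ha hφ
  set A := recipAP q ⌊x⌋₊ with hA
  have hA0 : 0 ≤ A := recipAP_nonneg q _
  rw [abs_le]
  constructor
  · have h4 := primeSeries_le_sum_add q hx1
      (δ := 2 * (L / l)) (mul_pos two_pos (div_pos (by linarith) (by linarith)))
    have h5 : 2 * (L / l) / 2 = L / l := by ring
    rw [h5] at h4
    have h6 : x ^ (-(L / l)) = l⁻¹ := by
      rw [Real.rpow_def_of_pos (by linarith)]
      have : Real.log x * -(L / l) = -L := by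
        have : l ≠ 0 := by linarith
        change l * -(L / l) = -L
        field_simp
      rw [this, Real.exp_neg, hLdef, Real.exp_log (by linarith)]
    have h7 : Real.log (1 / (L / l)) = L - Real.log L := by
      rw [one_div_div, Real.log_div (by linarith) (by linarith)]
    have h8 : Real.log (1 / (2 * (L / l))) = L - Real.log L - Real.log 2 := by
      rw [one_div, mul_inv, Real.log_mul (by norm_num) (by positivity), ← one_div (L / l), h7,
        Real.log_inv]
      ring
    rw [h7] at h2
    rw [h8] at h3
    have h9 := (abs_le.mp h3).1
    have h10 := (abs_le.mp h2).2
    have h11 := hdiv (a := L - Real.log L) (by linarith)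
    have h12 : l⁻¹ * primeSeries q (1 + L / l) ≤ 1 + C := by
      rw [inv_mul_le_iff₀ (by linarith)]
      nlinarith
    rw [h6] at h4
    have h13 : (L - Real.log L - Real.log 2) / φ = L / φ - (Real.log L + Real.log 2) / φ := by ring
    have hlog2 : 0 ≤ Real.log 2 := Real.log_nonneg (by norm_num)
    have hlog2' : Real.log 2 ≤ 1 := by linarith [Real.log_two_lt_d9]
    have h14 := hdiv (a := Real.log L + Real.log 2) (by linarith)
    linarith
  · have h4 := recipAP_le_primeSeries_add q hx1 (δ := 1 / (l * L)) (by positivity)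
    have h5 : 1 / (l * L) * Real.log x = 1 / L := by
      have : l ≠ 0 := by linarith
      change 1 / (l * L) * l = 1 / L
      field_simp
    rw [h5] at h4
    have h6 : Real.log (1 / (1 / (l * L))) = L + Real.log L := by
      rw [one_div_one_div, Real.log_mul (by linarith) (by linarith)]
    rw [h6] at h1
    have h7 := (abs_le.mp h1).2
    change A ≤ _ + 1 / L * A at h4
    set F := primeSeries q (1 + 1 / (l * L))
    have h8 : (L + Real.log L) / φ = L / φ + Real.log L / φ := by ring
    have h9 := hdiv hlogL
    have h10 := hdiv (a := L) (by linarith)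
    have h11 : 1 / L ≤ 1 / 2 := by gcongr
    have h12 : A ≤ 2 * F := by nlinarith
    have h13 : 1 / L * A ≤ 4 + C := by
      rw [one_div, inv_mul_le_iff₀ (by linarith)]
      nlinarith
    linarith

/-- The truncation level `n ^ (1 / log log n)`. -/
def truncLevel (n : ℕ) : ℕ := ⌊Real.exp (Real.log n / LL n)⌋₊

theorem tendsto_log_natCast : Tendsto (fun n : ℕ => Real.log (n : ℝ)) atTop atTop :=
  Real.tendsto_log_atTop.comp tendsto_natCast_atTop_atTop

theorem tendsto_LL : Tendsto LL atTop atTop :=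
  tendsto_log_log_atTop.comp tendsto_natCast_atTop_atTop

theorem tendsto_log_LL : Tendsto (fun n => Real.log (LL n)) atTop atTop :=
  Real.tendsto_log_atTop.comp tendsto_LL

theorem isLittleO_log_LL_sqrt :
    (fun n => Real.log (LL n)) =o[atTop] fun n => Real.sqrt (LL n) := by
  have h := (isLittleO_log_rpow_atTop (by norm_num : (0 : ℝ) < 1 / 2)).comp_tendsto tendsto_LL
  simpa only [Function.comp_def, ← Real.sqrt_eq_rpow] using h

theorem isLittleO_log_LL : (fun n => Real.log (LL n)) =o[atTop] LL :=
  Real.isLittleO_log_id_atTop.comp_tendsto tendsto_LL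

theorem isBigO_const_log_LL (c : ℝ) : (fun _ : ℕ => c) =O[atTop] fun n => Real.log (LL n) :=
  (Asymptotics.isLittleO_const_left.mpr
    (Or.inr (tendsto_norm_atTop_atTop.comp tendsto_log_LL))).isBigO

theorem tendsto_exp_log_div_LL :
    Tendsto (fun n : ℕ => Real.exp (Real.log n / LL n)) atTop atTop := by
  refine Real.tendsto_exp_atTop.comp ?_
  have h1 : Tendsto (fun n : ℕ => LL n / Real.log n) atTop (nhds 0) :=
    (Real.isLittleO_log_id_atTop.tendsto_div_nhds_zero).comp tendsto_log_natCast
  have h2 : Tendsto (fun n : ℕ => LL n / Real.log n) atTop (nhdsWithin 0 (Set.Ioi 0)) := by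
    refine tendsto_nhdsWithin_iff.mpr ⟨h1, ?_⟩
    filter_upwards [tendsto_LL.eventually_gt_atTop 0, tendsto_log_natCast.eventually_gt_atTop 0]
      with n h3 h4 using Set.mem_Ioi.mpr (div_pos h3 h4)
  simpa [Function.comp_def] using tendsto_inv_nhdsGT_zero.comp h2

theorem isBigO_recipAP_sub (q : ℕ) [NeZero q] :
    (fun n => recipAP q n - LL n / q.totient) =O[atTop] fun n => Real.log (LL n) := by
  obtain ⟨C, hC⟩ := exists_abs_recipAP_sub_le q
  have h := tendsto_natCast_atTop_atTop.eventually hC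
  refine (Asymptotics.IsBigO.of_bound 1 ?_).trans
    ((Asymptotics.isBigO_refl _ atTop).add (isBigO_const_log_LL C))
  filter_upwards [h] with n hn
  rw [Nat.floor_natCast] at hn
  rw [one_mul]
  exact hn.trans (le_abs_self _)

theorem isBigO_recipAP_truncLevel_sub (q : ℕ) [NeZero q] :
    (fun n => recipAP q (truncLevel n) - LL n / q.totient) =O[atTop]
      fun n => Real.log (LL n) := by
  obtain ⟨C, hC⟩ := exists_abs_recipAP_sub_le q
  have h := tendsto_exp_log_div_LL.eventually hC
  have hφ : (1 : ℝ) ≤ q.totient := by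
    exact_mod_cast Nat.one_le_iff_ne_zero.mpr (Nat.totient_pos.mpr (NeZero.pos q)).ne'
  refine (Asymptotics.IsBigO.of_bound 1 ?_).trans
    (((Asymptotics.isBigO_refl _ atTop).add (isBigO_const_log_LL C)).add
      (Asymptotics.isBigO_refl _ atTop))
  filter_upwards [h, tendsto_LL.eventually_ge_atTop 2,
    tendsto_log_natCast.eventually_ge_atTop 2,
    (isLittleO_log_LL).bound (by norm_num : (0 : ℝ) < 1 / 2)] with n hn hL hl hs
  have hlogL : 0 ≤ Real.log (LL n) := Real.log_nonneg (by linarith)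
  rw [Real.norm_of_nonneg hlogL, Real.norm_of_nonneg (by linarith)] at hs
  have h1 : Real.log (Real.log (Real.exp (Real.log n / LL n))) = LL n - Real.log (LL n) := by
    rw [Real.log_exp, Real.log_div (by linarith) (by linarith)]
    rfl
  rw [h1] at hn
  have h2 : Real.log (LL n - Real.log (LL n)) ≤ Real.log (LL n) :=
    Real.log_le_log (by linarith) (by linarith)
  rw [Real.norm_eq_abs, one_mul]
  refine le_trans ?_ (le_abs_self _)
  change |recipAP q (truncLevel n) - _| ≤ _ at hn
  have h3 : (LL n - Real.log (LL n)) / q.totient = LL n / q.totient - Real.log (LL n) / q.totient :=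
    sub_div _ _ _
  have h4 : Real.log (LL n) / q.totient ≤ Real.log (LL n) := div_le_self hlogL hφ
  have h5 : 0 ≤ Real.log (LL n) / q.totient := by positivity
  rw [h3, abs_le] at hn
  rw [abs_le]
  constructor <;> linarith [hn.1, hn.2]

theorem truncLevel_rpow_le {n p : ℕ} (hL : 0 < LL n) (hl : 0 < Real.log n) (hp0 : 0 < p)
    (hp : p ≤ truncLevel n) : (p : ℝ) ^ (LL n / Real.log n) ≤ Real.exp 1 := by
  have h : (p : ℝ) ≤ Real.exp (Real.log n / LL n) :=
    (Nat.le_floor_iff (Real.exp_pos _).le).mp hp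
  refine (Real.rpow_le_rpow (by positivity) h (by positivity)).trans ?_
  rw [← Real.exp_mul]
  refine Real.exp_le_exp.mpr (le_of_eq ?_)
  field_simp

theorem natCast_rpow_neg_LL_div_log {n : ℕ} (hl : 0 < Real.log n) :
    (n : ℝ) ^ (-(LL n / Real.log n)) = Real.exp (-LL n) := by
  have h0 : (0 : ℝ) < n := by
    rcases Nat.eq_zero_or_pos n with rfl | h
    · simp at hl
    · exact_mod_cast h
  rw [Real.rpow_def_of_pos h0]
  congr 1
  field_simp

theorem card_multiples_Icc (n D : ℕ) :
    ((Finset.Icc 1 n).filter fun m => D ∣ m).card = n / D := by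
  have : Finset.Icc 1 n = Finset.Ioc 0 n := rfl
  rw [this]
  exact Nat.Ioc_filter_dvd_card_eq_div n D

theorem abs_div_div_sub_inv_le {n D : ℕ} (hn : 1 ≤ n) (hD : 1 ≤ D) {δ : ℝ} (hδ0 : 0 ≤ δ)
    (hδ1 : δ ≤ 1) :
    |((n / D : ℕ) : ℝ) / n - (D : ℝ)⁻¹| ≤ (n : ℝ) ^ (-δ) * (D : ℝ) ^ (δ - 1) := by
  have hn0 : (0 : ℝ) < n := by exact_mod_cast hn
  have hD0 : (0 : ℝ) < D := by exact_mod_cast hD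
  set x := |((n / D : ℕ) : ℝ) / n - (D : ℝ)⁻¹| with hx
  have h1 : ((n / D : ℕ) : ℝ) ≤ (n : ℝ) / D := Nat.cast_div_le
  have h2 : (n : ℝ) / D < ((n / D : ℕ) : ℝ) + 1 := by
    rw [div_lt_iff₀ hD0]
    exact_mod_cast (by
      have h3 := Nat.div_add_mod n D
      have h4 := Nat.mod_lt n hD
      calc n = D * (n / D) + n % D := h3.symm
        _ < D * (n / D) + D := by omega
        _ = _ := by ring : n < (n / D + 1) * D)
  have h3 : x = ((n : ℝ) / D - ((n / D : ℕ) : ℝ)) / n := by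
    rw [hx, abs_sub_comm, abs_of_nonneg]
    · field_simp
    · rw [sub_nonneg, div_le_iff₀ hn0]
      rwa [div_eq_mul_inv, mul_comm] at h1
  have h4 : x ≤ (n : ℝ)⁻¹ := by
    rw [h3, ← one_div]
    gcongr
    linarith
  have h5 : x ≤ (D : ℝ)⁻¹ := by
    rw [h3]
    have : (0 : ℝ) ≤ ((n / D : ℕ) : ℝ) := by positivity
    calc ((n : ℝ) / D - ((n / D : ℕ) : ℝ)) / n ≤ ((n : ℝ) / D) / n := by gcongr; linarith
      _ = _ := by field_simp
  have h0 : 0 ≤ x := abs_nonneg _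
  calc x = x ^ δ * x ^ (1 - δ) := by
        rw [← Real.rpow_add_of_nonneg h0 hδ0 (by linarith), add_sub_cancel, Real.rpow_one]
    _ ≤ ((n : ℝ)⁻¹) ^ δ * ((D : ℝ)⁻¹) ^ (1 - δ) := by
        gcongr
    _ = _ := by
        rw [Real.inv_rpow hn0.le, Real.inv_rpow hD0.le, Real.rpow_neg hn0.le,
          ← Real.rpow_neg hD0.le, neg_sub]

theorem sum_prod_filter_dvd {P : Finset ℕ} (hP : ∀ p ∈ P, p.Prime) (g : ℕ → ℂ) (n : ℕ) :
    ∑ m ∈ Finset.Icc 1 n, ∏ p ∈ P.filter (· ∣ m), (1 + g p) =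
      ∑ S ∈ P.powerset, ((n / ∏ p ∈ S, p : ℕ) : ℂ) * ∏ p ∈ S, g p := by
  have h1 : ∀ m, ∏ p ∈ P.filter (· ∣ m), (1 + g p) =
      ∑ S ∈ P.powerset, (if (∏ p ∈ S, p) ∣ m then 1 else 0) * ∏ p ∈ S, g p := by
    intro m
    rw [Finset.prod_one_add]
    simp only [ite_mul, one_mul, zero_mul]
    rw [← Finset.sum_filter]
    refine Finset.sum_congr ?_ fun _ _ => rfl
    ext S
    rw [Finset.mem_powerset, Finset.mem_filter, Finset.mem_powerset]
    constructor
    · intro h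
      refine ⟨h.trans (Finset.filter_subset _ _), ?_⟩
      refine Finset.prod_primes_dvd m (fun p hp => ?_) fun p hp => ?_
      · exact (hP p (Finset.mem_filter.mp (h hp)).1).prime
      · exact (Finset.mem_filter.mp (h hp)).2
    · rintro ⟨h, h'⟩ p hp
      exact Finset.mem_filter.mpr ⟨h hp, (Finset.dvd_prod_of_mem _ hp).trans h'⟩
  simp only [h1]
  rw [Finset.sum_comm]
  refine Finset.sum_congr rfl fun S _ => ?_
  rw [← Finset.sum_mul, ← card_multiples_Icc, Finset.card_filter]
  push_cast
  rfl

/-- The mean of a multiplicative perturbation over divisors in a set of primes is close to the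
corresponding Euler product. -/
theorem norm_sum_prod_filter_dvd_div_sub_le {P : Finset ℕ} (hP : ∀ p ∈ P, p.Prime) (g : ℕ → ℂ)
    {n : ℕ} (hn : 1 ≤ n) {δ : ℝ} (hδ0 : 0 ≤ δ) (hδ1 : δ ≤ 1) :
    ‖(∑ m ∈ Finset.Icc 1 n, ∏ p ∈ P.filter (· ∣ m), (1 + g p)) / n - ∏ p ∈ P, (1 + g p / p)‖ ≤
      (n : ℝ) ^ (-δ) * ∏ p ∈ P, (1 + ‖g p‖ * (p : ℝ) ^ (δ - 1)) := by
  rw [sum_prod_filter_dvd hP, Finset.prod_one_add, Finset.prod_one_add, Finset.sum_div,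
    ← Finset.sum_sub_distrib, Finset.mul_sum]
  refine (norm_sum_le _ _).trans (Finset.sum_le_sum fun S hS => ?_)
  have hD : 1 ≤ ∏ p ∈ S, p :=
    Finset.one_le_prod' fun p hp => (hP p (Finset.mem_powerset.mp hS hp)).one_lt.le
  set D := ∏ p ∈ S, p with hDdef
  have h1 : ((n / D : ℕ) : ℂ) * (∏ p ∈ S, g p) / n - ∏ p ∈ S, g p / p =
      (((((n / D : ℕ) : ℝ) / n - (D : ℝ)⁻¹ : ℝ)) : ℂ) * ∏ p ∈ S, g p := by
    rw [Finset.prod_div_distrib, hDdef]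
    push_cast
    ring
  rw [h1, norm_mul, Complex.norm_real, Real.norm_eq_abs, norm_prod, Finset.prod_mul_distrib]
  have h2 : ∏ p ∈ S, (p : ℝ) ^ (δ - 1) = (D : ℝ) ^ (δ - 1) := by
    rw [hDdef, Nat.cast_prod, Real.finsetProd_rpow _ _ fun p _ => Nat.cast_nonneg p]
  rw [h2]
  have h3 := abs_div_div_sub_inv_le hn hD hδ0 hδ1
  have h4 : 0 ≤ ∏ p ∈ S, ‖g p‖ := Finset.prod_nonneg fun _ _ => norm_nonneg _
  nlinarith

/-- The sum of `f p` over the primes `p ≤ N` dividing `m`. -/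
def truncAdd (f : ℕ → ℝ) (N m : ℕ) : ℝ := ∑ p ∈ (primesAP 1 N).filter (· ∣ m), f p

/-- The moment generating function of a bounded truncated additive function. -/
theorem eventually_norm_mgf_sub_prod_le : ∀ᶠ n : ℕ in atTop, ∀ (f : ℕ → ℝ) (z : ℂ),
    (∀ p, |f p| ≤ 1) → ‖z‖ ≤ 1 / 12 →
    ‖(∑ m ∈ Finset.Icc 1 n, Complex.exp (z * truncAdd f (truncLevel n) m)) / n -
      ∏ p ∈ primesAP 1 (truncLevel n), (1 + (Complex.exp (z * f p) - 1) / p)‖ ≤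
      Real.exp (-(LL n / 4)) := by
  have hrec := (isBigO_recipAP_truncLevel_sub 1).trans_isLittleO isLittleO_log_LL
  filter_upwards [tendsto_LL.eventually_gt_atTop 0, tendsto_log_natCast.eventually_gt_atTop 0,
    eventually_ge_atTop 1, hrec.bound (by norm_num : (0 : ℝ) < 1 / 10),
    ((Real.isLittleO_log_id_atTop.comp_tendsto tendsto_log_natCast).bound one_pos)] with
    n hL hl hn hr hLl f z hf hz
  have hδ1 : LL n / Real.log n ≤ 1 := by
    rw [div_le_one hl]
    have h1 : ‖LL n‖ ≤ 1 * ‖Real.log n‖ := hLl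
    rwa [one_mul, Real.norm_of_nonneg hL.le, Real.norm_of_nonneg hl.le] at h1
  have hg : ∀ p, ‖Complex.exp (z * f p) - 1‖ ≤ 1 / 6 := by
    intro p
    have h1 : ‖z * (f p : ℂ)‖ ≤ 1 / 12 := by
      rw [norm_mul, Complex.norm_real, Real.norm_eq_abs]
      have := abs_nonneg (f p)
      nlinarith [hf p, norm_nonneg z]
    refine (Complex.norm_exp_sub_one_le (by linarith)).trans (by linarith)
  have hP : ∀ p ∈ primesAP 1 (truncLevel n), p.Prime := fun p hp => (mem_primesAP.mp hp).2.1
  have h := norm_sum_prod_filter_dvd_div_sub_le hP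
    (fun p => Complex.exp (z * f p) - 1) hn (by positivity : 0 ≤ LL n / Real.log n) hδ1
  simp only [add_sub_cancel] at h
  have h1 : ∀ m, ∏ p ∈ (primesAP 1 (truncLevel n)).filter (· ∣ m), Complex.exp (z * f p) =
      Complex.exp (z * truncAdd f (truncLevel n) m) := by
    intro m
    rw [← Complex.exp_sum, truncAdd, Complex.ofReal_sum, Finset.mul_sum]
  simp only [h1] at h
  refine h.trans ?_
  rw [natCast_rpow_neg_LL_div_log hl]
  have h2 : ∏ p ∈ primesAP 1 (truncLevel n),
      (1 + ‖Complex.exp (z * f p) - 1‖ * (p : ℝ) ^ (LL n / Real.log n - 1)) ≤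
      Real.exp (1 / 2 * recipAP 1 (truncLevel n)) := by
    rw [recipAP, Finset.mul_sum, Real.exp_sum]
    refine Finset.prod_le_prod (fun p _ => by positivity) fun p hp => ?_
    have hp0 := (hP p hp).pos
    have hp0' : (0 : ℝ) < p := by exact_mod_cast hp0
    have h3 := truncLevel_rpow_le hL hl hp0 (mem_primesAP.mp hp).1
    rw [Real.rpow_sub_one hp0'.ne', div_eq_mul_inv]
    have h4 : Real.exp 1 ≤ 3 := by linarith [Real.exp_one_lt_d9]
    have h5 : ‖Complex.exp (z * f p) - 1‖ * (p : ℝ) ^ (LL n / Real.log n) ≤ 1 / 2 := by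
      have := hg p
      have h6 : (0 : ℝ) ≤ (p : ℝ) ^ (LL n / Real.log n) := by positivity
      nlinarith [norm_nonneg (Complex.exp (z * f p) - 1)]
    have h6 := Real.add_one_le_exp (1 / 2 * (p : ℝ)⁻¹)
    have h7 : (0 : ℝ) < (p : ℝ)⁻¹ := by positivity
    nlinarith
  refine (mul_le_mul_of_nonneg_left h2 (Real.exp_pos _).le).trans ?_
  rw [← Real.exp_add]
  refine Real.exp_le_exp.mpr ?_
  rw [Nat.totient_one, Nat.cast_one, div_one, Real.norm_of_nonneg hL.le] at hr
  have := (abs_le.mp hr).2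
  linarith

/-- The mean of `F` over `{1, …, n}`. -/
def mean (F : ℕ → ℝ) (n : ℕ) : ℝ := (∑ m ∈ Finset.Icc 1 n, F m) / n

theorem mean_le_mean {F G : ℕ → ℝ} {n : ℕ} (h : ∀ m ∈ Finset.Icc 1 n, F m ≤ G m) :
    mean F n ≤ mean G n :=
  div_le_div_of_nonneg_right (Finset.sum_le_sum h) (Nat.cast_nonneg n)

theorem mean_nonneg {F : ℕ → ℝ} {n : ℕ} (h : ∀ m ∈ Finset.Icc 1 n, 0 ≤ F m) : 0 ≤ mean F n :=
  div_nonneg (Finset.sum_nonneg h) (Nat.cast_nonneg n)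

theorem mean_add (F G : ℕ → ℝ) (n : ℕ) : mean (fun m => F m + G m) n = mean F n + mean G n := by
  rw [mean, mean, mean, Finset.sum_add_distrib, add_div]

theorem mean_sub (F G : ℕ → ℝ) (n : ℕ) : mean (fun m => F m - G m) n = mean F n - mean G n := by
  rw [mean, mean, mean, Finset.sum_sub_distrib, sub_div]

theorem mean_const_mul (c : ℝ) (F : ℕ → ℝ) (n : ℕ) :
    mean (fun m => c * F m) n = c * mean F n := by
  rw [mean, mean, ← Finset.mul_sum, mul_div_assoc]

theorem mean_sum {ι : Type*} (s : Finset ι) (F : ι → ℕ → ℝ) (n : ℕ) :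
    mean (fun m => ∑ i ∈ s, F i m) n = ∑ i ∈ s, mean (F i) n := by
  simp only [mean]
  rw [Finset.sum_comm, Finset.sum_div]

theorem mean_const {n : ℕ} (hn : 1 ≤ n) (c : ℝ) : mean (fun _ => c) n = c := by
  have : (n : ℝ) ≠ 0 := by positivity
  rw [mean, Finset.sum_const, Nat.card_Icc, nsmul_eq_mul, add_tsub_cancel_right]
  field_simp

theorem eventually_recipAP_truncLevel_le : ∀ᶠ n : ℕ in atTop,
    recipAP 1 (truncLevel n) ≤ 2 * LL n := by
  have hrec := (isBigO_recipAP_truncLevel_sub 1).trans_isLittleO isLittleO_log_LL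
  filter_upwards [tendsto_LL.eventually_gt_atTop 0, hrec.bound one_pos] with n hL hr
  rw [Nat.totient_one, Nat.cast_one, div_one, Real.norm_of_nonneg hL.le] at hr
  have := (abs_le.mp hr).2
  linarith

theorem eventually_mean_exp_truncAdd_le : ∀ᶠ n : ℕ in atTop, ∀ (f : ℕ → ℝ) (c : ℝ),
    (∀ p, |f p| ≤ 1) → |c| ≤ 1 / 12 →
    mean (fun m => Real.exp (c * truncAdd f (truncLevel n) m)) n ≤
      Real.exp (c * (∑ p ∈ primesAP 1 (truncLevel n), f p / p) + 2 * c ^ 2 * LL n) +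
        Real.exp (-(LL n / 4)) := by
  filter_upwards [eventually_norm_mgf_sub_prod_le, eventually_recipAP_truncLevel_le] with
    n hn hr f c hf hc
  have h := hn f c hf (by rwa [Complex.norm_real])
  have h1 : (∑ m ∈ Finset.Icc 1 n, Complex.exp (c * truncAdd f (truncLevel n) m)) / n -
      ∏ p ∈ primesAP 1 (truncLevel n), (1 + (Complex.exp (c * f p) - 1) / p) =
      ((mean (fun m => Real.exp (c * truncAdd f (truncLevel n) m)) n -
        ∏ p ∈ primesAP 1 (truncLevel n), (1 + (Real.exp (c * f p) - 1) / p) : ℝ) : ℂ) := by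
    rw [mean]
    push_cast
    rfl
  rw [h1, Complex.norm_real] at h
  have h2 := (abs_le.mp h).2
  have h3 : ∏ p ∈ primesAP 1 (truncLevel n), (1 + (Real.exp (c * f p) - 1) / p) ≤
      Real.exp (c * (∑ p ∈ primesAP 1 (truncLevel n), f p / p) +
        c ^ 2 * recipAP 1 (truncLevel n)) := by
    rw [recipAP, Finset.mul_sum, Finset.mul_sum, ← Finset.sum_add_distrib, Real.exp_sum]
    refine Finset.prod_le_prod (fun p hp => ?_) fun p hp => ?_
    · have hp1 : (1 : ℝ) ≤ p := by exact_mod_cast (mem_primesAP.mp hp).2.1.one_lt.le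
      have : 0 ≤ Real.exp (c * f p) / p + (1 - 1 / p) := by
        have : 1 / (p : ℝ) ≤ 1 := by rw [div_le_one (by linarith)]; exact hp1
        have := Real.exp_pos (c * f p)
        have h4 : 0 ≤ Real.exp (c * f p) / p := by positivity
        linarith
      calc (0 : ℝ) ≤ _ := this
        _ = _ := by ring
    · have hp0 : (0 : ℝ) < p := by exact_mod_cast (mem_primesAP.mp hp).2.1.pos
      have hcf : |c * f p| ≤ 1 := by
        rw [abs_mul]
        nlinarith [abs_nonneg c, abs_nonneg (f p), hf p]
      have h4 := (abs_le.mp (Real.abs_exp_sub_one_sub_id_le hcf)).2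
      have h5 : (c * f p) ^ 2 ≤ c ^ 2 := by
        rw [mul_pow]
        have := (sq_le_one_iff_abs_le_one (f p)).mpr (hf p)
        nlinarith [sq_nonneg c]
      have h6 : (Real.exp (c * f p) - 1) / p ≤ c * (f p / p) + c ^ 2 * (p : ℝ)⁻¹ := by
        calc (Real.exp (c * f p) - 1) / p ≤ (c * f p + c ^ 2) / p := by gcongr; linarith
          _ = _ := by ring
      have h7 := Real.add_one_le_exp (c * (f p / p) + c ^ 2 * (p : ℝ)⁻¹)
      linarith
  have h4 : Real.exp (c * (∑ p ∈ primesAP 1 (truncLevel n), f p / p) +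
      c ^ 2 * recipAP 1 (truncLevel n)) ≤
      Real.exp (c * (∑ p ∈ primesAP 1 (truncLevel n), f p / p) + 2 * c ^ 2 * LL n) := by
    refine Real.exp_le_exp.mpr ?_
    nlinarith [sq_nonneg c]
  linarith

theorem norm_prod_sub_prod_le {ι : Type*} (s : Finset ι) (a b : ι → ℂ)
    (ha : ∀ i ∈ s, ‖a i‖ ≤ 1) (hb : ∀ i ∈ s, ‖b i‖ ≤ 1) :
    ‖∏ i ∈ s, a i - ∏ i ∈ s, b i‖ ≤ ∑ i ∈ s, ‖a i - b i‖ := by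
  classical
  induction s using Finset.induction_on with
  | empty => simp
  | insert i s hi ih =>
    rw [Finset.prod_insert hi, Finset.prod_insert hi, Finset.sum_insert hi]
    have h1 : a i * ∏ i ∈ s, a i - b i * ∏ i ∈ s, b i =
        (a i - b i) * ∏ i ∈ s, a i + b i * (∏ i ∈ s, a i - ∏ i ∈ s, b i) := by ring
    rw [h1]
    refine (norm_add_le _ _).trans (add_le_add ?_ ?_)
    · rw [norm_mul, norm_prod]
      refine mul_le_of_le_one_right (norm_nonneg _) ?_
      exact Finset.prod_le_one (fun _ _ => norm_nonneg _) fun j hj =>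
        ha j (Finset.mem_insert_of_mem hj)
    · rw [norm_mul]
      refine (mul_le_of_le_one_left (norm_nonneg _) (hb i (Finset.mem_insert_self i s))).trans ?_
      exact ih (fun j hj => ha j (Finset.mem_insert_of_mem hj))
        fun j hj => hb j (Finset.mem_insert_of_mem hj)

theorem norm_euler_factor_sub_exp_le {p : ℕ} (hp : 2 ≤ p) {x y : ℝ} (hx : |x| ≤ y) (hy : y ≤ 1) :
    ‖(1 + (Complex.exp (Complex.I * x) - 1) / p) -
      Complex.exp ((Complex.I * x - x ^ 2 / 2) / p)‖ ≤
        y ^ 3 * (p : ℝ)⁻¹ + 3 * y ^ 2 * (1 / (p : ℝ) ^ 2) := by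
  have hp0 : (2 : ℝ) ≤ p := by exact_mod_cast hp
  have hy0 : 0 ≤ y := (abs_nonneg x).trans hx
  have hix : ‖Complex.I * x‖ = |x| := by simp
  have h1 := Complex.exp_bound (x := Complex.I * x) (by rw [hix]; linarith) (n := 3) (by norm_num)
  rw [hix] at h1
  have h2 : ∑ m ∈ Finset.range 3, (Complex.I * x) ^ m / (m.factorial : ℂ) =
      1 + (Complex.I * x - x ^ 2 / 2) := by
    simp only [Finset.sum_range_succ, Finset.range_zero, Finset.sum_empty, Nat.factorial]
    push_cast
    have := Complex.I_sq
    linear_combination (x : ℂ) ^ 2 / 2 * this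
  rw [h2] at h1
  have h3 : |x| ^ 3 * (((Nat.succ 3 : ℕ) : ℝ) * (((Nat.factorial 3 : ℕ) : ℝ) * (3 : ℕ))⁻¹) ≤
      y ^ 3 := by
    have h4 : |x| ^ 3 ≤ y ^ 3 := by gcongr
    have h5 : (((Nat.succ 3 : ℕ) : ℝ) * (((Nat.factorial 3 : ℕ) : ℝ) * (3 : ℕ))⁻¹) ≤ 1 := by
      norm_num [Nat.factorial]
    have h6 : 0 ≤ |x| ^ 3 := by positivity
    nlinarith
  have h4 := h1.trans h3
  set w := (Complex.I * x - (x : ℂ) ^ 2 / 2) / p with hw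
  have hwn : ‖w‖ ≤ 3 / 2 * y * (p : ℝ)⁻¹ := by
    rw [hw, norm_div, Complex.norm_natCast, div_eq_mul_inv]
    refine mul_le_mul_of_nonneg_right ?_ (by positivity)
    refine (norm_sub_le _ _).trans ?_
    rw [hix, norm_div, norm_pow, Complex.norm_real, Real.norm_eq_abs]
    have : |x| ^ 2 ≤ y := by nlinarith [abs_nonneg x]
    have h5 : ‖(2 : ℂ)‖ = 2 := by simp
    rw [h5]
    linarith
  have hpi : (p : ℝ)⁻¹ ≤ 2⁻¹ := by gcongr
  have hpi0 : 0 < (p : ℝ)⁻¹ := by positivity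
  have h5 := Complex.norm_exp_sub_one_sub_id_le (x := w) (by nlinarith)
  have h6 : (1 + (Complex.exp (Complex.I * x) - 1) / p) - Complex.exp w =
      (Complex.exp (Complex.I * x) - (1 + (Complex.I * x - (x : ℂ) ^ 2 / 2))) / p -
        (Complex.exp w - 1 - w) := by
    rw [hw]; ring
  rw [h6]
  refine (norm_sub_le _ _).trans (add_le_add ?_ (h5.trans ?_))
  · rw [norm_div, Complex.norm_natCast, div_eq_mul_inv]
    exact mul_le_mul_of_nonneg_right h4 hpi0.le
  · have : ‖w‖ ^ 2 ≤ (3 / 2 * y * (p : ℝ)⁻¹) ^ 2 := by gcongr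
    rw [one_div, ← inv_pow]
    nlinarith [sq_nonneg (y * (p : ℝ)⁻¹)]

theorem norm_one_add_exp_sub_one_div_le {p : ℕ} (hp : 1 ≤ p) (x : ℝ) :
    ‖1 + (Complex.exp (Complex.I * x) - 1) / p‖ ≤ 1 := by
  have hp0 : (1 : ℝ) ≤ p := by exact_mod_cast hp
  have h1 : 1 + (Complex.exp (Complex.I * x) - 1) / p =
      ((1 - (p : ℝ)⁻¹ : ℝ) : ℂ) + Complex.exp (Complex.I * x) / p := by
    push_cast; ring
  rw [h1]
  refine (norm_add_le _ _).trans ?_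
  rw [norm_div, Complex.norm_natCast, Complex.norm_real, mul_comm, Complex.norm_exp_ofReal_mul_I,
    Real.norm_of_nonneg (sub_nonneg.mpr (inv_le_one_of_one_le₀ hp0)), one_div]
  linarith

/-- The characteristic function of a normalized truncated additive function converges to that of
a centred Gaussian. -/
theorem tendsto_mean_cos_truncAdd {f : ℕ → ℝ} (hf : ∀ p, |f p| ≤ 1) {s : ℝ}
    (hA : (fun n => ∑ p ∈ primesAP 1 (truncLevel n), f p / p) =O[atTop]
      fun n => Real.log (LL n))
    (hB : Tendsto (fun n => (∑ p ∈ primesAP 1 (truncLevel n), f p ^ 2 / p) / LL n) atTop (nhds s))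
    (t : ℝ) :
    Tendsto (fun n => mean (fun m => Real.cos (t * (truncAdd f (truncLevel n) m / √(LL n)))) n)
      atTop (nhds (Real.exp (-(s * t ^ 2 / 2)))) := by
  set A := fun n => ∑ p ∈ primesAP 1 (truncLevel n), f p / p with hAdef
  set B := fun n => ∑ p ∈ primesAP 1 (truncLevel n), f p ^ 2 / p with hBdef
  set C := ∑' k : ℕ, 1 / (k : ℝ) ^ 2
  have hsum : Summable fun k : ℕ => 1 / (k : ℝ) ^ 2 := Real.summable_one_div_nat_pow.mpr one_lt_two
  have hsq : Tendsto (fun n => √(LL n)) atTop atTop := Real.tendsto_sqrt_atTop.comp tendsto_LL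
  set τ := fun n => t / √(LL n) with hτ
  have hτ0 : Tendsto τ atTop (nhds 0) := hsq.const_div_atTop t
  set F : ℕ → ℂ := fun n => (∑ m ∈ Finset.Icc 1 n,
    Complex.exp ((Complex.I * τ n) * truncAdd f (truncLevel n) m)) / n with hF
  set M : ℕ → ℂ := fun n => Complex.exp (Complex.I * (τ n * A n : ℝ) -
    (t ^ 2 * (B n / LL n) / 2 : ℝ)) with hM
  have hτA : Tendsto (fun n => τ n * A n) atTop (nhds 0) := by
    have h1 := ((hA.trans_isLittleO isLittleO_log_LL_sqrt).tendsto_div_nhds_zero).const_mul t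
    rw [mul_zero] at h1
    refine h1.congr fun n => ?_
    rw [hτ]; ring
  have hMlim : Tendsto M atTop (nhds (Complex.exp (-(s * t ^ 2 / 2) : ℝ))) := by
    have h1 : Tendsto (fun n => Complex.I * (τ n * A n : ℝ) - (t ^ 2 * (B n / LL n) / 2 : ℝ)) atTop
        (nhds (Complex.I * (0 : ℝ) - (t ^ 2 * s / 2 : ℝ))) := by
      refine ((Complex.continuous_ofReal.tendsto _).comp hτA).const_mul Complex.I |>.sub ?_
      exact (Complex.continuous_ofReal.tendsto _).comp ((hB.const_mul (t ^ 2)).div_const 2)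
    have h2 := (Complex.continuous_exp.tendsto _).comp h1
    have h3 : Complex.I * (0 : ℝ) - (t ^ 2 * s / 2 : ℝ) = ((-(s * t ^ 2 / 2) : ℝ) : ℂ) := by
      push_cast; ring
    rw [h3] at h2
    exact h2
  have hdiff : ∀ᶠ n in atTop, ‖F n - M n‖ ≤
      Real.exp (-(LL n / 4)) + (2 * t ^ 2 * |τ n| + 3 * C * |τ n| ^ 2) := by
    filter_upwards [eventually_norm_mgf_sub_prod_le, eventually_recipAP_truncLevel_le,
      tendsto_LL.eventually_gt_atTop 0, (tendsto_order.mp hτ0.abs).2 (1 / 12) (by norm_num)] with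
      n h1 h2 hL h3
    have h4 := h1 f (Complex.I * τ n) hf (by
      rw [norm_mul, Complex.norm_I, one_mul, Complex.norm_real]; exact h3.le)
    have h5 : ∀ p, Complex.I * (τ n : ℂ) * (f p : ℂ) = Complex.I * ((τ n * f p : ℝ) : ℂ) :=
      fun p => by push_cast; ring
    simp only [h5] at h4
    have hτL : τ n ^ 2 * LL n = t ^ 2 := by
      rw [hτ, div_pow, Real.sq_sqrt hL.le, div_mul_cancel₀ _ hL.ne']
    have h6 : M n = ∏ p ∈ primesAP 1 (truncLevel n),
        Complex.exp ((Complex.I * (τ n * f p : ℝ) - ((τ n * f p : ℝ) : ℂ) ^ 2 / 2) / p) := by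
      rw [← Complex.exp_sum]
      have h7 : t ^ 2 * (B n / LL n) = τ n ^ 2 * B n := by
        rw [← hτL]; field_simp
      simp only [hM]
      rw [h7, hAdef, hBdef]
      congr 1
      push_cast
      rw [Finset.mul_sum, Finset.mul_sum, Finset.mul_sum, Finset.sum_div,
        ← Finset.sum_sub_distrib]
      refine Finset.sum_congr rfl fun p _ => ?_
      ring
    have h8 : ‖∏ p ∈ primesAP 1 (truncLevel n),
        (1 + (Complex.exp (Complex.I * ((τ n * f p : ℝ) : ℂ)) - 1) / p) - M n‖ ≤
        2 * t ^ 2 * |τ n| + 3 * C * |τ n| ^ 2 := by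
      rw [h6]
      refine (norm_prod_sub_prod_le _ _ _ (fun p hp => ?_) fun p hp => ?_).trans ?_
      · exact norm_one_add_exp_sub_one_div_le (mem_primesAP.mp hp).2.1.one_lt.le _
      · rw [Complex.norm_exp, Real.exp_le_one_iff]
        have h9 : ((Complex.I * (τ n * f p : ℝ) - ((τ n * f p : ℝ) : ℂ) ^ 2 / 2) / p) =
            ((-((τ n * f p) ^ 2 / 2 / p) : ℝ) : ℂ) + ((τ n * f p / p : ℝ) : ℂ) * Complex.I := by
          push_cast; ring
        rw [h9, Complex.add_re, Complex.re_ofReal_mul, Complex.I_re, Complex.ofReal_re, mul_zero,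
          add_zero]
        exact neg_nonpos.mpr (by positivity)
      · have h9 : ∀ p ∈ primesAP 1 (truncLevel n), |τ n * f p| ≤ |τ n| := fun p _ => by
          rw [abs_mul]
          exact mul_le_of_le_one_right (abs_nonneg _) (hf p)
        refine (Finset.sum_le_sum fun p hp => norm_euler_factor_sub_exp_le
          (mem_primesAP.mp hp).2.1.two_le (h9 p hp) (by linarith)).trans ?_
        rw [Finset.sum_add_distrib, ← Finset.mul_sum, ← Finset.mul_sum]
        refine add_le_add ?_ ?_
        · change |τ n| ^ 3 * recipAP 1 (truncLevel n) ≤ _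
          calc |τ n| ^ 3 * recipAP 1 (truncLevel n) ≤ |τ n| ^ 3 * (2 * LL n) := by gcongr
            _ = 2 * (τ n ^ 2 * LL n) * |τ n| := by rw [← sq_abs (τ n)]; ring
            _ = _ := by rw [hτL]
        · have := hsum.sum_le_tsum (primesAP 1 (truncLevel n)) fun k _ => by positivity
          have h10 : (0 : ℝ) ≤ 3 * |τ n| ^ 2 := by positivity
          nlinarith
    calc ‖F n - M n‖ ≤ _ := norm_sub_le_norm_sub_add_norm_sub _ (∏ p ∈ primesAP 1 (truncLevel n),
          (1 + (Complex.exp (Complex.I * ((τ n * f p : ℝ) : ℂ)) - 1) / p)) _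
      _ ≤ _ := add_le_add h4 h8
  have hbound : Tendsto (fun n => Real.exp (-(LL n / 4)) +
      (2 * t ^ 2 * |τ n| + 3 * C * |τ n| ^ 2)) atTop (nhds 0) := by
    have h1 : Tendsto (fun n => Real.exp (-(LL n / 4))) atTop (nhds 0) :=
      Real.tendsto_exp_neg_atTop_nhds_zero.comp (tendsto_LL.atTop_div_const (by norm_num))
    have h2 := hτ0.abs
    rw [abs_zero] at h2
    have h3 := h1.add ((h2.const_mul (2 * t ^ 2)).add ((h2.pow 2).const_mul (3 * C)))
    simpa using h3
  have hFM : Tendsto (fun n => F n - M n) atTop (nhds 0) := squeeze_zero_norm' hdiff hbound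
  have hF' : Tendsto F atTop (nhds (Complex.exp (-(s * t ^ 2 / 2) : ℝ))) := by
    simpa using hFM.add hMlim
  have hre := (Complex.continuous_re.tendsto _).comp hF'
  rw [← Complex.ofReal_exp, Complex.ofReal_re] at hre
  refine hre.congr fun n => ?_
  simp only [Function.comp_apply, hF, mean, hτ]
  rw [Complex.div_natCast_re, Complex.re_sum]
  congr 1
  refine Finset.sum_congr rfl fun m _ => ?_
  have h1 : Complex.I * ((t / √(LL n) : ℝ) : ℂ) * (truncAdd f (truncLevel n) m : ℂ) =
      ((t * (truncAdd f (truncLevel n) m / √(LL n)) : ℝ) : ℂ) * Complex.I := by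
    push_cast; ring
  rw [h1, Complex.exp_ofReal_mul_I_re]

theorem one_sub_cos_div_sq_le (x t : ℝ) :
    (1 - Real.cos (t * x)) / t ^ 2 ≤ (x ^ 2 / 2 + 2) * (1 + t ^ 2)⁻¹ := by
  have h1 : 1 - Real.cos (t * x) ≤ (t * x) ^ 2 / 2 := by
    linarith [Real.one_sub_sq_div_two_le_cos (x := t * x)]
  have h2 : 1 - Real.cos (t * x) ≤ 2 := by linarith [Real.neg_one_le_cos (t * x)]
  rcases eq_or_ne t 0 with rfl | ht
  · simp; positivity
  · have ht2 : 0 < t ^ 2 := by positivity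
    rw [← div_eq_mul_inv, div_le_div_iff₀ ht2 (by positivity)]
    nlinarith

theorem one_sub_cos_div_sq_nonneg (x t : ℝ) : 0 ≤ (1 - Real.cos (t * x)) / t ^ 2 :=
  div_nonneg (sub_nonneg.mpr (Real.cos_le_one _)) (sq_nonneg t)

theorem integrable_one_sub_cos_div_sq (x : ℝ) :
    Integrable fun t : ℝ => (1 - Real.cos (t * x)) / t ^ 2 := by
  refine (integrable_inv_one_add_sq.const_mul (x ^ 2 / 2 + 2)).mono' ?_ (.of_forall fun t => ?_)
  · exact (by fun_prop : Measurable fun t : ℝ => (1 - Real.cos (t * x)) / t ^ 2).aestronglyMeasurable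
  · rw [Real.norm_of_nonneg (one_sub_cos_div_sq_nonneg x t)]
    exact one_sub_cos_div_sq_le x t

/-- The constant `∫ (1 - cos t) / t²`. -/
def cosKernelMass : ℝ := ∫ t : ℝ, (1 - Real.cos (t * 1)) / t ^ 2

theorem integral_one_sub_cos_div_sq (x : ℝ) :
    ∫ t : ℝ, (1 - Real.cos (t * x)) / t ^ 2 = cosKernelMass * |x| := by
  rcases eq_or_ne x 0 with rfl | hx
  · simp
  have h := Measure.integral_comp_mul_right (fun t : ℝ => (1 - Real.cos (t * 1)) / t ^ 2) x
  have h1 : ∀ t : ℝ, (1 - Real.cos (t * x)) / t ^ 2 =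
      x ^ 2 * ((1 - Real.cos (t * x * 1)) / (t * x) ^ 2) := by
    intro t
    rcases eq_or_ne t 0 with rfl | ht
    · simp
    · rw [mul_one]; field_simp
  simp only [h1]
  rw [integral_const_mul, h, cosKernelMass, smul_eq_mul, abs_inv, ← sq_abs]
  have : |x| ≠ 0 := abs_ne_zero.mpr hx
  field_simp

theorem cosKernelMass_pos : 0 < cosKernelMass := by
  rw [cosKernelMass, integral_pos_iff_support_of_nonneg (fun t => one_sub_cos_div_sq_nonneg 1 t)
    (integrable_one_sub_cos_div_sq 1)]
  have hsub : Set.Ioo (0 : ℝ) 1 ⊆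
      Function.support fun t : ℝ => (1 - Real.cos (t * 1)) / t ^ 2 := by
    intro t ht
    have h1 : Real.cos (t * 1) < 1 := by
      rw [mul_one, ← Real.cos_zero]
      exact Real.cos_lt_cos_of_nonneg_of_le_pi le_rfl (by linarith [ht.2, Real.pi_gt_three]) ht.1
    exact (div_pos (sub_pos.mpr h1) (by have := ht.1; positivity)).ne'
  refine lt_of_lt_of_le ?_ (measure_mono hsub)
  simp

theorem integral_abs_gaussianReal : ∫ x, |x| ∂(gaussianReal 0 1) = √(2 / Real.pi) := by
  rw [integral_gaussianReal_eq_integral_smul (by norm_num)]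
  have h1 : ∀ x : ℝ, gaussianPDFReal 0 1 x • |x| =
      (fun y : ℝ => (√(2 * Real.pi))⁻¹ * (y ^ (1 : ℝ) * Real.exp (-(1 / 2) * y ^ (2 : ℝ)))) |x| := by
    intro x
    simp only [gaussianPDFReal, smul_eq_mul, Real.rpow_one, Real.rpow_two, sq_abs, sub_zero,
      NNReal.coe_one, mul_one]
    rw [neg_div, neg_mul, one_div, div_eq_inv_mul]
    ring
  simp only [h1]
  rw [integral_comp_abs (f := fun y : ℝ => (√(2 * Real.pi))⁻¹ *
    (y ^ (1 : ℝ) * Real.exp (-(1 / 2) * y ^ (2 : ℝ)))), integral_const_mul,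
    integral_rpow_mul_exp_neg_mul_rpow (by norm_num) (by norm_num) (by norm_num)]
  have h2 : Real.Gamma ((1 + 1) / 2) = 1 := by norm_num
  rw [h2, Real.sqrt_div (by norm_num), Real.sqrt_mul (by norm_num)]
  have h3 : (1 / 2 : ℝ) ^ (-(1 + 1) / 2 : ℝ) = 2 := by
    rw [show (-(1 + 1) / 2 : ℝ) = -1 by norm_num, Real.rpow_neg_one]; norm_num
  rw [h3]
  have h4 : √2 ≠ 0 := by positivity
  have h5 : √Real.pi ≠ 0 := (Real.sqrt_pos.mpr Real.pi_pos).ne'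
  field_simp
  norm_num

theorem integral_cos_gaussianReal (t : ℝ) :
    ∫ x, Real.cos (t * x) ∂(gaussianReal 0 1) = Real.exp (-(t ^ 2 / 2)) := by
  have h := charFun_gaussianReal (μ := 0) (v := 1) t
  rw [charFun_apply_real] at h
  have h1 := congrArg Complex.re h
  have h2 : ∫ x, Real.cos (t * x) ∂(gaussianReal 0 1) =
      (∫ x, Complex.exp (t * x * Complex.I) ∂(gaussianReal 0 1)).re := by
    rw [← RCLike.re_eq_complex_re, ← integral_re]
    · refine integral_congr_ae (.of_forall fun x => ?_)
      simp only [RCLike.re_eq_complex_re]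
      rw [← Complex.ofReal_mul, Complex.exp_ofReal_mul_I_re]
    · refine (integrable_const (1 : ℝ)).mono' (by fun_prop) (.of_forall fun x => ?_)
      rw [← Complex.ofReal_mul, Complex.norm_exp_ofReal_mul_I]
  rw [h2, h1]
  have h3 : (t : ℂ) * ((0 : ℝ) : ℂ) * Complex.I - ((1 : NNReal) : ℂ) * (t : ℂ) ^ 2 / 2 =
      ((-(t ^ 2 / 2) : ℝ) : ℂ) := by
    push_cast; ring
  rw [h3, Complex.exp_ofReal_re]

theorem integral_one_sub_exp_div_sq {s : ℝ} (hs : 0 ≤ s) :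
    ∫ t : ℝ, (1 - Real.exp (-(s * t ^ 2 / 2))) / t ^ 2 = cosKernelMass * √(2 * s / Real.pi) := by
  set σ := √s with hσ
  have hσ2 : σ ^ 2 = s := Real.sq_sqrt hs
  have hinteg : Integrable (fun z : ℝ × ℝ => (1 - Real.cos (z.2 * (σ * z.1))) / z.2 ^ 2)
      ((gaussianReal 0 1).prod volume) := by
    have h1 : Integrable (fun x : ℝ => (σ * x) ^ 2 / 2 + 2) (gaussianReal 0 1) := by
      have h2 : Integrable (fun x : ℝ => x ^ 2) (gaussianReal 0 1) :=
        (memLp_id_gaussianReal (μ := 0) (v := 1) 2).integrable_sq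
      have h3 := (h2.const_mul (σ ^ 2 / 2)).add (integrable_const (2 : ℝ))
      refine h3.congr (.of_forall fun x => ?_)
      simp only [Pi.add_apply]; ring
    refine (h1.mul_prod integrable_inv_one_add_sq).mono' ?_ (.of_forall fun z => ?_)
    · exact (by fun_prop : Measurable fun z : ℝ × ℝ =>
        (1 - Real.cos (z.2 * (σ * z.1))) / z.2 ^ 2).aestronglyMeasurable
    · rw [Real.norm_of_nonneg (one_sub_cos_div_sq_nonneg _ _)]
      exact one_sub_cos_div_sq_le _ _
  have h := integral_integral_swap (f := fun x t : ℝ => (1 - Real.cos (t * (σ * x))) / t ^ 2) hinteg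
  simp only [integral_one_sub_cos_div_sq] at h
  have h1 : ∀ t : ℝ, ∫ x, (1 - Real.cos (t * (σ * x))) / t ^ 2 ∂(gaussianReal 0 1) =
      (1 - Real.exp (-(s * t ^ 2 / 2))) / t ^ 2 := by
    intro t
    rw [integral_div, integral_sub (integrable_const _)]
    · have h2 := integral_cos_gaussianReal (t * σ)
      simp only [mul_assoc] at h2
      rw [h2]
      simp only [integral_const, probReal_univ, smul_eq_mul, mul_one]
      rw [mul_pow, hσ2, mul_comm s]
    · refine (integrable_const (1 : ℝ)).mono' ?_ (.of_forall fun x => ?_)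
      · exact (by fun_prop : Measurable fun x : ℝ =>
          Real.cos (t * (σ * x))).aestronglyMeasurable
      · exact Real.abs_cos_le_one _
  simp only [h1] at h
  rw [← h, integral_const_mul]
  congr 1
  simp only [abs_mul]
  rw [integral_const_mul, integral_abs_gaussianReal, abs_of_nonneg (Real.sqrt_nonneg s),
    ← Real.sqrt_mul hs]
  congr 1
  ring

/-- Convergence of the characteristic functions to a centred Gaussian together with bounded second
moments gives convergence of the first absolute moments. -/
theorem tendsto_mean_abs {X : ℕ → ℕ → ℝ} {s C : ℝ} (hs : 0 ≤ s)
    (hcos : ∀ t : ℝ, Tendsto (fun n => mean (fun m => Real.cos (t * X n m)) n) atTop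
      (nhds (Real.exp (-(s * t ^ 2 / 2)))))
    (hC : ∀ᶠ n in atTop, mean (fun m => X n m ^ 2) n ≤ C) :
    Tendsto (fun n => mean (fun m => |X n m|) n) atTop (nhds (√(2 * s / Real.pi))) := by
  have hmean : ∀ n ≥ 1, ∀ t : ℝ, (1 - mean (fun m => Real.cos (t * X n m)) n) / t ^ 2 =
      mean (fun m => (1 - Real.cos (t * X n m)) / t ^ 2) n := by
    intro n hn t
    rw [← mean_const hn (1 : ℝ), ← mean_sub, div_eq_inv_mul, ← mean_const_mul]
    simp only [div_eq_inv_mul]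
    rw [mean_const hn]
  have hkey : ∀ n ≥ 1, ∫ t : ℝ, (1 - mean (fun m => Real.cos (t * X n m)) n) / t ^ 2 =
      cosKernelMass * mean (fun m => |X n m|) n := by
    intro n hn
    simp only [hmean n hn]
    rw [← mean_const_mul]
    simp only [mean]
    rw [integral_div, integral_finsetSum _ fun m _ => integrable_one_sub_cos_div_sq _]
    simp only [integral_one_sub_cos_div_sq]
  have hlim : Tendsto (fun n => ∫ t : ℝ, (1 - mean (fun m => Real.cos (t * X n m)) n) / t ^ 2)
      atTop (nhds (∫ t : ℝ, (1 - Real.exp (-(s * t ^ 2 / 2))) / t ^ 2)) := by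
    refine tendsto_integral_filter_of_dominated_convergence
      (fun t => (C / 2 + 2) * (1 + t ^ 2)⁻¹) (.of_forall fun n => ?_) ?_
      (integrable_inv_one_add_sq.const_mul _) (.of_forall fun t => ?_)
    · simp only [mean]
      exact (by fun_prop : Measurable fun t : ℝ => (1 - (∑ m ∈ Finset.Icc 1 n,
        Real.cos (t * X n m)) / n) / t ^ 2).aestronglyMeasurable
    · filter_upwards [hC, eventually_ge_atTop 1] with n hn hn1
      refine .of_forall fun t => ?_
      rw [hmean n hn1, Real.norm_of_nonneg (mean_nonneg fun m _ => one_sub_cos_div_sq_nonneg _ _)]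
      refine (mean_le_mean fun m _ => one_sub_cos_div_sq_le (X n m) t).trans ?_
      have h1 : mean (fun m => (X n m ^ 2 / 2 + 2) * (1 + t ^ 2)⁻¹) n =
          (1 + t ^ 2)⁻¹ * ((1 / 2) * mean (fun m => X n m ^ 2) n + 2) := by
        rw [← mean_const_mul, ← mean_const hn1 (2 : ℝ), ← mean_add, ← mean_const_mul,
          mean_const hn1]
        congr 1
        funext m
        ring
      rw [h1, mul_comm]
      gcongr
      linarith
    · exact (tendsto_const_nhds.sub (hcos t)).div_const _
  rw [integral_one_sub_exp_div_sq hs] at hlim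
  have h2 := (hlim.congr' ((eventually_ge_atTop 1).mono hkey)).const_mul cosKernelMass⁻¹
  simpa only [inv_mul_cancel_left₀ cosKernelMass_pos.ne'] using h2

theorem tendsto_mean_posPart {X : ℕ → ℕ → ℝ} {s C : ℝ} (hs : 0 ≤ s)
    (hcos : ∀ t : ℝ, Tendsto (fun n => mean (fun m => Real.cos (t * X n m)) n) atTop
      (nhds (Real.exp (-(s * t ^ 2 / 2)))))
    (hC : ∀ᶠ n in atTop, mean (fun m => X n m ^ 2) n ≤ C)
    (h0 : Tendsto (fun n => mean (X n) n) atTop (nhds 0)) :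
    Tendsto (fun n => mean (fun m => max (X n m) 0) n) atTop (nhds (√s / √(2 * Real.pi))) := by
  have h := ((tendsto_mean_abs hs hcos hC).add h0).const_mul (1 / 2)
  have h1 : 1 / 2 * (√(2 * s / Real.pi) + 0) = √s / √(2 * Real.pi) := by
    rw [add_zero, Real.sqrt_div (by positivity), Real.sqrt_mul (by norm_num),
      Real.sqrt_mul (by norm_num)]
    have h4 : √2 ≠ 0 := by positivity
    have h5 : √Real.pi ≠ 0 := (Real.sqrt_pos.mpr Real.pi_pos).ne'
    field_simp
    rw [Real.sq_sqrt (by norm_num)]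
  rw [h1] at h
  refine h.congr fun n => ?_
  rw [← mean_add, ← mean_const_mul]
  congr 1
  funext m
  rcases le_total 0 (X n m) with hx | hx
  · rw [abs_of_nonneg hx, max_eq_left hx]; ring
  · rw [abs_of_nonpos hx, max_eq_right hx]; ring

/-- The indicator of `p ≡ 1 (mod q)`. -/
def indAP (q p : ℕ) : ℝ := if p % q = 1 % q then 1 else 0

theorem indAP_nonneg (q p : ℕ) : 0 ≤ indAP q p := by
  unfold indAP; split_ifs <;> norm_num

theorem indAP_le_one (q p : ℕ) : indAP q p ≤ 1 := by
  unfold indAP; split_ifs <;> norm_num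

theorem abs_indAP_le_one (q p : ℕ) : |indAP q p| ≤ 1 := by
  rw [abs_of_nonneg (indAP_nonneg q p)]
  exact indAP_le_one q p

theorem abs_indAP_sub_le_one (a b p : ℕ) : |indAP a p - indAP b p| ≤ 1 := by
  rw [abs_le]
  constructor <;> linarith [indAP_nonneg a p, indAP_nonneg b p, indAP_le_one a p, indAP_le_one b p]

theorem primesAP_eq_filter (q N : ℕ) :
    primesAP q N = (primesAP 1 N).filter fun p => p % q = 1 % q := by
  ext p
  simp only [Finset.mem_filter, mem_primesAP, Nat.mod_one]
  tauto

theorem sum_indAP_div (q N : ℕ) : ∑ p ∈ primesAP 1 N, indAP q p / p = recipAP q N := by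
  rw [recipAP, primesAP_eq_filter q, Finset.sum_filter]
  refine Finset.sum_congr rfl fun p _ => ?_
  unfold indAP
  split_ifs <;> simp

theorem omegaQ_eq_truncAdd {n m : ℕ} (hm : m ∈ Finset.Icc 1 n) (q : ℕ) :
    (omegaQ m q : ℝ) = truncAdd (indAP q) n m := by
  rw [Finset.mem_Icc] at hm
  rw [omegaQ, truncAdd, Finset.card_filter]
  push_cast
  have h : (primesAP 1 n).filter (· ∣ m) = m.primeFactors := by
    ext p
    rw [Finset.mem_filter, mem_primesAP, Nat.mem_primeFactors]
    constructor
    · rintro ⟨⟨_, h1, _⟩, h2⟩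
      exact ⟨h1, h2, by omega⟩
    · rintro ⟨h1, h2, _⟩
      exact ⟨⟨(Nat.le_of_dvd (by omega) h2).trans hm.2, h1, by simp [Nat.mod_one]⟩, h2⟩
  rw [h]
  rfl

theorem primesAP_mono (q : ℕ) {N N' : ℕ} (h : N ≤ N') : primesAP q N ⊆ primesAP q N' := by
  intro p hp
  rw [mem_primesAP] at hp ⊢
  exact ⟨hp.1.trans h, hp.2⟩

theorem truncAdd_sub_eq (f : ℕ → ℝ) {N N' : ℕ} (h : N ≤ N') (m : ℕ) :
    truncAdd f N' m - truncAdd f N m =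
      ∑ p ∈ (primesAP 1 N' \ primesAP 1 N).filter (· ∣ m), f p := by
  simp only [truncAdd, Finset.sum_filter]
  exact (Finset.sum_sdiff_eq_sub (primesAP_mono 1 h)).symm

theorem truncAdd_sub_nonneg {f : ℕ → ℝ} (hf : ∀ p, 0 ≤ f p) {N N' : ℕ} (h : N ≤ N') (m : ℕ) :
    0 ≤ truncAdd f N' m - truncAdd f N m := by
  rw [truncAdd_sub_eq f h]
  exact Finset.sum_nonneg fun p _ => hf p

theorem truncAdd_sub_le {f g : ℕ → ℝ} (hfg : ∀ p, f p ≤ g p) {N N' : ℕ} (h : N ≤ N') (m : ℕ) :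
    truncAdd f N' m - truncAdd f N m ≤ truncAdd g N' m - truncAdd g N m := by
  rw [truncAdd_sub_eq f h, truncAdd_sub_eq g h]
  exact Finset.sum_le_sum fun p _ => hfg p

theorem truncAdd_sub (f g : ℕ → ℝ) (N m : ℕ) :
    truncAdd (fun p => f p - g p) N m = truncAdd f N m - truncAdd g N m :=
  Finset.sum_sub_distrib _ _

theorem mean_sum_filter_dvd (S : Finset ℕ) (f : ℕ → ℝ) (n : ℕ) :
    mean (fun m => ∑ p ∈ S.filter (· ∣ m), f p) n = ∑ p ∈ S, f p * ((n / p : ℕ) / n : ℝ) := by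
  simp only [Finset.sum_filter]
  rw [mean_sum]
  refine Finset.sum_congr rfl fun p _ => ?_
  rw [mean, ← Finset.sum_filter, Finset.sum_const, card_multiples_Icc, nsmul_eq_mul]
  ring

theorem natCast_div_div_le_inv {n p : ℕ} (hn : 1 ≤ n) : ((n / p : ℕ) / n : ℝ) ≤ (p : ℝ)⁻¹ := by
  have hn0 : (0 : ℝ) < n := by exact_mod_cast hn
  rw [div_le_iff₀ hn0, inv_mul_eq_div]
  exact Nat.cast_div_le

/-- The number of primes between the truncation level and `n` dividing `m`. -/
def tailCount (n m : ℕ) : ℝ :=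
  truncAdd (fun _ => 1) n m - truncAdd (fun _ => 1) (truncLevel n) m

theorem eventually_truncLevel_le : ∀ᶠ n : ℕ in atTop, truncLevel n ≤ n := by
  filter_upwards [tendsto_LL.eventually_ge_atTop 1, tendsto_log_natCast.eventually_gt_atTop 0,
    eventually_ge_atTop 1] with n hL hl hn
  have hn0 : (0 : ℝ) < n := by exact_mod_cast hn
  rw [truncLevel, ← Nat.floor_natCast (R := ℝ) n]
  refine Nat.floor_le_floor ?_
  rw [Nat.floor_natCast]
  calc Real.exp (Real.log n / LL n) ≤ Real.exp (Real.log n) :=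
        Real.exp_le_exp.mpr (div_le_self hl.le hL)
    _ = n := Real.exp_log hn0

theorem isBigO_mean_tailCount :
    (fun n => mean (tailCount n) n) =O[atTop] fun n => Real.log (LL n) := by
  have h := (isBigO_recipAP_sub 1).sub (isBigO_recipAP_truncLevel_sub 1)
  refine (Asymptotics.IsBigO.of_bound 1 ?_).trans h
  filter_upwards [eventually_truncLevel_le, eventually_ge_atTop 1] with n hY hn
  have h1 : ∀ m, tailCount n m =
      ∑ p ∈ (primesAP 1 n \ primesAP 1 (truncLevel n)).filter (· ∣ m), (1 : ℝ) :=
    fun m => truncAdd_sub_eq _ hY m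
  have h0 : 0 ≤ mean (tailCount n) n := mean_nonneg fun m _ =>
    truncAdd_sub_nonneg (fun _ => zero_le_one) hY m
  rw [one_mul, Real.norm_of_nonneg h0]
  refine le_trans ?_ (Real.le_norm_self _)
  have h2 : mean (tailCount n) n ≤ recipAP 1 n - recipAP 1 (truncLevel n) := by
    rw [funext h1, mean_sum_filter_dvd, recipAP, recipAP,
      ← Finset.sum_sdiff_eq_sub (primesAP_mono 1 hY)]
    refine Finset.sum_le_sum fun p _ => ?_
    rw [one_mul]
    exact natCast_div_div_le_inv hn
  linarith

theorem abs_mean_truncAdd_sub_le {f : ℕ → ℝ} (hf : ∀ p, |f p| ≤ 1) {n N : ℕ} (hn : 1 ≤ n) :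
    |mean (truncAdd f N) n - ∑ p ∈ primesAP 1 N, f p / p| ≤ N / n := by
  have hn0 : (0 : ℝ) < n := by exact_mod_cast hn
  have h1 := mean_sum_filter_dvd (primesAP 1 N) f n
  change mean (truncAdd f N) n = _ at h1
  rw [h1, ← Finset.sum_sub_distrib]
  refine (Finset.abs_sum_le_sum_abs _ _).trans ?_
  have h2 : ∀ p ∈ primesAP 1 N, |f p * ((n / p : ℕ) / n : ℝ) - f p / p| ≤ 1 / n := by
    intro p hp
    have h3 : f p * ((n / p : ℕ) / n : ℝ) - f p / p = f p * (((n / p : ℕ) : ℝ) / n - (p : ℝ)⁻¹) := by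
      ring
    have h4 := abs_div_div_sub_inv_le hn (mem_primesAP.mp hp).2.1.one_lt.le zero_le_one le_rfl
    rw [sub_self, Real.rpow_zero, mul_one, Real.rpow_neg_one] at h4
    rw [h3, abs_mul, one_div]
    exact (mul_le_of_le_one_left (abs_nonneg _) (hf p)).trans h4
  refine (Finset.sum_le_sum h2).trans ?_
  rw [Finset.sum_const, nsmul_eq_mul, mul_one_div]
  gcongr
  have : (primesAP 1 N).card ≤ (Finset.Icc 1 N).card := Finset.card_filter_le _ _
  simpa using this

theorem isBigO_sum_indAP_sub_div {a b : ℕ} [NeZero a] [NeZero b] (h : a.totient = b.totient) :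
    (fun n => ∑ p ∈ primesAP 1 (truncLevel n), (indAP a p - indAP b p) / p) =O[atTop]
      fun n => Real.log (LL n) := by
  refine ((isBigO_recipAP_truncLevel_sub a).sub (isBigO_recipAP_truncLevel_sub b)).congr_left
    fun n => ?_
  simp only [sub_div, Finset.sum_sub_distrib, sum_indAP_div, h]
  ring

theorem tendsto_recipAP_truncLevel_div (q : ℕ) [NeZero q] :
    Tendsto (fun n => recipAP q (truncLevel n) / LL n) atTop (nhds (1 / q.totient)) := by
  have h := ((isBigO_recipAP_truncLevel_sub q).trans_isLittleO
    isLittleO_log_LL).tendsto_div_nhds_zero.add_const (1 / (q.totient : ℝ))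
  rw [zero_add] at h
  refine h.congr' ?_
  filter_upwards [tendsto_LL.eventually_gt_atTop 0] with n hL
  field_simp
  ring

theorem indAP_mul {a b : ℕ} (hab : a.Coprime b) (p : ℕ) :
    indAP a p * indAP b p = indAP (a * b) p := by
  have h := Nat.modEq_and_modEq_iff_modEq_mul (a := p) (b := 1) hab
  simp only [Nat.ModEq] at h
  unfold indAP
  by_cases h1 : p % a = 1 % a <;> by_cases h2 : p % b = 1 % b <;>
    simp only [h1, h2, ← h, if_true, if_false, mul_one, mul_zero, and_self, and_false, false_and]

theorem tendsto_sum_indAP_sub_sq_div {a b : ℕ} [NeZero a] [NeZero b] (hab : a.Coprime b) :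
    Tendsto (fun n => (∑ p ∈ primesAP 1 (truncLevel n), (indAP a p - indAP b p) ^ 2 / p) / LL n)
      atTop (nhds (1 / a.totient + 1 / b.totient - 2 / (a.totient * b.totient))) := by
  have h := ((tendsto_recipAP_truncLevel_div a).add (tendsto_recipAP_truncLevel_div b)).sub
    ((tendsto_recipAP_truncLevel_div (a * b)).const_mul 2)
  rw [Nat.totient_mul hab] at h
  push_cast at h
  rw [mul_one_div] at h
  refine h.congr fun n => ?_
  have h1 : ∀ p : ℕ, (indAP a p - indAP b p) ^ 2 / p =
      indAP a p / p + indAP b p / p - 2 * (indAP (a * b) p / p) := by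
    intro p
    have h2 : ∀ q, indAP q p ^ 2 = indAP q p := by
      intro q; unfold indAP; split_ifs <;> norm_num
    rw [sub_sq, h2, h2, mul_assoc, indAP_mul hab]
    ring
  simp only [h1, Finset.sum_sub_distrib, Finset.sum_add_distrib, sum_indAP_div, ← Finset.mul_sum]
  ring

/-- Mean of the positive part of the difference of two truncated counts with equal totients. -/
theorem tendsto_mean_posPart_indAP_sub {a b : ℕ} [NeZero a] [NeZero b] (hab : a.Coprime b)
    (h : a.totient = b.totient) :
    Tendsto (fun n => mean (fun m => max (truncAdd (fun p => indAP a p - indAP b p)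
      (truncLevel n) m) 0) n / √(LL n)) atTop
      (nhds (√(1 / a.totient + 1 / b.totient - 2 / (a.totient * b.totient)) /
        √(2 * Real.pi))) := by
  set f := fun p => indAP a p - indAP b p with hf
  have hf1 : ∀ p, |f p| ≤ 1 := abs_indAP_sub_le_one a b
  have hA : (fun n => ∑ p ∈ primesAP 1 (truncLevel n), f p / p) =O[atTop]
    fun n => Real.log (LL n) := isBigO_sum_indAP_sub_div h
  have hB : Tendsto (fun n => (∑ p ∈ primesAP 1 (truncLevel n), f p ^ 2 / p) / LL n) atTop
    (nhds (1 / a.totient + 1 / b.totient - 2 / (a.totient * b.totient))) :=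
    tendsto_sum_indAP_sub_sq_div hab
  set s : ℝ := 1 / a.totient + 1 / b.totient - 2 / (a.totient * b.totient)
  have hs : 0 ≤ s := by
    refine ge_of_tendsto hB ?_
    filter_upwards [tendsto_LL.eventually_gt_atTop 0] with n hL
    exact div_nonneg (Finset.sum_nonneg fun p _ => by positivity) hL.le
  have hsq : Tendsto (fun n => √(LL n)) atTop atTop := Real.tendsto_sqrt_atTop.comp tendsto_LL
  have hAs := (hA.trans_isLittleO isLittleO_log_LL_sqrt).tendsto_div_nhds_zero
  have hsec : ∀ᶠ n in atTop,
      mean (fun m => (truncAdd f (truncLevel n) m / √(LL n)) ^ 2) n ≤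
        4 * (Real.exp 3 + 1) := by
    filter_upwards [eventually_mean_exp_truncAdd_le, tendsto_LL.eventually_gt_atTop 0,
      hsq.eventually_ge_atTop 12, hAs.abs.eventually_le_const (by norm_num : |(0:ℝ)| < 1)] with
      n hn hL hs12 hA1
    set c := (√(LL n))⁻¹ with hc
    have hc0 : 0 < c := inv_pos.mpr (by linarith)
    have hc12 : c ≤ 1 / 12 := by rw [hc, one_div]; gcongr
    have hcL : c ^ 2 * LL n = 1 := by
      rw [hc, inv_pow, Real.sq_sqrt hL.le, inv_mul_cancel₀ hL.ne']
    have hE : Real.exp (-(LL n / 4)) ≤ 1 := Real.exp_le_one_iff.mpr (by linarith)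
    have h1 := hn f c hf1 (by rw [abs_of_pos hc0]; exact hc12)
    have h2 := hn f (-c) hf1 (by rw [abs_neg, abs_of_pos hc0]; exact hc12)
    rw [div_eq_inv_mul, ← hc] at hA1
    have hA2 := abs_le.mp hA1
    have h3 : mean (fun m => Real.exp (c * truncAdd f (truncLevel n) m)) n ≤ Real.exp 3 + 1 := by
      refine h1.trans (add_le_add (Real.exp_le_exp.mpr ?_) hE)
      linarith
    have h4 : mean (fun m => Real.exp (-c * truncAdd f (truncLevel n) m)) n ≤ Real.exp 3 + 1 := by
      refine h2.trans (add_le_add (Real.exp_le_exp.mpr ?_) hE)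
      rw [neg_sq]
      linarith
    refine le_trans ?_ ((mul_le_mul_of_nonneg_left (add_le_add h3 h4) zero_le_two).trans
      (by linarith))
    rw [← mean_add, ← mean_const_mul]
    refine mean_le_mean fun m _ => ?_
    rw [div_eq_inv_mul, ← hc, neg_mul]
    set x := c * truncAdd f (truncLevel n) m
    have h5 := Real.quadratic_le_exp_of_nonneg (abs_nonneg x)
    rw [sq_abs] at h5
    have h6 := Real.exp_pos x
    have h7 := Real.exp_pos (-x)
    have h8 := Real.add_one_le_exp x
    have h9 := Real.add_one_le_exp (-x)
    rcases abs_cases x with ⟨h10, h11⟩ | ⟨h10, h11⟩ <;> rw [h10] at h5 <;> linarith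
  have h0 : Tendsto (fun n => mean (fun m => truncAdd f (truncLevel n) m / √(LL n)) n) atTop
      (nhds 0) := by
    have h1 : ∀ n, mean (fun m => truncAdd f (truncLevel n) m / √(LL n)) n =
        mean (truncAdd f (truncLevel n)) n / √(LL n) := by
      intro n
      rw [div_eq_inv_mul, ← mean_const_mul]
      simp only [div_eq_inv_mul]
    simp only [h1]
    have h2 : Tendsto (fun n => (mean (truncAdd f (truncLevel n)) n -
        ∑ p ∈ primesAP 1 (truncLevel n), f p / p) / √(LL n)) atTop (nhds 0) := by
      refine squeeze_zero_norm' ?_ (hsq.const_div_atTop 1)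
      filter_upwards [eventually_truncLevel_le, eventually_ge_atTop 1] with n hY hn
      rw [norm_div, Real.norm_of_nonneg (Real.sqrt_nonneg _)]
      gcongr
      refine (abs_mean_truncAdd_sub_le hf1 hn).trans ?_
      have : (0 : ℝ) < n := by exact_mod_cast hn
      rw [div_le_one this]
      exact_mod_cast hY
    refine (zero_add (0 : ℝ) ▸ h2.add hAs).congr fun n => ?_
    ring
  refine (tendsto_mean_posPart hs (tendsto_mean_cos_truncAdd hf1 hA hB) hsec h0).congr' ?_
  filter_upwards [tendsto_LL.eventually_gt_atTop 0] with n hL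
  have hr : 0 < √(LL n) := Real.sqrt_pos.mpr hL
  rw [div_eq_inv_mul, ← mean_const_mul]
  congr 1
  funext m
  rw [mul_max_of_nonneg _ _ (inv_nonneg.mpr hr.le), mul_zero, div_eq_inv_mul]

/-- A truncated additive function whose centre is of order `-log log n` has bounded mean positive
part. -/
theorem exists_mean_posPart_truncAdd_le {f : ℕ → ℝ} (hf : ∀ p, |f p| ≤ 1) {T : ℕ → ℝ} {c : ℝ}
    (hc : 0 < c) (hT : ∀ᶠ n in atTop, T n ≤ LL n)
    (hA : ∀ᶠ n in atTop,
      ∑ p ∈ primesAP 1 (truncLevel n), f p / p + T n ≤ -(c * LL n)) :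
    ∃ C : ℝ, ∀ᶠ n in atTop,
      mean (fun m => max (truncAdd f (truncLevel n) m + T n) 0) n ≤ C := by
  set r := min (c / 2) (1 / 12) with hr
  have hr0 : 0 < r := lt_min (by linarith) (by norm_num)
  have hr1 : r ≤ c / 2 := min_le_left _ _
  have hr2 : r ≤ 1 / 12 := min_le_right _ _
  refine ⟨r⁻¹ * 2, ?_⟩
  filter_upwards [eventually_mean_exp_truncAdd_le, hT, hA, tendsto_LL.eventually_gt_atTop 0] with
    n hn hTn hAn hL
  have h1 := hn f r hf (by rw [abs_of_pos hr0]; exact hr2)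
  have h2 : mean (fun m => max (truncAdd f (truncLevel n) m + T n) 0) n ≤
      r⁻¹ * (Real.exp (r * T n) * mean (fun m => Real.exp (r * truncAdd f (truncLevel n) m)) n) := by
    rw [← mean_const_mul, ← mean_const_mul]
    refine mean_le_mean fun m _ => ?_
    rw [← Real.exp_add, ← mul_add, add_comm (T n)]
    set x := truncAdd f (truncLevel n) m + T n
    have h3 := Real.add_one_le_exp (r * x)
    have h4 := Real.exp_pos (r * x)
    rw [le_inv_mul_iff₀ hr0, mul_max_of_nonneg _ _ hr0.le, mul_zero]
    exact max_le (by linarith) h4.le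
  refine h2.trans (mul_le_mul_of_nonneg_left ?_ (by positivity))
  refine (mul_le_mul_of_nonneg_left h1 (Real.exp_pos _).le).trans ?_
  rw [mul_add, ← Real.exp_add, ← Real.exp_add]
  have h3 : Real.exp (r * T n + (r * (∑ p ∈ primesAP 1 (truncLevel n), f p / p) +
      2 * r ^ 2 * LL n)) ≤ 1 := by
    refine Real.exp_le_one_iff.mpr ?_
    have h4 : r * (∑ p ∈ primesAP 1 (truncLevel n), f p / p + T n) ≤ r * -(c * LL n) := by gcongr
    have h5 : r * (c * LL n) ≥ r * (2 * r * LL n) := by gcongr; linarith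
    nlinarith
  have h4 : Real.exp (r * T n + -(LL n / 4)) ≤ 1 := by
    refine Real.exp_le_one_iff.mpr ?_
    have : r * T n ≤ r * LL n := by gcongr
    nlinarith
  linarith

theorem omegaQ_eq_card_filter {n m : ℕ} (hm : m ∈ Finset.Icc 1 n) (q : ℕ) :
    omegaQ m q = ((primesAP q n).filter (· ∣ m)).card := by
  rw [Finset.mem_Icc] at hm
  rw [omegaQ]
  congr 1
  ext p
  rw [Finset.mem_filter, Finset.mem_filter, mem_primesAP, Nat.mem_primeFactors]
  constructor
  · rintro ⟨⟨h1, h2, _⟩, h3⟩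
    exact ⟨⟨(Nat.le_of_dvd (by omega) h2).trans hm.2, h1, h3⟩, h2⟩
  · rintro ⟨⟨_, h1, h3⟩, h2⟩
    exact ⟨⟨h1, h2, by omega⟩, h3⟩

theorem mean_one_add_pow_omegaQ_le {n : ℕ} (hn : 1 ≤ n) (q : ℕ) {x : ℝ} (hx : 0 ≤ x) :
    mean (fun m => (1 + x) ^ omegaQ m q) n ≤ Real.exp (x * recipAP q n) := by
  have hP : ∀ p ∈ primesAP q n, p.Prime := fun p hp => (mem_primesAP.mp hp).2.1
  have hn0 : (0 : ℝ) < n := by exact_mod_cast hn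
  have h1 : ∑ m ∈ Finset.Icc 1 n, (1 + x) ^ omegaQ m q =
      ∑ S ∈ (primesAP q n).powerset, ((n / ∏ p ∈ S, p : ℕ) : ℝ) * ∏ _p ∈ S, x := by
    have h := sum_prod_filter_dvd hP (fun _ => (x : ℂ)) n
    simp only [Finset.prod_const] at h ⊢
    rw [Finset.sum_congr rfl fun m hm => by rw [← omegaQ_eq_card_filter hm q]] at h
    exact_mod_cast h
  rw [mean, h1, Finset.sum_div]
  calc ∑ S ∈ (primesAP q n).powerset, ((n / ∏ p ∈ S, p : ℕ) : ℝ) * (∏ _p ∈ S, x) / n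
      ≤ ∑ S ∈ (primesAP q n).powerset, ∏ p ∈ S, x * (p : ℝ)⁻¹ := by
        refine Finset.sum_le_sum fun S _ => ?_
        have h2 := natCast_div_div_le_inv (n := n) (p := ∏ p ∈ S, p) hn
        rw [Finset.prod_mul_distrib, mul_div_right_comm, mul_comm]
        refine mul_le_mul_of_nonneg_left (h2.trans (le_of_eq ?_))
          (Finset.prod_nonneg fun _ _ => hx)
        rw [Nat.cast_prod, Finset.prod_inv_distrib]
    _ = ∏ p ∈ primesAP q n, (1 + x * (p : ℝ)⁻¹) := (Finset.prod_one_add _).symm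
    _ ≤ ∏ p ∈ primesAP q n, Real.exp (x * (p : ℝ)⁻¹) :=
        Finset.prod_le_prod (fun p _ => by positivity) fun p _ => by
          linarith [Real.add_one_le_exp (x * (p : ℝ)⁻¹)]
    _ = _ := by rw [← Real.exp_sum, recipAP, Finset.mul_sum]

theorem mean_posPart_omegaQ_sub_le {n : ℕ} (hn : 1 ≤ n) (q : ℕ) {x : ℝ} (hx : 0 ≤ x)
    (hx1 : 1 ≤ Real.log (1 + x)) (T : ℝ) :
    mean (fun m => max ((omegaQ m q : ℝ) - T) 0) n ≤
      Real.exp (-(Real.log (1 + x) * T)) * Real.exp (x * recipAP q n) := by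
  refine le_trans ?_ (mul_le_mul_of_nonneg_left (mean_one_add_pow_omegaQ_le hn q hx)
    (Real.exp_pos _).le)
  rw [← mean_const_mul]
  refine mean_le_mean fun m _ => ?_
  have h1 : (1 + x) ^ omegaQ m q = Real.exp (Real.log (1 + x) * omegaQ m q) := by
    rw [mul_comm, Real.exp_nat_mul, Real.exp_log (by linarith)]
  rw [h1, ← Real.exp_add]
  set y := (omegaQ m q : ℝ) - T with hy
  have h2 : -(Real.log (1 + x) * T) + Real.log (1 + x) * omegaQ m q = Real.log (1 + x) * y := by
    rw [hy]; ring
  rw [h2]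
  refine max_le ?_ (Real.exp_pos _).le
  rcases le_total y 0 with h | h
  · exact h.trans (Real.exp_pos _).le
  · have := Real.add_one_le_exp (Real.log (1 + x) * y)
    nlinarith

theorem le_two_mul_totient_of_isPrimePow {q : ℕ} (hq : IsPrimePow q) : q ≤ 2 * q.totient := by
  obtain ⟨p, k, hp, hk, rfl⟩ := (isPrimePow_nat_iff q).mp hq
  rw [Nat.totient_prime_pow hp hk]
  obtain ⟨k, rfl⟩ := Nat.exists_eq_succ_of_ne_zero hk.ne'
  have h2 : p ≤ 2 * (p - 1) := by have := hp.two_le; omega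
  calc p ^ (k + 1) = p ^ k * p := pow_succ p k
    _ ≤ p ^ k * (2 * (p - 1)) := Nat.mul_le_mul_left _ h2
    _ = _ := by rw [Nat.succ_sub_one]; ring

theorem exists_sum_mean_posPart_omegaQ_le {φ : ℝ} (hφ : 1 ≤ φ) :
    ∃ Q : ℕ, ∃ C : ℝ, ∀ᶠ n : ℕ in atTop,
      ∑ q ∈ (Finset.Icc Q n).filter IsPrimePow,
        mean (fun m => max ((omegaQ m q : ℝ) - LL n / (2 * φ)) 0) n ≤ C := by
  set C0 := ∑' p : Nat.Primes, (p : ℝ) ^ (-2 : ℝ) with hC0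
  set x0 := Real.exp (12 * φ) - 1 with hx0
  have hx0pos : 0 < x0 := by
    have := Real.add_one_le_exp (12 * φ)
    linarith
  have hlog0 : Real.log (1 + x0) = 12 * φ := by rw [hx0, add_sub_cancel, Real.log_exp]
  obtain ⟨Q, hQ⟩ := exists_nat_ge (12 * x0 + 2)
  refine ⟨Q, ∑' k : ℕ, 48 * (1 / (k : ℝ) ^ 2), ?_⟩
  have hsum : Summable fun k : ℕ => 48 * (1 / (k : ℝ) ^ 2) :=
    (Real.summable_one_div_nat_pow.mpr one_lt_two).mul_left 48
  have hQ2 : 2 ≤ Q := by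
    have : (2 : ℝ) ≤ Q := by linarith
    exact_mod_cast this
  have hsmall : ∀ᶠ n : ℕ in atTop, x0 * (3 * (Real.log (1 + 4 * LL n) + C0)) ≤ LL n := by
    have h1 : Tendsto (fun y : ℝ => 1 + 4 * y) atTop atTop :=
      tendsto_atTop_add_const_left _ _ (tendsto_id.const_mul_atTop (by norm_num))
    have h2 : (fun y : ℝ => Real.log (1 + 4 * y)) =o[atTop] (fun y : ℝ => y) := by
      refine (Real.isLittleO_log_id_atTop.comp_tendsto h1).trans_isBigO ?_
      refine Asymptotics.IsBigO.of_bound 5 ?_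
      filter_upwards [eventually_ge_atTop 1] with y hy
      simp only [Function.comp_apply, id]
      rw [Real.norm_of_nonneg (by linarith), Real.norm_of_nonneg (by linarith)]
      linarith
    have h3 : (fun y : ℝ => x0 * (3 * (Real.log (1 + 4 * y) + C0))) =o[atTop] (fun y : ℝ => y) :=
      ((h2.add (Asymptotics.isLittleO_const_id_atTop C0)).const_mul_left 3).const_mul_left x0
    filter_upwards [(h3.comp_tendsto tendsto_LL).bound one_pos,
      tendsto_LL.eventually_ge_atTop 0] with n hn hL
    simp only [Function.comp_apply, one_mul] at hn
    rw [Real.norm_of_nonneg hL] at hn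
    exact (Real.le_norm_self _).trans hn
  filter_upwards [hsmall, tendsto_LL.eventually_ge_atTop (8 * φ),
    tendsto_log_natCast.eventually_ge_atTop 4, eventually_ge_atTop 1,
    tendsto_natCast_atTop_atTop.eventually_ge_atTop (Real.exp 1)] with n hs hL hl hn hne
  refine (Finset.sum_le_sum fun q hq => ?_).trans (hsum.sum_le_tsum _ fun k _ => by positivity)
  obtain ⟨hq1, hqp⟩ := Finset.mem_filter.mp hq
  have hqQ := (Finset.mem_Icc.mp hq1).1
  have hq2 : 2 ≤ q := hQ2.trans hqQ
  have hq0 : (0 : ℝ) < q := by positivity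
  have hqQ' : (Q : ℝ) ≤ q := by exact_mod_cast hqQ
  have hl0 : 0 < Real.log n := by linarith
  have hφ0 : 0 < φ := by linarith
  have hexpL : Real.exp (LL n) = Real.log n := Real.exp_log hl0
  have hT : 4 ≤ LL n / (2 * φ) := by
    rw [le_div_iff₀ (by positivity)]; linarith
  rcases le_or_gt (q : ℝ) (Real.log n ^ 2) with hcase | hcase
  · refine (mean_posPart_omegaQ_sub_le hn q hx0pos.le (by rw [hlog0]; linarith) _).trans ?_
    have h1 := recipAP_le_uniform hq2 hne
    rw [Nat.floor_natCast] at h1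
    have htot : (Q : ℝ) / 2 ≤ q.totient := by
      have : (q : ℝ) ≤ 2 * q.totient := by
        exact_mod_cast le_two_mul_totient_of_isPrimePow hqp
      linarith
    have htot0 : (0 : ℝ) < q.totient := by
      have : (0 : ℝ) < Q := by positivity
      linarith
    have h2 : x0 * (3 * ((LL n + 1) / q.totient)) ≤ LL n := by
      have h3 : x0 * (3 * ((LL n + 1) / q.totient)) = 3 * x0 * (LL n + 1) / q.totient := by ring
      rw [h3, div_le_iff₀ htot0]
      have h4 : LL n * (6 * x0) ≤ LL n * q.totient :=
        mul_le_mul_of_nonneg_left (by linarith) (by linarith)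
      nlinarith
    have h3 : Real.log (1 + 2 * Real.log q) ≤ Real.log (1 + 4 * LL n) := by
      have h4 : Real.log q ≤ 2 * LL n := by
        have h5 := Real.log_le_log hq0 hcase
        rw [Real.log_pow] at h5
        exact_mod_cast h5
      have h5 : 0 ≤ Real.log q := Real.log_nonneg (by exact_mod_cast (by omega : 1 ≤ q))
      exact Real.log_le_log (by linarith) (by linarith)
    have h4 : x0 * recipAP q n ≤ 2 * LL n := by
      have h5 : x0 * recipAP q n ≤ x0 * (3 * ((LL n + 1) / q.totient) +
          3 * (Real.log (1 + 4 * LL n) + C0)) := by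
        refine mul_le_mul_of_nonneg_left ?_ hx0pos.le
        change recipAP q n ≤ 3 * ((LL n + 1) / q.totient + _ + _) at h1
        linarith
      linarith
    have h5 : Real.log (1 + x0) * (LL n / (2 * φ)) = 6 * LL n := by
      rw [hlog0]; field_simp; ring
    rw [h5, ← Real.exp_add]
    have h6 : Real.exp (-(6 * LL n) + x0 * recipAP q n) ≤ Real.exp (-(4 * LL n)) :=
      Real.exp_le_exp.mpr (by linarith)
    refine h6.trans ?_
    have h7 : Real.exp (-(4 * LL n)) = (Real.log n ^ 4)⁻¹ := by
      rw [Real.exp_neg, ← hexpL, ← Real.exp_nat_mul]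
      norm_num
    rw [h7]
    have h8 : ((Real.log n) ^ 4)⁻¹ ≤ 1 / (q : ℝ) ^ 2 := by
      rw [one_div]
      gcongr
      calc (q : ℝ) ^ 2 ≤ (Real.log n ^ 2) ^ 2 := by gcongr
        _ = _ := by ring
    have h9 : (0 : ℝ) ≤ 1 / (q : ℝ) ^ 2 := by positivity
    linarith
  · set x := q / (2 * Real.log n) with hx
    have hx2 : 2 ≤ x := by
      rw [hx, le_div_iff₀ (by positivity)]
      nlinarith
    have hlogx : 1 ≤ Real.log (1 + x) := by
      rw [Real.le_log_iff_exp_le (by linarith)]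
      linarith [Real.exp_one_lt_d9]
    refine (mean_posPart_omegaQ_sub_le hn q (by linarith) hlogx _).trans ?_
    have h1 : x * recipAP q n ≤ 1 := by
      have h2 : recipAP q n ≤ (2 * Real.log n) / q :=
        (recipAP_le_one_add_log_div hq2 n).trans (by gcongr; linarith)
      refine (mul_le_mul_of_nonneg_left h2 (by linarith)).trans (le_of_eq ?_)
      rw [hx]; field_simp
    have h2 : Real.exp (x * recipAP q n) ≤ 3 :=
      (Real.exp_le_exp.mpr h1).trans (by linarith [Real.exp_one_lt_d9])
    have h3 : Real.exp (-(Real.log (1 + x) * (LL n / (2 * φ)))) ≤ (x ^ 4)⁻¹ := by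
      rw [Real.exp_neg]
      gcongr
      have h4 : x ^ 4 = Real.exp (Real.log x * 4) := by
        rw [mul_comm, ← Real.exp_log (by linarith : 0 < x), ← Real.exp_nat_mul, Real.log_exp]
        norm_num
      rw [h4]
      refine Real.exp_le_exp.mpr ?_
      have h5 : Real.log x ≤ Real.log (1 + x) := Real.log_le_log (by linarith) (by linarith)
      have h6 : 0 ≤ Real.log x := Real.log_nonneg (by linarith)
      gcongr
    have h4 : (x ^ 4)⁻¹ ≤ 16 * (1 / (q : ℝ) ^ 2) := by
      have h5 : (x ^ 4)⁻¹ = 16 * ((Real.log n ^ 2) ^ 2 / (q : ℝ) ^ 4) := by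
        rw [hx]; field_simp; norm_num
      rw [h5]
      have h6 : (Real.log n ^ 2) ^ 2 / (q : ℝ) ^ 4 ≤ 1 / (q : ℝ) ^ 2 := by
        rw [div_le_div_iff₀ (by positivity) (by positivity)]
        have : (Real.log n ^ 2) ^ 2 ≤ (q : ℝ) ^ 2 := by gcongr
        nlinarith [sq_nonneg (q : ℝ)]
      linarith
    calc _ ≤ (x ^ 4)⁻¹ * 3 := mul_le_mul h3 h2 (Real.exp_pos _).le (by positivity)
      _ ≤ 48 * (1 / (q : ℝ) ^ 2) := by linarith

theorem mean_padicValNat_two_le {n : ℕ} (hn : 1 ≤ n) :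
    mean (fun m => (padicValNat 2 m : ℝ)) n ≤ 1 := by
  have h1 : ∀ N, ∑ m ∈ Finset.Icc 1 N, padicValNat 2 m = padicValNat 2 N.factorial := by
    intro N
    induction N with
    | zero => simp
    | succ N ih =>
      rw [Finset.sum_Icc_succ_top (by omega), ih, Nat.factorial_succ,
        padicValNat.mul (by omega) (Nat.factorial_ne_zero N), add_comm]
  have h2 : padicValNat 2 n.factorial ≤ n := by
    have := sub_one_mul_padicValNat_factorial (p := 2) n
    omega
  have hn0 : (0 : ℝ) < n := by exact_mod_cast hn
  rw [mean, div_le_one hn0, ← Nat.cast_sum, h1]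
  exact_mod_cast h2

/-- `ℤ/a × ℤ/b ≅ ℤ/gcd(a,b) × ℤ/lcm(a,b)`. -/
theorem nonempty_zmod_prod_addEquiv_gcd_lcm {a b : ℕ} (ha : 0 < a) (hb : 0 < b) :
    Nonempty (ZMod a × ZMod b ≃+ ZMod (a.gcd b) × ZMod (a.lcm b)) := by
  obtain ⟨a', ha'⟩ := Nat.gcd_dvd_left a b
  obtain ⟨b', hb'⟩ := Nat.gcd_dvd_right a b
  set g := a.gcd b with hg
  have hg0 : 0 < g := Nat.gcd_pos_of_pos_left b ha
  have hl : a.lcm b = g * a' * b' := by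
    have h := Nat.gcd_mul_lcm a b
    rw [← hg] at h
    apply Nat.eq_of_mul_eq_mul_left hg0
    rw [h]
    nth_rewrite 1 [ha', hb']
    ring
  have haz : (a : ℤ) = g * a' := by exact_mod_cast ha'
  have hbz : (b : ℤ) = g * b' := by exact_mod_cast hb'
  have hst : (a' : ℤ) * a.gcdA b + b' * a.gcdB b = 1 := by
    have h := Nat.gcd_eq_gcd_ab a b
    rw [← hg] at h
    have h' : (g : ℤ) * (a' * a.gcdA b + b' * a.gcdB b) = g * 1 := by
      rw [mul_one]
      linear_combination -h - a.gcdA b * haz - a.gcdB b * hbz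
    exact mul_left_cancel₀ (by exact_mod_cast hg0.ne') h'
  rw [hl]
  set s := a.gcdA b
  set t := a.gcdB b
  let f1 : ℤ →+ ZMod (g * a' * b') := (zmultiplesHom _) (((b' * t : ℤ)) : ZMod (g * a' * b'))
  let f2 : ℤ →+ ZMod (g * a' * b') := (zmultiplesHom _) (((a' * s : ℤ)) : ZMod (g * a' * b'))
  have hf1 : f1 (a : ℤ) = 0 := by
    simp only [f1, zmultiplesHom_apply, zsmul_eq_mul, ← Int.cast_mul]
    rw [ZMod.intCast_zmod_eq_zero_iff_dvd]
    refine ⟨t, ?_⟩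
    nth_rewrite 1 [ha']
    push_cast
    ring
  have hf2 : f2 (b : ℤ) = 0 := by
    simp only [f2, zmultiplesHom_apply, zsmul_eq_mul, ← Int.cast_mul]
    rw [ZMod.intCast_zmod_eq_zero_iff_dvd]
    refine ⟨s, ?_⟩
    nth_rewrite 1 [hb']
    push_cast
    ring
  let F1 := ZMod.lift a ⟨f1, hf1⟩
  let F2 := ZMod.lift b ⟨f2, hf2⟩
  let c1 : ZMod a →+ ZMod g := (ZMod.castHom (Nat.gcd_dvd_left a b) (ZMod g)).toAddMonoidHom
  let c2 : ZMod b →+ ZMod g := (ZMod.castHom (Nat.gcd_dvd_right a b) (ZMod g)).toAddMonoidHom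
  let F : ZMod a × ZMod b →+ ZMod g × ZMod (g * a' * b') :=
    (c1.coprod (-c2)).prod (F1.coprod F2)
  have hinj : Function.Injective F := by
    rw [injective_iff_map_eq_zero]
    rintro ⟨x, y⟩ hxy
    obtain ⟨x, rfl⟩ := ZMod.intCast_surjective x
    obtain ⟨y, rfl⟩ := ZMod.intCast_surjective y
    have h1 : ((x - y : ℤ) : ZMod g) = 0 := by
      have := congrArg Prod.fst hxy
      simpa [F, c1, c2, sub_eq_add_neg] using this
    have h2 : ((x * (b' * t) + y * (a' * s) : ℤ) : ZMod (g * a' * b')) = 0 := by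
      have := congrArg Prod.snd hxy
      simpa [F, F1, F2, f1, f2] using this
    rw [ZMod.intCast_zmod_eq_zero_iff_dvd] at h1 h2
    obtain ⟨k, hk⟩ := h1
    obtain ⟨c, hc⟩ := h2
    push_cast at hc
    refine Prod.ext ?_ ?_
    · change (x : ZMod a) = 0
      rw [ZMod.intCast_zmod_eq_zero_iff_dvd, haz]
      refine ⟨b' * c + s * k, ?_⟩
      linear_combination hc - x * hst + (a' * s : ℤ) * hk
    · change (y : ZMod b) = 0
      rw [ZMod.intCast_zmod_eq_zero_iff_dvd, hbz]
      refine ⟨a' * c - t * k, ?_⟩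
      linear_combination hc - y * hst - (b' * t : ℤ) * hk
  have hl0 : 0 < g * a' * b' := hl ▸ Nat.lcm_pos ha hb
  have : NeZero a := ⟨ha.ne'⟩
  have : NeZero b := ⟨hb.ne'⟩
  have : NeZero g := ⟨hg0.ne'⟩
  have : NeZero (g * a' * b') := ⟨hl0.ne'⟩
  refine ⟨AddEquiv.ofBijective F ((Fintype.bijective_iff_injective_and_card F).mpr ⟨hinj, ?_⟩)⟩
  rw [Fintype.card_prod, Fintype.card_prod, ZMod.card, ZMod.card, ZMod.card, ZMod.card, ← hl,
    Nat.gcd_mul_lcm]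

/-- The product of a dependent family over `Fin (k + 1)` splits off the first factor. -/
def zmodPiConsEquiv {k : ℕ} (x : ℕ) (f : Fin k → ℕ) :
    (∀ j : Fin (k + 1), ZMod ((Fin.cons x f : Fin (k + 1) → ℕ) j)) ≃+
      ZMod x × ∀ j : Fin k, ZMod (f j) where
  toFun g := (g 0, fun j => g j.succ)
  invFun g := Fin.cons (α := fun j => ZMod ((Fin.cons x f : Fin (k + 1) → ℕ) j)) g.1 g.2
  left_inv g := by
    funext j
    refine Fin.cases ?_ (fun j => ?_) j <;> rfl
  right_inv g := rfl
  map_add' g h := rfl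

theorem exists_dvd_chain_insert {K : ℕ} (lam : Fin K → ℕ) (hlam : ∀ j, 1 < lam j)
    (hchain : ∀ j k : Fin K, j ≤ k → lam j ∣ lam k) {n : ℕ} (hn : 1 < n) :
    ∃ (L : ℕ) (mu : Fin L → ℕ), (∀ j, 1 < mu j) ∧ (∀ j k : Fin L, j ≤ k → mu j ∣ mu k) ∧
      Nonempty ((ZMod n × ∀ j, ZMod (lam j)) ≃+ ∀ j, ZMod (mu j)) ∧
      ∀ y, y ∣ n → (∀ j, y ∣ lam j) → ∀ j, y ∣ mu j := by
  induction K generalizing n with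
  | zero =>
    refine ⟨1, Fin.cons n lam, fun j => ?_, fun j k _ => ?_, ⟨(zmodPiConsEquiv n lam).symm⟩,
      fun y hy _ j => ?_⟩
    · rw [Subsingleton.elim j 0]; exact hn
    · rw [Subsingleton.elim j k]
    · rw [Subsingleton.elim j 0]; exact hy
  | succ K ih =>
    obtain ⟨x, f, rfl⟩ : ∃ (x : ℕ) (f : Fin K → ℕ), lam = Fin.cons x f :=
      ⟨lam 0, fun j => lam j.succ, (Fin.cons_self_tail lam).symm⟩
    have hx : 1 < x := hlam 0
    have hxf : ∀ j, x ∣ f j := fun j => hchain 0 j.succ (Fin.zero_le _)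
    have hl : 1 < n.lcm x :=
      hn.trans_le (Nat.le_of_dvd (Nat.lcm_pos (by omega) (by omega)) (Nat.dvd_lcm_left _ _))
    obtain ⟨L, mu, h1, h2, ⟨e⟩, h4⟩ := ih f (fun j => hlam j.succ)
      (fun j k hjk => hchain j.succ k.succ (Fin.succ_le_succ_iff.mpr hjk)) hl
    obtain ⟨e0⟩ := nonempty_zmod_prod_addEquiv_gcd_lcm (by omega : 0 < n) (by omega : 0 < x)
    have hg : ∀ j, n.gcd x ∣ mu j :=
      h4 _ ((Nat.gcd_dvd_left _ _).trans (Nat.dvd_lcm_left _ _))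
        fun j => (Nat.gcd_dvd_right _ _).trans (hxf j)
    have e1 : (ZMod n × ∀ j, ZMod ((Fin.cons x f : Fin (K + 1) → ℕ) j)) ≃+
        ZMod (n.gcd x) × ∀ j, ZMod (mu j) :=
      ((AddEquiv.refl _).prodCongr (zmodPiConsEquiv x f)).trans <|
        (AddEquiv.prodAssoc (M := ZMod n) (N := ZMod x) (P := ∀ j, ZMod (f j))).symm.trans <|
        (e0.prodCongr (AddEquiv.refl _)).trans <|
        AddEquiv.prodAssoc.trans <| (AddEquiv.refl _).prodCongr e
    have hy : ∀ y, y ∣ n → (∀ j, y ∣ (Fin.cons x f : Fin (K + 1) → ℕ) j) →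
        y ∣ n.gcd x ∧ ∀ j, y ∣ mu j := fun y hyn hyf =>
      ⟨Nat.dvd_gcd hyn (hyf 0), h4 y (hyn.trans (Nat.dvd_lcm_left _ _)) fun j => hyf j.succ⟩
    by_cases hg1 : n.gcd x = 1
    · rw [hg1] at e1
      exact ⟨L, mu, h1, h2, ⟨e1.trans AddEquiv.uniqueProd⟩, fun y hyn hyf => (hy y hyn hyf).2⟩
    · have hg2 : 1 < n.gcd x := by
        have := Nat.gcd_pos_of_pos_left x (by omega : 0 < n)
        omega
      refine ⟨L + 1, Fin.cons (n.gcd x) mu, fun j => ?_, fun j k hjk => ?_,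
        ⟨e1.trans (zmodPiConsEquiv _ _).symm⟩, fun y hyn hyf j => ?_⟩
      · exact Fin.cases hg2 h1 j
      · induction j using Fin.cases with
        | zero => exact Fin.cases dvd_rfl hg k
        | succ j =>
          induction k using Fin.cases with
          | zero => exact absurd hjk (by simp)
          | succ k => exact h2 j k (Fin.succ_le_succ_iff.mp hjk)
      · exact Fin.cases (hy y hyn hyf).1 (hy y hyn hyf).2 j

/-- Invariant factor decomposition of a finite product of cyclic groups. -/
theorem exists_dvd_chain_of_pi {k : ℕ} (f : Fin k → ℕ) (hf : ∀ j, 1 < f j) :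
    ∃ (L : ℕ) (mu : Fin L → ℕ), (∀ j, 1 < mu j) ∧ (∀ j k : Fin L, j ≤ k → mu j ∣ mu k) ∧
      Nonempty ((∀ j, ZMod (f j)) ≃+ ∀ j, ZMod (mu j)) := by
  induction k with
  | zero => exact ⟨0, f, hf, fun j => j.elim0, ⟨AddEquiv.refl _⟩⟩
  | succ k ih =>
    obtain ⟨x, f, rfl⟩ : ∃ (x : ℕ) (g : Fin k → ℕ), f = Fin.cons x g :=
      ⟨f 0, fun j => f j.succ, (Fin.cons_self_tail f).symm⟩
    obtain ⟨L, mu, h1, h2, ⟨e⟩⟩ := ih f fun j => hf j.succ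
    obtain ⟨M, nu, h3, h4, ⟨e'⟩, -⟩ := exists_dvd_chain_insert mu h1 h2 (hf 0)
    exact ⟨M, nu, h3, h4, ⟨(zmodPiConsEquiv x f).trans
      (((AddEquiv.refl _).prodCongr e).trans e')⟩⟩

/-- Every finite abelian group has an invariant factor decomposition. -/
theorem exists_invariantFactors (G : Type*) [CommGroup G] [Finite G] :
    ∃ (K : ℕ) (lam : Fin K → ℕ), (∀ j, 1 < lam j) ∧ (∀ j k : Fin K, j ≤ k → lam j ∣ lam k) ∧
      Nonempty (G ≃* Multiplicative (∀ j : Fin K, ZMod (lam j))) := by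
  obtain ⟨ι, _, n, hn, ⟨e⟩⟩ := CommGroup.equiv_prod_multiplicative_zmod_of_finite G
  let r := (Fintype.equivFin ι).symm
  obtain ⟨L, mu, h1, h2, ⟨e'⟩⟩ := exists_dvd_chain_of_pi (fun j => n (r j)) fun j => hn _
  have e1 : (∀ i, Multiplicative (ZMod (n i))) ≃* Multiplicative (∀ i, ZMod (n i)) :=
    (MulEquiv.piMultiplicative fun i => ZMod (n i)).symm
  have e2 : (∀ i, ZMod (n i)) ≃+ ∀ j, ZMod (n (r j)) :=
    { (Equiv.piCongrLeft' (fun i => ZMod (n i)) r.symm) with map_add' := fun _ _ => rfl }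
  exact ⟨L, mu, h1, h2, ⟨e.trans (e1.trans (AddEquiv.toMultiplicative (e2.trans e')))⟩⟩

/-- The number of solutions of `x ^ k = 1` in a commutative group. -/
def torsionCard (G : Type*) [CommGroup G] (k : ℕ) : ℕ := Nat.card {x : G // x ^ k = 1}

theorem torsionCard_congr {G H : Type*} [CommGroup G] [CommGroup H] (e : G ≃* H) (k : ℕ) :
    torsionCard G k = torsionCard H k :=
  Nat.card_congr (e.toEquiv.subtypeEquiv fun x => by
    rw [MulEquiv.toEquiv_eq_coe, MulEquiv.coe_toEquiv, ← map_pow, EmbeddingLike.map_eq_one_iff])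

theorem torsionCard_pos (G : Type*) [CommGroup G] [Finite G] (k : ℕ) : 0 < torsionCard G k :=
  have : Nonempty {x : G // x ^ k = 1} := ⟨⟨1, one_pow k⟩⟩
  Nat.card_pos

theorem torsionCard_pi {ι : Type*} [Fintype ι] (G : ι → Type*) [∀ i, CommGroup (G i)] (k : ℕ) :
    torsionCard (∀ i, G i) k = ∏ i, torsionCard (G i) k := by
  unfold torsionCard
  rw [← Nat.card_pi]
  exact Nat.card_congr
    ((Equiv.subtypeEquivRight fun x => by simp [funext_iff]).trans
      (Equiv.subtypePiEquivPi (p := fun i (x : G i) => x ^ k = 1)))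

theorem torsionCard_of_isCyclic (G : Type*) [CommGroup G] [Finite G] [IsCyclic G] (k : ℕ) :
    torsionCard G k = (Nat.card G).gcd k :=
  (Nat.card_congr (Equiv.subtypeEquivRight fun x => by
    rw [MonoidHom.mem_ker, powMonoidHom_apply])).trans (IsCyclic.card_powMonoidHom_ker (G := G) k)

/-- `s` is the `l`-rank of the group of `l ^ a`-th powers in `G`. -/
def HasPowRank (G : Type*) [CommGroup G] (l a s : ℕ) : Prop :=
  torsionCard G (l ^ (a + 1)) = torsionCard G (l ^ a) * l ^ s

theorem HasPowRank.unique {G : Type*} [CommGroup G] [Finite G] {l a s t : ℕ} (hl : 1 < l)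
    (hs : HasPowRank G l a s) (ht : HasPowRank G l a t) : s = t :=
  Nat.pow_right_injective hl
    (Nat.eq_of_mul_eq_mul_left (torsionCard_pos G _) (hs.symm.trans ht))

theorem HasPowRank.congr {G H : Type*} [CommGroup G] [CommGroup H] {l a s : ℕ}
    (h : HasPowRank G l a s) (e : G ≃* H) : HasPowRank H l a s := by
  rw [HasPowRank, ← torsionCard_congr e, ← torsionCard_congr e]
  exact h

theorem HasPowRank.pi {ι : Type*} [Fintype ι] {G : ι → Type*} [∀ i, CommGroup (G i)] {l a : ℕ}
    {s : ι → ℕ} (h : ∀ i, HasPowRank (G i) l a (s i)) :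
    HasPowRank (∀ i, G i) l a (∑ i, s i) := by
  rw [HasPowRank, torsionCard_pi, torsionCard_pi, ← Finset.prod_pow_eq_pow_sum,
    ← Finset.prod_mul_distrib]
  exact Finset.prod_congr rfl fun i _ => h i

theorem hasPowRank_of_isCyclic (G : Type*) [CommGroup G] [Finite G] [IsCyclic G] {l : ℕ}
    (hl : l.Prime) (a : ℕ) :
    HasPowRank G l a (if l ^ (a + 1) ∣ Nat.card G then 1 else 0) := by
  rw [HasPowRank, torsionCard_of_isCyclic, torsionCard_of_isCyclic]
  split_ifs with h
  · rw [Nat.gcd_eq_right h, Nat.gcd_eq_right ((pow_dvd_pow l (Nat.le_succ a)).trans h), pow_one,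
      pow_succ]
  · rw [pow_zero, mul_one]
    refine Nat.dvd_antisymm (Nat.dvd_gcd (Nat.gcd_dvd_left _ _) ?_)
      (Nat.gcd_dvd_gcd_of_dvd_right _ (pow_dvd_pow l (Nat.le_succ a)))
    obtain ⟨j, hj, hj'⟩ := (Nat.dvd_prime_pow hl).mp (Nat.gcd_dvd_right (Nat.card G) (l ^ (a + 1)))
    rw [hj']
    refine pow_dvd_pow l (Nat.lt_succ_iff.mp (lt_of_le_of_ne hj fun hja => h ?_))
    rw [Nat.succ_eq_add_one] at hja
    rw [← hja, ← hj']
    exact Nat.gcd_dvd_left _ _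

/-- In a group of order `2 ^ e` the ranks are at most `e`, and vanish for odd `l`. -/
theorem exists_hasPowRank_of_card_eq_two_pow (G : Type*) [CommGroup G] [Finite G] {e : ℕ}
    (hG : Nat.card G = 2 ^ e) {l : ℕ} (hl : l.Prime) (a : ℕ) :
    ∃ s, HasPowRank G l a s ∧ s ≤ e ∧ (l ≠ 2 → s = 0) := by
  have hker : ∀ k, torsionCard G k = Nat.card (powMonoidHom k : G →* G).ker := fun k =>
    Nat.card_congr (Equiv.subtypeEquivRight fun x => by
      rw [MonoidHom.mem_ker, powMonoidHom_apply])
  have hdvd : ∀ k, torsionCard G k ∣ 2 ^ e := fun k => by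
    rw [hker, ← hG]; exact Subgroup.card_subgroup_dvd_card _
  have hmono : torsionCard G (l ^ a) ∣ torsionCard G (l ^ (a + 1)) := by
    rw [hker, hker]
    refine Subgroup.card_dvd_of_le fun x hx => ?_
    rw [MonoidHom.mem_ker, powMonoidHom_apply] at hx ⊢
    rw [pow_succ, pow_mul, hx, one_pow]
  by_cases h2 : l = 2
  · subst h2
    obtain ⟨c, hc⟩ := hmono
    obtain ⟨s, hs, rfl⟩ := (Nat.dvd_prime_pow Nat.prime_two).mp
      ((Dvd.intro_left _ hc.symm).trans (hdvd (2 ^ (a + 1))))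
    exact ⟨s, hc, hs, fun h => absurd rfl h⟩
  · refine ⟨0, ?_, Nat.zero_le _, fun _ => rfl⟩
    have hone : ∀ k, torsionCard G (l ^ k) = 1 := fun k => by
      have : Unique {x : G // x ^ l ^ k = 1} :=
        { default := ⟨1, one_pow _⟩
          uniq := fun x => by
            have hx := orderOf_dvd_of_pow_eq_one x.2
            have hx' : orderOf x.1 ∣ 2 ^ e := hG ▸ orderOf_dvd_natCard _
            have hco : (2 ^ e).Coprime (l ^ k) := Nat.Coprime.pow _ _
              ((Nat.coprime_primes Nat.prime_two hl).mpr (Ne.symm h2))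
            exact Subtype.ext (orderOf_eq_one_iff.mp (Nat.eq_one_of_dvd_coprimes hco hx' hx)) }
      exact Nat.card_unique
    rw [HasPowRank, hone, hone, pow_zero, mul_one]

/-- The number of invariant factors divisible by `l ^ (a + 1)` is a rank. -/
theorem hasPowRank_pi_zmod {K : ℕ} {lam : Fin K → ℕ} (hlam : ∀ j, 1 < lam j) {l : ℕ}
    (hl : l.Prime) (a : ℕ) :
    HasPowRank (Multiplicative (∀ j, ZMod (lam j))) l a
      (Finset.univ.filter fun j => l ^ (a + 1) ∣ lam j).card := by
  have hne : ∀ j, NeZero (lam j) := fun j => ⟨by have := hlam j; omega⟩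
  rw [Finset.card_filter]
  refine HasPowRank.congr (HasPowRank.pi fun j => ?_)
    (MulEquiv.piMultiplicative fun j => ZMod (lam j)).symm
  have h := hasPowRank_of_isCyclic (Multiplicative (ZMod (lam j))) hl a
  rwa [Nat.card_congr Multiplicative.toAdd, Nat.card_zmod] at h

/-- The unit group of `ℤ/mℤ` as a product over the prime powers exactly dividing `m`. -/
def unitsZModEquivPi {m : ℕ} (hm : m ≠ 0) :
    (ZMod m)ˣ ≃* ∀ p : m.primeFactors, (ZMod ((p : ℕ) ^ m.factorization p))ˣ :=
  (Units.mapEquiv (ZMod.equivPi m hm).toMulEquiv).trans MulEquiv.piUnits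

theorem exists_hasPowRank_units_zmod_prime_pow {p e l : ℕ} (hp : p.Prime) (he : e ≠ 0)
    (hl : l.Prime) (a : ℕ) :
    ∃ s, HasPowRank (ZMod (p ^ e))ˣ l a s ∧
      (if p % l ^ (a + 1) = 1 % l ^ (a + 1) then 1 else 0) ≤ s ∧
      s ≤ (if p % l ^ (a + 1) = 1 % l ^ (a + 1) then 1 else 0) +
        if p = l then 1 + (2 ^ e).factorization p * (if p = 2 then 1 else 0) else 0 := by
  set q := l ^ (a + 1) with hq
  have hq2 : 2 ≤ q := hl.two_le.trans (Nat.le_self_pow (Nat.succ_ne_zero a) l)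
  have hne : NeZero (p ^ e) := ⟨pow_ne_zero e hp.ne_zero⟩
  have hcard : Nat.card (ZMod (p ^ e))ˣ = p ^ (e - 1) * (p - 1) := by
    rw [Nat.card_eq_fintype_card, ZMod.card_units_eq_totient,
      Nat.totient_prime_pow hp (Nat.pos_of_ne_zero he)]
  by_cases hp2 : p = 2
  · subst hp2
    obtain ⟨s, hs, hse, hs0⟩ := exists_hasPowRank_of_card_eq_two_pow (ZMod (2 ^ e))ˣ
      (by simpa using hcard) hl a
    have hmod : ¬ 2 % q = 1 % q := by
      rcases hq2.eq_or_lt with h | h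
      · rw [← h]; norm_num
      · rw [Nat.mod_eq_of_lt h, Nat.mod_eq_of_lt (by omega)]; norm_num
    refine ⟨s, hs, by rw [if_neg hmod]; exact Nat.zero_le _, ?_⟩
    rw [if_neg hmod, Nat.prime_two.factorization_pow]
    by_cases h2 : l = 2
    · simp [h2]; omega
    · rw [hs0 h2]; exact Nat.zero_le _
  · have hcyc : IsCyclic (ZMod (p ^ e))ˣ := ZMod.isCyclic_units_of_prime_pow p hp hp2 e
    refine ⟨_, hasPowRank_of_isCyclic _ hl a, ?_⟩
    rw [hcard, ← hq]
    have hiff : p % q = 1 % q ↔ q ∣ p - 1 := by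
      rw [← Nat.modEq_iff_dvd' hp.one_le]
      exact eq_comm
    simp only [hiff]
    by_cases h : q ∣ p - 1
    · simp [h, Dvd.dvd.mul_left h]
    · by_cases hpl : p = l
      · rw [if_pos hpl, if_neg h]
        split_ifs <;> omega
      · have hco : q.Coprime (p ^ (e - 1)) :=
          Nat.Coprime.pow _ _ ((Nat.coprime_primes hl hp).mpr (Ne.symm hpl))
        have : ¬ q ∣ p ^ (e - 1) * (p - 1) := fun h' => h (hco.dvd_of_dvd_mul_left h')
        simp [h, this]

/-- The number of invariant factors of `(ℤ/mℤ)ˣ` divisible by a prime power `q` is close to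
the number of primes `p ∣ m` with `p ≡ 1 (mod q)`. -/
theorem omegaQ_le_card_dvd_le {m K q : ℕ} (hm : m ≠ 0) {lam : Fin K → ℕ} (hlam : ∀ j, 1 < lam j)
    (e : (ZMod m)ˣ ≃* Multiplicative (∀ j : Fin K, ZMod (lam j))) (hq : IsPrimePow q) :
    omegaQ m q ≤ (Finset.univ.filter fun j => q ∣ lam j).card ∧
      (Finset.univ.filter fun j => q ∣ lam j).card ≤ omegaQ m q + (1 + padicValNat 2 m) := by
  obtain ⟨l, b, hl, hb, rfl⟩ := (isPrimePow_nat_iff q).mp hq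
  obtain ⟨a, rfl⟩ : ∃ a, b = a + 1 := ⟨b - 1, by omega⟩
  have hmem : ∀ p : m.primeFactors, (p : ℕ).Prime ∧ m.factorization p ≠ 0 := fun p =>
    ⟨Nat.prime_of_mem_primeFactors p.2, Finsupp.mem_support_iff.mp
      ((Nat.support_factorization m).symm ▸ p.2)⟩
  choose s hs hs1 hs2 using fun p : m.primeFactors =>
    exists_hasPowRank_units_zmod_prime_pow (hmem p).1 (hmem p).2 hl a
  have hne : ∀ j, NeZero (lam j) := fun j => ⟨by have := hlam j; omega⟩
  have : Finite (Multiplicative (∀ j, ZMod (lam j))) :=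
    Finite.of_equiv (∀ j, ZMod (lam j)) Multiplicative.ofAdd
  have hr := ((HasPowRank.pi hs).congr ((unitsZModEquivPi hm).symm.trans e)).unique hl.one_lt
    (hasPowRank_pi_zmod hlam hl a)
  have homega : omegaQ m (l ^ (a + 1)) = ∑ p : m.primeFactors,
      if (p : ℕ) % l ^ (a + 1) = 1 % l ^ (a + 1) then 1 else 0 := by
    rw [omegaQ, Finset.card_filter, ← Finset.sum_coe_sort]
  rw [← hr, homega]
  refine ⟨Finset.sum_le_sum fun p _ => hs1 p,
    (Finset.sum_le_sum fun p _ => hs2 p).trans ?_⟩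
  rw [Finset.sum_add_distrib]
  refine Nat.add_le_add_left ?_ _
  have hterm : ∀ p : m.primeFactors, (if (p : ℕ) = l then 1 + (2 ^ m.factorization p).factorization
      p * (if (p : ℕ) = 2 then 1 else 0) else 0) ≤ if (p : ℕ) = l then 1 + padicValNat 2 m else 0 := by
    intro p
    by_cases hp : (p : ℕ) = l
    · rw [if_pos hp, if_pos hp]
      by_cases hp2 : (p : ℕ) = 2
      · rw [if_pos hp2, hp2, Nat.prime_two.factorization_pow, ← Nat.factorization_def m Nat.prime_two]
        simp
      · rw [if_neg hp2]; omega
    · rw [if_neg hp, if_neg hp]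
  refine (Finset.sum_le_sum fun p _ => hterm p).trans ?_
  rw [Finset.sum_coe_sort m.primeFactors fun p => if p = l then 1 + padicValNat 2 m else 0,
    Finset.sum_ite_eq']
  split_ifs
  · exact le_rfl
  · exact Nat.zero_le _

theorem isPrimePow_dvd_lcm_iff {q a b : ℕ} (hq : IsPrimePow q) (ha : a ≠ 0) (hb : b ≠ 0) :
    q ∣ a.lcm b ↔ q ∣ a ∨ q ∣ b := by
  obtain ⟨p, k, hp, -, rfl⟩ := (isPrimePow_nat_iff q).mp hq
  rw [hp.pow_dvd_iff_le_factorization (Nat.lcm_ne_zero ha hb), Nat.factorization_lcm ha hb,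
    hp.pow_dvd_iff_le_factorization ha, hp.pow_dvd_iff_le_factorization hb, Finsupp.sup_apply]
  exact le_sup_iff

theorem isPrimePow_dvd_finset_lcm_iff {ι : Type*} {q : ℕ} (hq : IsPrimePow q) (s : Finset ι)
    {f : ι → ℕ} (hf : ∀ i ∈ s, f i ≠ 0) : q ∣ s.lcm f ↔ ∃ i ∈ s, q ∣ f i := by
  classical
  induction s using Finset.induction_on with
  | empty => simpa using hq.ne_one
  | insert i s _ ih =>
    have hf' : ∀ j ∈ s, f j ≠ 0 := fun j hj => hf j (Finset.mem_insert_of_mem hj)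
    have hs : s.lcm f ≠ 0 := by
      rw [Ne, Finset.lcm_eq_zero_iff]
      simpa using fun j hj => hf' j hj
    rw [Finset.lcm_insert, lcm_eq_nat_lcm,
      isPrimePow_dvd_lcm_iff hq (hf i (Finset.mem_insert_self i s)) hs, ih hf']
    simp

/-- Distinct prime powers with equal totients are coprime, and the larger one is prime. -/
theorem coprime_of_totient_eq {q q' : ℕ} (hq : IsPrimePow q) (hq' : IsPrimePow q') (hlt : q ≠ q')
    (h : q.totient = q'.totient) :
    q.Coprime q' ∧ (q = q.totient + 1 ∨ q' = q.totient + 1) := by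
  obtain ⟨p, s, hp, hs, rfl⟩ := (isPrimePow_nat_iff q).mp hq
  obtain ⟨l, t, hl, ht, rfl⟩ := (isPrimePow_nat_iff q').mp hq'
  have key : ∀ {p l s t : ℕ}, p.Prime → l.Prime → 0 < s → 0 < t →
      (p ^ s).totient = (l ^ t).totient → p < l → l ^ t = (p ^ s).totient + 1 := by
    intro p l s t hp hl hs ht h hpl
    rcases Nat.lt_or_ge 1 t with ht1 | ht1
    · exfalso
      rw [Nat.totient_prime_pow hp hs, Nat.totient_prime_pow hl ht] at h
      have hdvd : l ∣ p ^ (s - 1) * (p - 1) :=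
        h ▸ Dvd.dvd.mul_right (dvd_pow_self l (by omega)) _
      rcases (Nat.Prime.dvd_mul hl).mp hdvd with h1 | h1
      · exact hpl.ne' ((Nat.prime_dvd_prime_iff_eq hl hp).mp (hl.dvd_of_dvd_pow h1))
      · have := Nat.le_of_dvd (by have := hp.two_le; omega) h1
        omega
    · obtain rfl : t = 1 := by omega
      rw [h, pow_one, Nat.totient_prime hl]
      have := hl.one_le
      omega
  have hpl : p ≠ l := by
    rintro rfl
    rw [Nat.totient_prime_pow hp hs, Nat.totient_prime_pow hp ht] at h
    have h1 := Nat.pow_right_injective hp.two_le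
      (Nat.eq_of_mul_eq_mul_right (by have := hp.two_le; omega) h)
    exact hlt (by rw [show s = t by omega])
  refine ⟨Nat.Coprime.pow _ _ ((Nat.coprime_primes hp hl).mpr hpl), ?_⟩
  rcases hpl.lt_or_gt with hlt' | hlt'
  · exact Or.inr (key hp hl hs ht h hlt')
  · exact Or.inl (h ▸ key hl hp ht hs h.symm hlt')

theorem eq_or_eq_of_totient_eq {a b q : ℕ} (ha : IsPrimePow a) (hb : IsPrimePow b)
    (hq : IsPrimePow q) (hab : a ≠ b) (h : a.totient = b.totient) (hqa : q.totient = a.totient) :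
    q = a ∨ q = b := by
  by_contra! hne
  have h1 := (coprime_of_totient_eq ha hb hab h).2
  have h2 := (coprime_of_totient_eq hq ha hne.1 hqa).2
  have h3 := (coprime_of_totient_eq hq hb hne.2 (hqa.trans h)).2
  omega

theorem ppKey_lt_of_totient_lt {q q' : ℕ} (hq : IsPrimePow q) (h : q.totient < q'.totient) :
    ppKey q < ppKey q' := by
  have h1 := le_two_mul_totient_of_isPrimePow hq
  have h2 : (q.totient + 1) ^ 2 ≤ q'.totient ^ 2 := Nat.pow_le_pow_left h 2
  have h3 : 0 < q' := Nat.totient_pos.mp (by omega)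
  unfold ppKey
  nlinarith

theorem totient_le_of_ppKey_le {q q' : ℕ} (hq' : IsPrimePow q')
    (h : ppKey q ≤ ppKey q') : q.totient ≤ q'.totient := by
  by_contra! h'
  exact (ppKey_lt_of_totient_lt hq' h').not_ge h

theorem ppKey_injOn {q q' : ℕ} (hq : IsPrimePow q) (hq' : IsPrimePow q')
    (h : ppKey q = ppKey q') : q = q' := by
  have h1 := (totient_le_of_ppKey_le hq' h.le).antisymm (totient_le_of_ppKey_le hq h.ge)
  unfold ppKey at h
  rw [h1] at h
  omega

theorem infinite_ppKey : (Set.ofPred fun k => ∃ q, IsPrimePow q ∧ ppKey q = k).Infinite := by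
  have h : {p : ℕ | p.Prime}.Infinite := Nat.infinite_setOfPred_prime
  refine (h.image (f := ppKey) fun p hp q hq hpq =>
    ppKey_injOn (Nat.Prime.isPrimePow hp) (Nat.Prime.isPrimePow hq) hpq).mono ?_
  rintro _ ⟨p, hp, rfl⟩
  exact ⟨p, Nat.Prime.isPrimePow hp, rfl⟩

theorem qt_spec (i : ℕ) : IsPrimePow (qt i) ∧ ppKey (qt i) = ppNthKey (i - 1) :=
  Nat.sInf_mem (s := {q : ℕ | IsPrimePow q ∧ ppKey q = ppNthKey (i - 1)})
    (Nat.nth_mem_of_infinite infinite_ppKey (i - 1))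

theorem ppKey_qt_lt {i j : ℕ} (hi : 1 ≤ i) (hij : i < j) : ppKey (qt i) < ppKey (qt j) := by
  rw [(qt_spec i).2, (qt_spec j).2]
  exact Nat.nth_strictMono infinite_ppKey (by omega)

theorem totient_qt_le {i j : ℕ} (hi : 1 ≤ i) (hij : i ≤ j) :
    (qt i).totient ≤ (qt j).totient := by
  rcases hij.eq_or_lt with rfl | hij
  · exact le_rfl
  · exact totient_le_of_ppKey_le (qt_spec j).1 (ppKey_qt_lt hi hij).le

theorem qt_ne {i j : ℕ} (hi : 1 ≤ i) (hij : i < j) : qt i ≠ qt j := fun h =>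
  (ppKey_qt_lt hi hij).ne (congrArg ppKey h)

theorem exists_qt_eq {q : ℕ} (hq : IsPrimePow q) : ∃ i, 1 ≤ i ∧ qt i = q := by
  have h : ppKey q ∈ Set.range (Nat.nth fun k => ∃ q, IsPrimePow q ∧ ppKey q = k) := by
    rw [Nat.range_nth_of_infinite infinite_ppKey]
    exact ⟨q, hq, rfl⟩
  obtain ⟨n, hn⟩ := h
  exact ⟨n + 1, by omega, ppKey_injOn (qt_spec _).1 hq ((qt_spec (n + 1)).2.trans hn)⟩

theorem exists_qt_eq_of_totient_lt {q i : ℕ} (hq : IsPrimePow q)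
    (h : q.totient < (qt i).totient) (hi : 1 ≤ i) : ∃ j ∈ Finset.Icc 1 (i - 1), qt j = q := by
  obtain ⟨j, hj, rfl⟩ := exists_qt_eq hq
  refine ⟨j, Finset.mem_Icc.mpr ⟨hj, ?_⟩, rfl⟩
  by_contra! hij
  exact absurd (totient_qt_le hi (by omega : i ≤ j)) h.not_ge

theorem Lseq_ne_zero (i : ℕ) : Lseq i ≠ 0 := by
  rw [Lseq, Ne, Finset.lcm_eq_zero_iff]
  simpa using fun j _ _ => (qt_spec j).1.ne_zero

theorem totient_le_of_dvd_qt {q j : ℕ} (h : q ∣ qt j) : q.totient ≤ (qt j).totient :=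
  Nat.le_of_dvd (Nat.totient_pos.mpr (qt_spec j).1.pos) (Nat.totient_dvd_of_dvd h)

/-- The prime powers dividing an element of a two-element universal factor order set. -/
theorem exists_coprime_of_mem_UFO {i d : ℕ} (hi : 1 ≤ i) (h2 : (UFO i).ncard = 2)
    (hd : d ∈ UFO i) :
    ∃ a b, IsPrimePow a ∧ IsPrimePow b ∧ a.Coprime b ∧ a.totient = b.totient ∧
      (∀ q, IsPrimePow q → q.totient = a.totient → q = a ∨ q = b) ∧
      (∀ q, IsPrimePow q → (q ∣ d ↔ q.totient < a.totient ∨ q = a)) ∧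
      sigSeq i = √(1 / a.totient + 1 / b.totient - 2 / ((a.totient : ℝ) * b.totient)) := by
  have hnlt : ¬ (qt i).totient < (qt (i + 1)).totient := fun h => by
    rw [UFO, if_pos h, Set.ncard_singleton] at h2
    omega
  rw [UFO, if_neg hnlt] at hd
  have hφ : (qt i).totient = (qt (i + 1)).totient :=
    (totient_qt_le hi (Nat.le_succ i)).antisymm (not_lt.mp hnlt)
  have ha := (qt_spec i).1
  have hb := (qt_spec (i + 1)).1
  have hne : qt i ≠ qt (i + 1) := qt_ne hi (Nat.lt_succ_self i)
  have hco := (coprime_of_totient_eq ha hb hne hφ).1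
  have hor : ∀ q, IsPrimePow q → q.totient = (qt i).totient → q = qt i ∨ q = qt (i + 1) :=
    fun q hq hqa => eq_or_eq_of_totient_eq ha hb hq hne hφ hqa
  have hdvd : ∀ j ≤ i, ∀ q, IsPrimePow q →
      (q ∣ Lseq j ↔ ∃ k ∈ Finset.Icc 1 j, q ∣ qt k) := fun j _ q hq =>
    isPrimePow_dvd_finset_lcm_iff hq _ fun k _ => (qt_spec k).1.ne_zero
  have hsmall : ∀ k, 1 ≤ k → k < i → ∀ q, IsPrimePow q → q ∣ qt k →
      q.totient < (qt i).totient := by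
    intro k hk hki q hq hqk
    refine lt_of_le_of_ne ((totient_le_of_dvd_qt hqk).trans (totient_qt_le hk hki.le)) fun h => ?_
    have h1 : (qt k).totient = (qt i).totient :=
      (totient_qt_le hk hki.le).antisymm (h ▸ totient_le_of_dvd_qt hqk)
    rcases hor _ (qt_spec k).1 h1 with h' | h'
    · exact qt_ne hk hki h'
    · exact qt_ne hk (by omega) h'
  have hself : ∀ {q c c' : ℕ}, IsPrimePow q → (∀ q, IsPrimePow q → q.totient = c.totient →
      q = c ∨ q = c') → c.Coprime c' → 0 < c → q ∣ c → q.totient < c.totient ∨ q = c := by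
    intro q c c' hq hor' hco' hc hqc
    rcases (Nat.le_of_dvd (Nat.totient_pos.mpr hc) (Nat.totient_dvd_of_dvd hqc)).lt_or_eq
      with h | h
    · exact Or.inl h
    · rcases hor' q hq h with h' | h'
      · exact Or.inr h'
      · exact absurd (Nat.eq_one_of_dvd_coprimes hco' hqc (h' ▸ dvd_rfl)) hq.ne_one
  rcases hd with rfl | hd
  · refine ⟨qt i, qt (i + 1), ha, hb, hco, hφ, hor, fun q hq => ?_, rfl⟩
    rw [hdvd i le_rfl q hq]
    constructor
    · rintro ⟨k, hk, hqk⟩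
      obtain ⟨hk1, hk2⟩ := Finset.mem_Icc.mp hk
      rcases hk2.lt_or_eq with hk2 | rfl
      · exact Or.inl (hsmall k hk1 hk2 q hq hqk)
      · exact hself hq hor hco ha.pos hqk
    · rintro (h | rfl)
      · obtain ⟨j, hj, rfl⟩ := exists_qt_eq_of_totient_lt hq h hi
        exact ⟨j, Finset.Icc_subset_Icc_right (Nat.sub_le i 1) hj, dvd_rfl⟩
      · exact ⟨i, Finset.mem_Icc.mpr ⟨hi, le_rfl⟩, dvd_rfl⟩
  · rw [Set.mem_singleton_iff] at hd
    subst hd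
    have hor' : ∀ q, IsPrimePow q → q.totient = (qt (i + 1)).totient → q = qt (i + 1) ∨ q = qt i :=
      fun q hq hqa => (hor q hq (hqa.trans hφ.symm)).symm
    refine ⟨qt (i + 1), qt i, hb, ha, hco.symm, hφ.symm, hor', fun q hq => ?_, ?_⟩
    · rw [isPrimePow_dvd_lcm_iff hq (Lseq_ne_zero _) hb.ne_zero, hdvd (i - 1) (Nat.sub_le i 1) q hq,
        ← hφ]
      constructor
      · rintro (⟨k, hk, hqk⟩ | h)
        · obtain ⟨hk1, hk2⟩ := Finset.mem_Icc.mp hk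
          exact Or.inl (hsmall k hk1 (by omega) q hq hqk)
        · rw [hφ]
          exact hself hq hor' hco.symm hb.pos h
      · rintro (h | rfl)
        · obtain ⟨j, hj, rfl⟩ := exists_qt_eq_of_totient_lt hq h hi
          exact Or.inl ⟨j, hj, dvd_rfl⟩
        · exact Or.inr dvd_rfl
    · rw [sigSeq, phiQ, phiQ]
      congr 1
      ring

/-- The indices `j` with `q ∣ λ_j`. -/
def dvdSet {K : ℕ} (lam : Fin K → ℕ) (q : ℕ) : Finset (Fin K) :=
  Finset.univ.filter fun j => q ∣ lam j

theorem mem_dvdSet {K : ℕ} {lam : Fin K → ℕ} {q : ℕ} {j : Fin K} :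
    j ∈ dvdSet lam q ↔ q ∣ lam j := by
  simp [dvdSet]

theorem dvdSet_subset_or_subset {K : ℕ} {lam : Fin K → ℕ}
    (hchain : ∀ j k : Fin K, j ≤ k → lam j ∣ lam k) (p q : ℕ) :
    dvdSet lam p ⊆ dvdSet lam q ∨ dvdSet lam q ⊆ dvdSet lam p := by
  by_contra! h
  obtain ⟨⟨j, hj, hj'⟩, k, hk, hk'⟩ := h.imp Finset.not_subset.mp Finset.not_subset.mp
  rw [mem_dvdSet] at hj hj' hk hk'
  rcases le_total j k with hjk | hjk
  · exact hk' (hj.trans (hchain j k hjk))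
  · exact hj' (hk.trans (hchain k j hjk))

theorem card_dvdSet_sdiff {K : ℕ} {lam : Fin K → ℕ}
    (hchain : ∀ j k : Fin K, j ≤ k → lam j ∣ lam k) (p q : ℕ) :
    ((dvdSet lam p \ dvdSet lam q).card : ℝ) =
      max (((dvdSet lam p).card : ℝ) - (dvdSet lam q).card) 0 := by
  rcases dvdSet_subset_or_subset hchain p q with h | h
  · rw [Finset.sdiff_eq_empty_iff_subset.mpr h, Finset.card_empty, Nat.cast_zero, max_eq_right]
    exact sub_nonpos.mpr (by exact_mod_cast Finset.card_le_card h)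
  · have h' : ((dvdSet lam q).card : ℝ) ≤ (dvdSet lam p).card := by
      exact_mod_cast Finset.card_le_card h
    rw [max_eq_left (sub_nonneg.mpr h'), Finset.card_sdiff_of_subset h,
      Nat.cast_sub (Finset.card_le_card h)]

theorem exists_isPrimePow_dvd_of_ne {x y : ℕ} (h : x ≠ y) :
    ∃ q, IsPrimePow q ∧ (q ∣ x ∧ ¬ q ∣ y ∨ q ∣ y ∧ ¬ q ∣ x) := by
  by_contra! hq
  refine h (Nat.dvd_antisymm ?_ ?_) <;> rw [Nat.dvd_iff_prime_pow_dvd_dvd] <;>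
    intro p k hp hpk <;> rcases Nat.eq_zero_or_pos k with rfl | hk
  · simp
  · exact (hq _ (hp.isPrimePow.pow hk.ne')).1 hpk
  · simp
  · exact (hq _ (hp.isPrimePow.pow hk.ne')).2 hpk

/-- The prime powers with totient less than that of `a`. -/
def smallPP (a : ℕ) : Finset ℕ :=
  (Finset.range (2 * a.totient)).filter fun q => IsPrimePow q ∧ q.totient < a.totient

/-- The prime powers below `Q` with totient greater than that of `a`. -/
def largePP (a Q : ℕ) : Finset ℕ :=
  (Finset.range Q).filter fun q => IsPrimePow q ∧ a.totient < q.totient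

theorem card_eq_le_max {K : ℕ} {lam : Fin K → ℕ}
    (hchain : ∀ j k : Fin K, j ≤ k → lam j ∣ lam k) {d a b : ℕ} (ha : a ∣ d) (hb : ¬ b ∣ d) :
    ((Finset.univ.filter fun j => lam j = d).card : ℝ) ≤
      max (((dvdSet lam a).card : ℝ) - (dvdSet lam b).card) 0 := by
  rw [← card_dvdSet_sdiff hchain]
  refine Nat.cast_le.mpr (Finset.card_le_card fun j hj => ?_)
  rw [(Finset.mem_filter.mp hj).2.symm] at ha hb
  rw [Finset.mem_sdiff, mem_dvdSet, mem_dvdSet]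
  exact ⟨ha, hb⟩

theorem max_le_card_eq_add {K n Q d a b : ℕ} {lam : Fin K → ℕ}
    (hchain : ∀ j k : Fin K, j ≤ k → lam j ∣ lam k) (hlam : ∀ j, 0 < lam j ∧ lam j ≤ n)
    (hab : ∀ q, IsPrimePow q → q.totient = a.totient → q = a ∨ q = b)
    (hd : ∀ q, IsPrimePow q → (q ∣ d ↔ q.totient < a.totient ∨ q = a)) {X : ℝ} (hX0 : 0 ≤ X)
    (hX : ∀ q ∈ (Finset.Icc Q n).filter IsPrimePow,
      ((dvdSet lam q).card : ℝ) - (dvdSet lam b).card ≤ X) :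
    max (((dvdSet lam a).card : ℝ) - (dvdSet lam b).card) 0 ≤
      (Finset.univ.filter fun j => lam j = d).card +
      ∑ q ∈ smallPP a, max (((dvdSet lam a).card : ℝ) - (dvdSet lam q).card) 0 +
      ∑ q ∈ largePP a Q, max (((dvdSet lam q).card : ℝ) - (dvdSet lam b).card) 0 + X := by
  set B := (Finset.Icc Q n).filter IsPrimePow
  set U := B.biUnion fun q => dvdSet lam q \ dvdSet lam b
  have hU : (U.card : ℝ) ≤ X := by
    rcases B.eq_empty_or_nonempty with hB | hB
    · simp [U, hB, hX0]
    · obtain ⟨q, hq, hmax⟩ := Finset.exists_max_image B (fun q => (dvdSet lam q).card) hB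
      have hsub : U ⊆ dvdSet lam q \ dvdSet lam b := by
        refine Finset.biUnion_subset.mpr fun p hp => Finset.sdiff_subset_sdiff ?_ subset_rfl
        rcases dvdSet_subset_or_subset hchain p q with h | h
        · exact h
        · exact (Finset.eq_of_subset_of_card_le h (hmax p hp)).ge
      calc (U.card : ℝ) ≤ (dvdSet lam q \ dvdSet lam b).card :=
            Nat.cast_le.mpr (Finset.card_le_card hsub)
        _ ≤ X := by
            rw [card_dvdSet_sdiff hchain]
            exact max_le (hX q hq) hX0
  have hcover : dvdSet lam a \ dvdSet lam b ⊆
      ((Finset.univ.filter fun j => lam j = d) ∪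
        (smallPP a).biUnion fun q => dvdSet lam a \ dvdSet lam q) ∪
        ((largePP a Q).biUnion fun q => dvdSet lam q \ dvdSet lam b) ∪ U := by
    intro j hj
    rw [Finset.mem_sdiff, mem_dvdSet, mem_dvdSet] at hj
    by_cases hjd : lam j = d
    · simp [hjd]
    obtain ⟨q, hq, ⟨hqj, hqd⟩ | ⟨hqd, hqj⟩⟩ := exists_isPrimePow_dvd_of_ne hjd
    · rw [hd q hq, not_or, not_lt] at hqd
      have hlt : a.totient < q.totient := by
        refine lt_of_le_of_ne hqd.1 fun h => ?_
        rcases hab q hq h.symm with rfl | rfl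
        · exact hqd.2 rfl
        · exact hj.2 hqj
      rcases lt_or_ge q Q with hqQ | hqQ
      · refine Finset.mem_union_left _ (Finset.mem_union_right _ (Finset.mem_biUnion.mpr
          ⟨q, ?_, ?_⟩))
        · simp [largePP, hqQ, hq, hlt]
        · simp [mem_dvdSet, hqj, hj.2]
      · refine Finset.mem_union_right _ (Finset.mem_biUnion.mpr ⟨q, ?_, ?_⟩)
        · have := (Nat.le_of_dvd (hlam j).1 hqj).trans (hlam j).2
          simp [B, hqQ, hq, this]
        · simp [mem_dvdSet, hqj, hj.2]
    · have hlt : q.totient < a.totient := by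
        rcases (hd q hq).mp hqd with h | rfl
        · exact h
        · exact absurd hj.1 hqj
      refine Finset.mem_union_left _ (Finset.mem_union_left _ (Finset.mem_union_right _
        (Finset.mem_biUnion.mpr ⟨q, ?_, ?_⟩)))
      · have := le_two_mul_totient_of_isPrimePow hq
        simp only [smallPP, Finset.mem_filter, Finset.mem_range]
        exact ⟨by omega, hq, hlt⟩
      · simp [mem_dvdSet, hqj, hj.1]
  simp only [← card_dvdSet_sdiff hchain]
  refine le_trans ?_ (add_le_add_right hU _)
  exact_mod_cast (Finset.card_le_card hcover).trans <|
    (Finset.card_union_le _ _).trans <| Nat.add_le_add_right ((Finset.card_union_le _ _).trans <|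
      Nat.add_le_add ((Finset.card_union_le _ _).trans <|
        Nat.add_le_add_left Finset.card_biUnion_le _) Finset.card_biUnion_le) _

theorem max_sub_le_max_sub_add {r s x y V : ℝ} (hV : 0 ≤ V) (hr : r ≤ x + V) (hs : y ≤ s) :
    max (r - s) 0 ≤ max (x - y) 0 + V :=
  max_le (by linarith [le_max_left (x - y) 0]) (by linarith [le_max_right (x - y) 0])

/-- The invariant factor count compared with positive parts of differences of `ω(m; q, 1)`. -/
theorem IsInvCount.bounds {d : ℕ} {J : ℕ → ℕ} (hJ : IsInvCount d J) {a b : ℕ}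
    (ha : IsPrimePow a) (hb : IsPrimePow b) (hne : a ≠ b) (hφ : a.totient = b.totient)
    (hab : ∀ q, IsPrimePow q → q.totient = a.totient → q = a ∨ q = b)
    (hd : ∀ q, IsPrimePow q → (q ∣ d ↔ q.totient < a.totient ∨ q = a)) {n m : ℕ}
    (hm : m ∈ Finset.Icc 1 n) (Q : ℕ) (T : ℝ) :
    (J m : ℝ) ≤ max ((omegaQ m a : ℝ) - omegaQ m b) 0 + (1 + padicValNat 2 m) ∧
    max ((omegaQ m a : ℝ) - omegaQ m b) 0 ≤ J m + (1 + padicValNat 2 m) +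
      ∑ q ∈ smallPP a, (max ((omegaQ m a : ℝ) - omegaQ m q) 0 + (1 + padicValNat 2 m)) +
      ∑ q ∈ largePP a Q, (max ((omegaQ m q : ℝ) - omegaQ m b) 0 + (1 + padicValNat 2 m)) +
      ((1 + padicValNat 2 m) + max (T - omegaQ m b) 0 +
        ∑ q ∈ (Finset.Icc Q n).filter IsPrimePow, max ((omegaQ m q : ℝ) - T) 0) := by
  obtain ⟨hm1, hmn⟩ := Finset.mem_Icc.mp hm
  have hm0 : m ≠ 0 := by omega
  have hne' : NeZero m := ⟨hm0⟩
  obtain ⟨K, lam, hlam, hchain, ⟨e⟩⟩ := exists_invariantFactors (ZMod m)ˣ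
  rw [hJ m hm1 K lam hlam hchain ⟨e⟩]
  set V : ℝ := 1 + padicValNat 2 m with hV
  have hV0 : 0 ≤ V := by positivity
  have hr : ∀ q, IsPrimePow q → (omegaQ m q : ℝ) ≤ (dvdSet lam q).card ∧
      ((dvdSet lam q).card : ℝ) ≤ omegaQ m q + V := fun q hq => by
    obtain ⟨h1, h2⟩ := omegaQ_le_card_dvd_le hm0 hlam e hq
    exact ⟨by exact_mod_cast h1, by rw [hV]; exact_mod_cast h2⟩
  have hlam' : ∀ j, 0 < lam j ∧ lam j ≤ n := fun j => by
    have hpos : ∀ j, 0 < lam j := fun j => zero_lt_one.trans (hlam j)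
    refine ⟨hpos j, ?_⟩
    have hcard : ∏ j, lam j = m.totient := by
      rw [← ZMod.card_units_eq_totient, ← Nat.card_eq_fintype_card, Nat.card_congr e.toEquiv,
        Nat.card_congr Multiplicative.toAdd, Nat.card_pi]
      exact Finset.prod_congr rfl fun j _ => (Nat.card_zmod _).symm
    exact (Nat.le_of_dvd (Nat.totient_pos.mpr hm1)
      (hcard ▸ Finset.dvd_prod_of_mem lam (Finset.mem_univ j))).trans
      ((Nat.totient_le m).trans hmn)
  have had : a ∣ d := (hd a ha).mpr (Or.inr rfl)
  have hbd : ¬ b ∣ d := fun h => by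
    rcases (hd b hb).mp h with h | h
    · exact h.ne hφ.symm
    · exact hne h.symm
  refine ⟨(card_eq_le_max hchain had hbd).trans
    (max_sub_le_max_sub_add hV0 (hr a ha).2 (hr b hb).1), ?_⟩
  set X : ℝ := V + max (T - omegaQ m b) 0 +
    ∑ q ∈ (Finset.Icc Q n).filter IsPrimePow, max ((omegaQ m q : ℝ) - T) 0
  have hsum0 : ∀ q ∈ (Finset.Icc Q n).filter IsPrimePow, 0 ≤ max ((omegaQ m q : ℝ) - T) 0 :=
    fun q _ => le_max_right _ _
  have hX0 : 0 ≤ X := add_nonneg (add_nonneg hV0 (le_max_right _ _)) (Finset.sum_nonneg hsum0)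
  have hX : ∀ q ∈ (Finset.Icc Q n).filter IsPrimePow,
      ((dvdSet lam q).card : ℝ) - (dvdSet lam b).card ≤ X := fun q hq => by
    have h1 := Finset.single_le_sum hsum0 hq
    have h2 := (hr q (Finset.mem_filter.mp hq).2).2
    have h3 := (hr b hb).1
    linarith [le_max_left ((omegaQ m q : ℝ) - T) 0, le_max_left (T - (omegaQ m b : ℝ)) 0]
  have hmain := max_le_card_eq_add hchain hlam' hab hd hX0 hX
  have h1 : max ((omegaQ m a : ℝ) - omegaQ m b) 0 ≤
      max (((dvdSet lam a).card : ℝ) - (dvdSet lam b).card) 0 + V :=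
    max_le (by linarith [(hr a ha).1, (hr b hb).2,
        le_max_left (((dvdSet lam a).card : ℝ) - (dvdSet lam b).card) 0])
      (add_nonneg (le_max_right _ _) hV0)
  have h2 : ∑ q ∈ smallPP a, max (((dvdSet lam a).card : ℝ) - (dvdSet lam q).card) 0 ≤
      ∑ q ∈ smallPP a, (max ((omegaQ m a : ℝ) - omegaQ m q) 0 + V) :=
    Finset.sum_le_sum fun q hq => max_sub_le_max_sub_add hV0 (hr a ha).2
      (hr q (Finset.mem_filter.mp hq).2.1).1
  have h3 : ∑ q ∈ largePP a Q, max (((dvdSet lam q).card : ℝ) - (dvdSet lam b).card) 0 ≤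
      ∑ q ∈ largePP a Q, (max ((omegaQ m q : ℝ) - omegaQ m b) 0 + V) :=
    Finset.sum_le_sum fun q hq => max_sub_le_max_sub_add hV0
      (hr q (Finset.mem_filter.mp hq).2.1).2 (hr b hb).1
  linarith

theorem isBigO_of_nonneg_of_eventually_le {f g h : ℕ → ℝ} (hf : ∀ n, 0 ≤ f n)
    (hfg : ∀ᶠ n in atTop, f n ≤ g n) (hg : g =O[atTop] h) : f =O[atTop] h := by
  refine (Asymptotics.IsBigO.of_bound 1 ?_).trans hg
  filter_upwards [hfg] with n hn
  rw [one_mul, Real.norm_of_nonneg (hf n)]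
  exact hn.trans (Real.le_norm_self _)

theorem exists_mean_posPart_truncAdd_le_of_tendsto {f : ℕ → ℝ} (hf : ∀ p, |f p| ≤ 1) {T : ℕ → ℝ}
    (hT : ∀ᶠ n in atTop, T n ≤ LL n) {c : ℝ} (hc : c < 0)
    (h : Tendsto (fun n => (∑ p ∈ primesAP 1 (truncLevel n), f p / p + T n) / LL n) atTop
      (nhds c)) :
    ∃ C : ℝ, ∀ᶠ n in atTop,
      mean (fun m => max (truncAdd f (truncLevel n) m + T n) 0) n ≤ C := by
  refine exists_mean_posPart_truncAdd_le hf (c := -c / 2) (by linarith) hT ?_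
  filter_upwards [h.eventually_le_const (by linarith : c < c / 2),
    tendsto_LL.eventually_gt_atTop 0] with n hn hL
  rw [div_le_iff₀ hL] at hn
  linarith

theorem posPart_omegaQ_sub_le {n m : ℕ} (hm : m ∈ Finset.Icc 1 n) (hn : truncLevel n ≤ n)
    (q q' : ℕ) :
    |max ((omegaQ m q : ℝ) - omegaQ m q') 0 -
      max (truncAdd (fun p => indAP q p - indAP q' p) (truncLevel n) m) 0| ≤ tailCount n m := by
  refine (abs_max_sub_max_le_abs _ _ _).trans ?_
  rw [omegaQ_eq_truncAdd hm, omegaQ_eq_truncAdd hm, truncAdd_sub]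
  have h1 := truncAdd_sub_nonneg (indAP_nonneg q) hn m
  have h2 := truncAdd_sub_nonneg (indAP_nonneg q') hn m
  have h3 := truncAdd_sub_le (g := fun _ => 1) (indAP_le_one q) hn m
  have h4 := truncAdd_sub_le (g := fun _ => 1) (indAP_le_one q') hn m
  rw [tailCount, abs_le]
  constructor <;> linarith

theorem isBigO_mean_posPart_omegaQ_sub {q q' : ℕ} (hq' : 0 < q')
    (h : q'.totient < q.totient) :
    (fun n => mean (fun m => max ((omegaQ m q : ℝ) - omegaQ m q') 0) n) =O[atTop]
      fun n => Real.log (LL n) := by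
  have : NeZero q := ⟨by rintro rfl; simp at h⟩
  have : NeZero q' := ⟨hq'.ne'⟩
  have hpos : (0 : ℝ) < q'.totient := by exact_mod_cast Nat.totient_pos.mpr hq'
  have hlt : (q'.totient : ℝ) < q.totient := by exact_mod_cast h
  obtain ⟨C, hC⟩ := exists_mean_posPart_truncAdd_le_of_tendsto (abs_indAP_sub_le_one q q')
    (T := fun _ => 0) (tendsto_LL.eventually_ge_atTop 0)
    (sub_neg.mpr (one_div_lt_one_div_of_lt hpos hlt))
    (((tendsto_recipAP_truncLevel_div q).sub (tendsto_recipAP_truncLevel_div q')).congr fun n => by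
      simp only [sub_div, Finset.sum_sub_distrib, sum_indAP_div, add_zero])
  refine isBigO_of_nonneg_of_eventually_le (fun n => mean_nonneg fun m _ => le_max_right _ _)
    (g := fun n => C + mean (tailCount n) n) ?_
    ((isBigO_const_log_LL C).add isBigO_mean_tailCount)
  filter_upwards [hC, eventually_truncLevel_le] with n hn hY
  simp only [add_zero] at hn
  refine le_trans ?_ (add_le_add_left hn _)
  rw [← mean_add]
  refine mean_le_mean fun m hm => ?_
  linarith [(abs_le.mp (posPart_omegaQ_sub_le hm hY q q')).2]

theorem isBigO_mean_posPart_sub_omegaQ {b : ℕ} (hb : 0 < b) :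
    (fun n => mean (fun m => max (LL n / (2 * b.totient) - (omegaQ m b : ℝ)) 0) n) =O[atTop]
      fun n => Real.log (LL n) := by
  have : NeZero b := ⟨hb.ne'⟩
  have hpos : (1 : ℝ) ≤ b.totient := by exact_mod_cast Nat.totient_pos.mpr hb
  obtain ⟨C, hC⟩ := exists_mean_posPart_truncAdd_le_of_tendsto (f := fun p => -indAP b p)
    (fun p => (abs_neg _).trans_le (abs_indAP_le_one b p))
    (T := fun n => LL n / (2 * b.totient)) (c := -(1 / (2 * (b.totient : ℝ))))
    (by
      filter_upwards [tendsto_LL.eventually_ge_atTop 0] with n hn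
      exact div_le_self hn (by linarith))
    (by simp; linarith)
    (by
      have h := (tendsto_recipAP_truncLevel_div b).neg.add_const (1 / (2 * (b.totient : ℝ)))
      have he : -(1 / (b.totient : ℝ)) + 1 / (2 * b.totient) = -(1 / (2 * b.totient)) := by
        field_simp; norm_num
      rw [he] at h
      refine h.congr' ?_
      filter_upwards [tendsto_LL.eventually_gt_atTop 0] with n hn
      simp only [neg_div, Finset.sum_neg_distrib, sum_indAP_div]
      field_simp)
  refine isBigO_of_nonneg_of_eventually_le (fun n => mean_nonneg fun m _ => le_max_right _ _)
    (g := fun _ => C) ?_ (isBigO_const_log_LL C)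
  filter_upwards [hC, eventually_truncLevel_le] with n hn hY
  refine le_trans (mean_le_mean fun m hm => max_le_max_right 0 ?_) hn
  have h1 : truncAdd (fun p => -indAP b p) (truncLevel n) m = -truncAdd (indAP b) (truncLevel n) m :=
    Finset.sum_neg_distrib _
  rw [h1, omegaQ_eq_truncAdd hm]
  linarith [truncAdd_sub_nonneg (indAP_nonneg b) hY m]

theorem isBigO_mean_one_add_padicValNat_two :
    (fun n => mean (fun m => 1 + (padicValNat 2 m : ℝ)) n) =O[atTop]
      fun n => Real.log (LL n) := by
  refine isBigO_of_nonneg_of_eventually_le (fun n => mean_nonneg fun m _ => by positivity)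
    (g := fun _ => 2) ?_ (isBigO_const_log_LL 2)
  filter_upwards [eventually_ge_atTop 1] with n hn
  rw [mean_add, mean_const hn]
  linarith [mean_padicValNat_two_le hn]

theorem isBigO_avg_sub_mean_posPart {d : ℕ} {J : ℕ → ℕ} (hJ : IsInvCount d J) {a b : ℕ}
    (ha : IsPrimePow a) (hb : IsPrimePow b) (hne : a ≠ b) (hφ : a.totient = b.totient)
    (hab : ∀ q, IsPrimePow q → q.totient = a.totient → q = a ∨ q = b)
    (hd : ∀ q, IsPrimePow q → (q ∣ d ↔ q.totient < a.totient ∨ q = a)) :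
    (fun n => avg J n - mean (fun m => max ((omegaQ m a : ℝ) - omegaQ m b) 0) n) =O[atTop]
      fun n => Real.log (LL n) := by
  have hpos : (1 : ℝ) ≤ b.totient := by exact_mod_cast Nat.totient_pos.mpr hb.pos
  obtain ⟨Q, C, hQ⟩ := exists_sum_mean_posPart_omegaQ_le hpos
  set V : ℕ → ℝ := fun n => mean (fun m => 1 + (padicValNat 2 m : ℝ)) n with hV
  have hVO : V =O[atTop] fun n => Real.log (LL n) := isBigO_mean_one_add_padicValNat_two
  set P : ℕ → ℕ → ℕ → ℝ := fun q q' n =>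
    mean (fun m => max ((omegaQ m q : ℝ) - omegaQ m q') 0) n with hP
  set B : ℕ → ℝ := fun n =>
    mean (fun m => max (LL n / (2 * b.totient) - (omegaQ m b : ℝ)) 0) n with hB
  have hPO : ∀ q q', 0 < q' → q'.totient < q.totient →
      (fun n => P q q' n + V n) =O[atTop] fun n => Real.log (LL n) := fun q q' h h' =>
    (isBigO_mean_posPart_omegaQ_sub h h').add hVO
  have hs : (fun n => ∑ q ∈ smallPP a, (P a q n + V n)) =O[atTop] fun n => Real.log (LL n) :=
    Asymptotics.IsBigO.fun_sum fun q hq =>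
      hPO a q (Finset.mem_filter.mp hq).2.1.pos (Finset.mem_filter.mp hq).2.2
  have hl : (fun n => ∑ q ∈ largePP a Q, (P q b n + V n)) =O[atTop] fun n => Real.log (LL n) :=
    Asymptotics.IsBigO.fun_sum fun q hq =>
      hPO q b hb.pos (hφ ▸ (Finset.mem_filter.mp hq).2.2)
  have hE := (((hVO.add hs).add hl).add ((hVO.add (isBigO_mean_posPart_sub_omegaQ hb.pos)).add
    (isBigO_const_log_LL C)))
  refine (Asymptotics.IsBigO.of_bound 1 ?_).trans hE
  filter_upwards [hQ] with n hQn
  rw [one_mul]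
  refine le_trans ?_ (Real.le_norm_self _)
  have hbd := fun m (hm : m ∈ Finset.Icc 1 n) =>
    hJ.bounds ha hb hne hφ hab hd hm Q (LL n / (2 * b.totient))
  have h1 : avg J n ≤ P a b n + V n := by
    have := mean_le_mean (n := n) fun m hm => (hbd m hm).1
    rwa [mean_add] at this
  have h2 := mean_le_mean (n := n) fun m hm => (hbd m hm).2
  simp only [mean_add, mean_sum] at h2
  have hV' : V n = mean (fun _ => (1 : ℝ)) n + mean (fun m => (padicValNat 2 m : ℝ)) n :=
    mean_add _ _ n
  have hJ' : avg J n = mean (fun m => (J m : ℝ)) n := rfl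
  simp only [← hV', ← hJ'] at h2
  have hV0 : 0 ≤ V n := mean_nonneg fun m _ => by positivity
  have hP0 : ∀ q q', 0 ≤ P q q' n := fun q q' => mean_nonneg fun m _ => le_max_right _ _
  have hB0 : 0 ≤ B n := mean_nonneg fun m _ => le_max_right _ _
  have hC0 : 0 ≤ C := (Finset.sum_nonneg fun q _ => mean_nonneg fun m _ => le_max_right _ _).trans
    hQn
  have hs0 : 0 ≤ ∑ q ∈ smallPP a, (P a q n + V n) :=
    Finset.sum_nonneg fun q _ => add_nonneg (hP0 _ _) hV0
  have hl0 : 0 ≤ ∑ q ∈ largePP a Q, (P q b n + V n) :=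
    Finset.sum_nonneg fun q _ => add_nonneg (hP0 _ _) hV0
  rw [Real.norm_eq_abs, abs_le]
  change P a b n ≤ avg J n + V n + ∑ q ∈ smallPP a, (P a q n + V n) +
    ∑ q ∈ largePP a Q, (P q b n + V n) + (V n + B n + _) at h2
  change -(V n + ∑ q ∈ smallPP a, (P a q n + V n) + ∑ q ∈ largePP a Q, (P q b n + V n) +
    (V n + B n + C)) ≤ avg J n - P a b n ∧ avg J n - P a b n ≤ V n +
    ∑ q ∈ smallPP a, (P a q n + V n) + ∑ q ∈ largePP a Q, (P q b n + V n) + (V n + B n + C)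
  constructor <;> linarith

theorem isBigO_mean_posPart_sub_truncAdd (a b : ℕ) :
    (fun n => mean (fun m => max ((omegaQ m a : ℝ) - omegaQ m b) 0) n -
      mean (fun m => max (truncAdd (fun p => indAP a p - indAP b p) (truncLevel n) m) 0) n)
      =O[atTop] fun n => Real.log (LL n) := by
  refine (Asymptotics.IsBigO.of_bound 1 ?_).trans isBigO_mean_tailCount
  filter_upwards [eventually_truncLevel_le] with n hY
  rw [one_mul, ← mean_sub, Real.norm_eq_abs]
  refine le_trans (abs_le.mpr ⟨?_, ?_⟩) (Real.le_norm_self _)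
  · rw [neg_le, ← neg_one_mul, ← mean_const_mul]
    refine mean_le_mean fun m hm => ?_
    linarith [(abs_le.mp (posPart_omegaQ_sub_le hm hY a b)).1]
  · exact mean_le_mean fun m hm => (abs_le.mp (posPart_omegaQ_sub_le hm hY a b)).2

theorem statement7 (i : ℕ) (hi : 1 ≤ i) (h2 : (UFO i).ncard = 2)
    (d : ℕ) (hd : d ∈ UFO i) (J : ℕ → ℕ) (hJ : IsInvCount d J) :
    Filter.Tendsto (fun n : ℕ => avg J n / Real.sqrt (LL n))
      Filter.atTop (nhds (sigSeq i / Real.sqrt (2 * Real.pi))) := by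
  obtain ⟨a, b, ha, hb, hco, hφ, hab, hdvd, hσ⟩ := exists_coprime_of_mem_UFO hi h2 hd
  have : NeZero a := ⟨ha.ne_zero⟩
  have : NeZero b := ⟨hb.ne_zero⟩
  have hne : a ≠ b := fun h => ha.ne_one (Nat.eq_one_of_dvd_coprimes hco dvd_rfl (h ▸ dvd_rfl))
  have herr := (((isBigO_avg_sub_mean_posPart hJ ha hb hne hφ hab hdvd).add
    (isBigO_mean_posPart_sub_truncAdd a b)).trans_isLittleO
      isLittleO_log_LL_sqrt).tendsto_div_nhds_zero
  have hlim := herr.add (tendsto_mean_posPart_indAP_sub hco hφ)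
  rw [zero_add, ← hσ] at hlim
  refine hlim.congr fun n => ?_
  rw [← add_div]
  congr 1
  ring

end
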